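/- Let ℱ be the space of hypersurfaces of degree M in ℙ^M, M ≥ 10, and ℱ_reg ⊂ ℱ the subset of hypersurfaces satisfying conditions (R1.1)–(R1.3) at every non-singular point and conditions (R2.1)–(R2.3) at every singular point. Then codim((ℱ \ ℱ_reg) ⊂ ℱ) ≥ (M−7)(M−6)/2 − 5. -/

import Mathlib

/-!
Shared elementary framework: the Zariski topology on a complex vector space,
dimension of subsets (topological Krull dimension), rank of quadratic forms,
and the space 𝒫^sing of polynomials `f = q₂ + q₃ + ⋯ + q_M`.
-/

noncomputable section

open MvPolynomial

/-- A polynomial function on a complex vector space: a polynomial expression in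
finitely many linear functionals. -/
def IsPolyFun {E : Type*} [AddCommGroup E] [Module ℂ E] (g : E → ℂ) : Prop :=
  ∃ (n : ℕ) (φ : E →ₗ[ℂ] (Fin n → ℂ)) (p : MvPolynomial (Fin n) ℂ),
    ∀ v, g v = MvPolynomial.eval (φ v) p

/-- Zariski-closed subsets of a complex vector space: common zero loci of families
of polynomial functions. -/
def IsZClosed {E : Type*} [AddCommGroup E] [Module ℂ E] (A : Set E) : Prop :=
  ∃ G : Set (E → ℂ), (∀ g ∈ G, IsPolyFun g) ∧ A = {v | ∀ g ∈ G, g v = 0}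

/-- The Zariski topology on a complex vector space. -/
def zariskiTopology (E : Type*) [AddCommGroup E] [Module ℂ E] : TopologicalSpace E :=
  TopologicalSpace.generateFrom {U | IsZClosed Uᶜ}

/-- A subset is Zariski open. -/
def IsZOpen {E : Type*} [AddCommGroup E] [Module ℂ E] (A : Set E) : Prop :=
  @IsOpen E (zariskiTopology E) A

/-- The dimension of a subset of a complex vector space: the topological Krull
dimension in the induced Zariski topology. -/
def zdim {E : Type*} [AddCommGroup E] [Module ℂ E] (A : Set E) : WithBot ℕ∞ :=
  @topologicalKrullDim A (TopologicalSpace.induced Subtype.val (zariskiTopology E))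

/-- The Zariski closure of a subset of a complex vector space. -/
def zclosure {E : Type*} [AddCommGroup E] [Module ℂ E] (A : Set E) : Set E :=
  @closure E (zariskiTopology E) A

/-- The rank of the quadratic form `q` on a subset `A ⊆ ℂ^n`: the least number of
squares of linear forms expressing `q` on `A` (over `ℂ` this is the rank of the
restriction of `q`). -/
def rankOn {n : ℕ} (q : MvPolynomial (Fin n) ℂ) (A : Set (Fin n → ℂ)) : ℕ :=
  sInf {r : ℕ | ∃ l : Fin r → ((Fin n → ℂ) →ₗ[ℂ] ℂ),
    ∀ z ∈ A, MvPolynomial.eval z q = ∑ i, l i z ^ 2}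

/-- The space 𝒫^sing of polynomials `f = q₂ + q₃ + ⋯ + q_M` in `M` variables:
polynomials of total degree at most `M` whose homogeneous components of degree 0
and 1 vanish. -/
def Psing (M : ℕ) : Submodule ℂ (MvPolynomial (Fin M) ℂ) :=
  (MvPolynomial.restrictTotalDegree (Fin M) ℂ M) ⊓
    (LinearMap.ker (MvPolynomial.homogeneousComponent 0) ⊓
     LinearMap.ker (MvPolynomial.homogeneousComponent 1))

/-- The affine expansion of a homogeneous form `G` at a point `v` of the affine chart
`{z_j = 1}` (so `v j = 1`): substitute `z_j ↦ v_j` and `z_i ↦ v_i + t_i` for `i ≠ j`.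
Its homogeneous components are the terms `q_k` of the local affine equation at `v`. -/
def chartShift {N : ℕ} (G : MvPolynomial (Fin N) ℂ) (v : Fin N → ℂ) (j : Fin N) :
    MvPolynomial (Fin N) ℂ :=
  MvPolynomial.bind₁
    (fun i => if i = j then MvPolynomial.C (v i) else MvPolynomial.C (v i) + MvPolynomial.X i) G

/-- The `k`-th term of the local affine equation of `{G = 0}` at the point `v` of the
chart `{z_j = 1}`. -/
def chartComp {N : ℕ} (k : ℕ) (G : MvPolynomial (Fin N) ℂ) (v : Fin N → ℂ) (j : Fin N) :
    MvPolynomial (Fin N) ℂ :=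
  MvPolynomial.homogeneousComponent k (chartShift G v j)

/-- `C` is an irreducible component of `Z` (with respect to the Zariski topology):
a maximal irreducible subset of `Z`. -/
def IsIrredCompOf {E : Type*} [AddCommGroup E] [Module ℂ E] (C Z : Set E) : Prop :=
  C ⊆ Z ∧ @IsIrreducible E (zariskiTopology E) C ∧
    ∀ C' : Set E, C ⊆ C' → C' ⊆ Z → @IsIrreducible E (zariskiTopology E) C' → C' = C

/-- The space ℱ of hypersurfaces of degree `M` in `ℙ^M` (as the space of homogeneous
forms of degree `M` in `M+1` variables; codimensions of cone-invariant subsets agree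
with those in the projectivisation). -/
abbrev FSpace (M : ℕ) := ↥(MvPolynomial.homogeneousSubmodule (Fin (M + 1)) ℂ M)

section RegularityConditions

variable {M : ℕ} (G : MvPolynomial (Fin (M + 1)) ℂ) (v : Fin (M + 1) → ℂ) (j : Fin (M + 1))

/-- Condition (R1.1) at a non-singular point `o = v` of `F = {G = 0}` (chart `z_j = 1`):
the sequence `q₁, …, q_{M−1}` is regular in `𝒪_{o,ℙ}`, i.e. the system
`q₁ = ⋯ = q_{M−1} = 0` defines a finite set of lines through `o`. -/
def ChartR11 : Prop :=
  zdim {z : Fin (M + 1) → ℂ | z j = 0 ∧ ∀ i ∈ Finset.Icc 1 (M - 1),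
    MvPolynomial.eval z (chartComp i G v j) = 0} ≤ 1

/-- Condition (R1.2) at a non-singular point: the quadratic form `q₂` restricted to
the tangent hyperplane `{q₁ = 0}` has rank at least 6, and the linear span of every
irreducible component of `{q₁ = q₂ = q₃ = 0}` is the tangent hyperplane `{q₁ = 0}`. -/
def ChartR12 : Prop :=
  6 ≤ rankOn (chartComp 2 G v j)
        {z : Fin (M + 1) → ℂ | z j = 0 ∧ MvPolynomial.eval z (chartComp 1 G v j) = 0} ∧
  ∀ C : Set (Fin (M + 1) → ℂ),
    IsIrredCompOf C {z : Fin (M + 1) → ℂ | z j = 0 ∧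
        MvPolynomial.eval z (chartComp 1 G v j) = 0 ∧
        MvPolynomial.eval z (chartComp 2 G v j) = 0 ∧
        MvPolynomial.eval z (chartComp 3 G v j) = 0} →
      (Submodule.span ℂ C : Set (Fin (M + 1) → ℂ))
        = {z : Fin (M + 1) → ℂ | z j = 0 ∧ MvPolynomial.eval z (chartComp 1 G v j) = 0}

/-- Condition (R1.3) at a non-singular point: for every hyperplane `P ∋ o` different
from the tangent hyperplane `T_oF`, the scheme-theoretic intersection of `P`, `T_oF`,
the quadric `{q₂ = 0}` and `F` is an irreducible and reduced cycle; i.e. the ideal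
generated by the corresponding local equations is prime. -/
def ChartR13 : Prop :=
  ∀ p : MvPolynomial (Fin (M + 1)) ℂ, p.IsHomogeneous 1 →
    p ∉ Submodule.span ℂ ({chartComp 1 G v j, MvPolynomial.X j} :
      Set (MvPolynomial (Fin (M + 1)) ℂ)) →
    (Ideal.span ({MvPolynomial.X j, p, chartComp 1 G v j, chartComp 2 G v j,
        chartShift G v j} : Set (MvPolynomial (Fin (M + 1)) ℂ))).IsPrime

/-- Condition (R2.1) at a singular point `o = v` of `F = {G = 0}` (chart `z_j = 1`):
for every linear subspace `Π` of the chart of codimension `c ∈ {0,1,2}`, the sequence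
`q₂|_Π, …, q_{M−c}|_Π` is regular, i.e. its zero set in `ℙ(Π)` is finite. -/
def ChartR21 : Prop :=
  ∀ c ∈ ({0, 1, 2} : Set ℕ), ∀ Pl : Submodule ℂ (Fin (M + 1) → ℂ),
    Pl ≤ LinearMap.ker (LinearMap.proj (R := ℂ) (φ := fun _ : Fin (M + 1) => ℂ) j) →
    Module.finrank ℂ ↥Pl = M - c →
      zdim {z : Fin (M + 1) → ℂ | z ∈ Pl ∧ ∀ i ∈ Finset.Icc 2 (M - c),
        MvPolynomial.eval z (chartComp i G v j) = 0} ≤ 1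

/-- Condition (R2.2) at a singular point: the quadratic form `q₂` has rank ≥ 8. -/
def ChartR22 : Prop :=
  8 ≤ rankOn (chartComp 2 G v j) {z : Fin (M + 1) → ℂ | z j = 0}

/-- Condition (R2.3) at a singular point: the divisor `{q₃|_{q₂=0} = 0}` on the
quadric `{q₂ = 0} ⊂ ℙ^{M−1}` is not a sum of three hyperplane sections of the quadric
from the same linear pencil; i.e. there is no identity `q₃ = l₁l₂l₃ + l·q₂` with the
linear forms `l₁, l₂, l₃` lying in a pencil. -/
def ChartR23 : Prop :=
  ¬ ∃ a b l l₁ l₂ l₃ : MvPolynomial (Fin (M + 1)) ℂ,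
      a.IsHomogeneous 1 ∧ b.IsHomogeneous 1 ∧ l.IsHomogeneous 1 ∧
      l₁ ∈ Submodule.span ℂ ({a, b} : Set (MvPolynomial (Fin (M + 1)) ℂ)) ∧
      l₂ ∈ Submodule.span ℂ ({a, b} : Set (MvPolynomial (Fin (M + 1)) ℂ)) ∧
      l₃ ∈ Submodule.span ℂ ({a, b} : Set (MvPolynomial (Fin (M + 1)) ℂ)) ∧
      chartComp 3 G v j = l₁ * l₂ * l₃ + l * chartComp 2 G v j

end RegularityConditions

/-- A hypersurface `F = {G = 0}` of degree `M` in `ℙ^M` is regular (`F ∈ ℱ_reg`) if it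
satisfies conditions (R1.1)–(R1.3) at every non-singular point and conditions
(R2.1)–(R2.3) at every singular point. -/
def FRegular {M : ℕ} (G : MvPolynomial (Fin (M + 1)) ℂ) : Prop :=
  ∀ (v : Fin (M + 1) → ℂ) (j : Fin (M + 1)), v j = 1 → MvPolynomial.eval v G = 0 →
    (chartComp 1 G v j ≠ 0 → ChartR11 G v j ∧ ChartR12 G v j ∧ ChartR13 G v j) ∧
    (chartComp 1 G v j = 0 → ChartR21 G v j ∧ ChartR22 G v j ∧ ChartR23 G v j)

section ZariskiBasics

variable {E : Type*} [AddCommGroup E] [Module ℂ E] {ι : Type*}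

theorem exists_poly_of_isPolyFun [Finite ι] {φ : E →ₗ[ℂ] (ι → ℂ)} (hφ : Function.Injective φ)
    {g : E → ℂ} (hg : IsPolyFun g) : ∃ P : MvPolynomial ι ℂ, ∀ v, g v = eval (φ v) P := by
  classical
  have := Fintype.ofFinite ι
  obtain ⟨n, ψ, p, hp⟩ := hg
  obtain ⟨l, hl⟩ := φ.exists_leftInverse_of_injective (LinearMap.ker_eq_bot.2 hφ)
  let L : (ι → ℂ) →ₗ[ℂ] (Fin n → ℂ) := ψ ∘ₗ l
  have hL : ∀ v, ψ v = L (φ v) := fun v => by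
    have := LinearMap.congr_fun hl v
    simp only [LinearMap.comp_apply, LinearMap.id_apply] at this
    simp [L, this]
  refine ⟨bind₁ (fun k => ∑ i, C (L (Pi.single i 1) k) * X i) p, fun v => ?_⟩
  rw [hp, hL, ← aeval_eq_eval, ← aeval_eq_eval, aeval_bind₁]
  congr 2
  funext k
  have h1 : L (φ v) = ∑ i, φ v i • L (Pi.single i 1) := by
    conv_lhs => rw [pi_eq_sum_univ' (φ v)]
    rw [map_sum]
    refine Finset.sum_congr rfl fun i _ => ?_
    rw [map_smul]
  rw [h1]
  simp [Finset.sum_apply, mul_comm]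

theorem isPolyFun_eval [Finite ι] (φ : E →ₗ[ℂ] (ι → ℂ)) (P : MvPolynomial ι ℂ) :
    IsPolyFun fun v => eval (φ v) P := by
  have := Fintype.ofFinite ι
  obtain ⟨n, ⟨e⟩⟩ := Finite.exists_equiv_fin ι
  refine ⟨n, (LinearMap.funLeft ℂ ℂ e.symm) ∘ₗ φ, rename e P, fun v => ?_⟩
  rw [eval_rename]
  have : ((LinearMap.funLeft ℂ ℂ e.symm) ∘ₗ φ) v ∘ e = φ v := by
    funext i
    simp [LinearMap.funLeft_apply]
  rw [this]

theorem isClosed_eval_eq_zero [Finite ι] (φ : E →ₗ[ℂ] (ι → ℂ)) (P : MvPolynomial ι ℂ) :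
    @IsClosed E (zariskiTopology E) {v | eval (φ v) P = 0} := by
  let := zariskiTopology E
  rw [← isOpen_compl_iff]
  refine TopologicalSpace.isOpen_generateFrom_of_mem ?_
  refine ⟨{fun v => eval (φ v) P}, by simpa using isPolyFun_eval φ P, ?_⟩
  ext v
  simp

theorem exists_poly_separating [Finite ι] {φ : E →ₗ[ℂ] (ι → ℂ)} (hφ : Function.Injective φ)
    {Z : Set E} (hZ : @IsClosed E (zariskiTopology E) Z) {x : E} (hx : x ∉ Z) :
    ∃ P : MvPolynomial ι ℂ, (∀ z ∈ Z, eval (φ z) P = 0) ∧ eval (φ x) P ≠ 0 := by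
  have key : ∀ U : Set E, TopologicalSpace.GenerateOpen {U : Set E | IsZClosed Uᶜ} U → ∀ x ∈ U,
      ∃ P : MvPolynomial ι ℂ, (∀ z ∉ U, eval (φ z) P = 0) ∧ eval (φ x) P ≠ 0 := by
    intro U hU
    induction hU with
    | basic s hs =>
      intro x hx
      obtain ⟨G, hG, hs⟩ := hs
      have : x ∉ sᶜ := fun h => h hx
      rw [hs] at this
      simp only [Set.mem_ofPred_eq, not_forall] at this
      obtain ⟨g, hg, hgx⟩ := this
      obtain ⟨P, hP⟩ := exists_poly_of_isPolyFun hφ (hG g hg)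
      refine ⟨P, fun z hz => ?_, by rwa [← hP]⟩
      have : z ∈ sᶜ := hz
      rw [hs] at this
      rw [← hP]
      exact this g hg
    | univ => exact fun x _ => ⟨1, by simp, by simp⟩
    | inter s t _ _ ihs iht =>
      intro x hx
      obtain ⟨P, hP, hPx⟩ := ihs x hx.1
      obtain ⟨Q, hQ, hQx⟩ := iht x hx.2
      refine ⟨P * Q, fun z hz => ?_, by simp [hPx, hQx]⟩
      by_cases h : z ∈ s
      · simp [hQ z fun h' => hz ⟨h, h'⟩]
      · simp [hP z h]
    | sUnion S _ ih =>
      rintro x ⟨s, hs, hx⟩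
      obtain ⟨P, hP, hPx⟩ := ih s hs x hx
      exact ⟨P, fun z hz => hP z fun h => hz ⟨s, hs, h⟩, hPx⟩
  have := key Zᶜ hZ.isOpen_compl x hx
  simpa using this

/-- The ideal of polynomials vanishing on the image of `S` under the coordinates `φ`. -/
def vanIdeal (φ : E →ₗ[ℂ] (ι → ℂ)) (S : Set E) : Ideal (MvPolynomial ι ℂ) where
  carrier := {P | ∀ s ∈ S, eval (φ s) P = 0}
  add_mem' ha hb s hs := by simp [ha s hs, hb s hs]
  zero_mem' s _ := by simp
  smul_mem' c P hP s hs := by simp [hP s hs]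

theorem mem_vanIdeal {φ : E →ₗ[ℂ] (ι → ℂ)} {S : Set E} {P : MvPolynomial ι ℂ} :
    P ∈ vanIdeal φ S ↔ ∀ s ∈ S, eval (φ s) P = 0 := Iff.rfl

theorem vanIdeal_isPrime [Finite ι] (φ : E →ₗ[ℂ] (ι → ℂ)) {S : Set E}
    (hS : @IsIrreducible E (zariskiTopology E) S) : (vanIdeal φ S).IsPrime := by
  let := zariskiTopology E
  obtain ⟨⟨s, hs⟩, hS⟩ := hS
  refine ⟨?_, ?_⟩
  · rw [Ideal.ne_top_iff_one, mem_vanIdeal]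
    intro h
    simpa using h s hs
  · intro P Q hPQ
    rw [isPreirreducible_iff_isClosed_union_isClosed] at hS
    refine hS {v | eval (φ v) P = 0} {v | eval (φ v) Q = 0} (isClosed_eval_eq_zero φ P)
      (isClosed_eval_eq_zero φ Q) fun z hz => ?_
    have := hPQ z hz
    simpa using this

theorem exists_algebraicIndependent_of_primeChain {n : ℕ} {P : Ideal (MvPolynomial ι ℂ)} [Finite ι]
    [P.IsPrime] (c : LTSeries (PrimeSpectrum (MvPolynomial ι ℂ))) (hn : n ≤ c.length)
    (hc : ∀ i, P ≤ (c i).asIdeal) :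
    ∃ f : Fin n → MvPolynomial ι ℂ ⧸ P, AlgebraicIndependent ℂ f := by
  let R := MvPolynomial ι ℂ ⧸ P
  obtain ⟨s, g, hg, hgi⟩ := exists_integral_inj_algHom_of_fg (k := ℂ) (R := R)
  have hmono : ∀ p q : PrimeSpectrum (MvPolynomial ι ℂ), P ≤ p.asIdeal → P ≤ q.asIdeal → p < q →
      ((p.asIdeal.map (Ideal.Quotient.mk P)).comap g.toRingHom <
        (q.asIdeal.map (Ideal.Quotient.mk P)).comap g.toRingHom) := by
    intro p q hp hq hpq
    have hsurj := Ideal.Quotient.mk_surjective (I := P)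
    have : (p.asIdeal.map (Ideal.Quotient.mk P)).IsPrime :=
      Ideal.map_isPrime_of_surjective hsurj (by simpa using hp)
    have hle : p.asIdeal.map (Ideal.Quotient.mk P) ≤ q.asIdeal.map (Ideal.Quotient.mk P) :=
      Ideal.map_mono hpq.le
    obtain ⟨x, hxq, hxp⟩ := SetLike.exists_of_lt (show p.asIdeal < q.asIdeal from hpq)
    let : Algebra (MvPolynomial (Fin s) ℂ) R := g.toRingHom.toAlgebra
    have hx : Ideal.Quotient.mk P x ∉ p.asIdeal.map (Ideal.Quotient.mk P) := by
      intro h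
      rw [Ideal.mem_map_iff_of_surjective _ hsurj] at h
      obtain ⟨y, hy, hxy⟩ := h
      rw [Ideal.Quotient.eq] at hxy
      exact hxp (by simpa using p.asIdeal.sub_mem hy (hp hxy))
    exact Ideal.comap_lt_comap_of_integral_mem_sdiff hle
      ⟨Ideal.mem_map_of_mem _ hxq, hx⟩ (hgi _)
  have hprime : ∀ p : PrimeSpectrum (MvPolynomial ι ℂ), P ≤ p.asIdeal →
      ((p.asIdeal.map (Ideal.Quotient.mk P)).comap g.toRingHom).IsPrime := by
    intro p hp
    have : (p.asIdeal.map (Ideal.Quotient.mk P)).IsPrime :=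
      Ideal.map_isPrime_of_surjective Ideal.Quotient.mk_surjective (by simpa using hp)
    exact Ideal.IsPrime.comap _
  let c' : LTSeries (PrimeSpectrum (MvPolynomial (Fin s) ℂ)) :=
    { length := c.length
      toFun := fun i => ⟨_, hprime (c i) (hc i)⟩
      step := fun i => hmono _ _ (hc _) (hc _) (c.step i) }
  have h1 := Order.LTSeries.length_le_krullDim c'
  have h2 : Order.krullDim (PrimeSpectrum (MvPolynomial (Fin s) ℂ)) = s := by
    have := MvPolynomial.ringKrullDim_of_isNoetherianRing (R := ℂ) (ι := Fin s)
    rw [ringKrullDim_eq_zero_of_field] at this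
    simpa [ringKrullDim] using this
  rw [h2] at h1
  have h3 : n ≤ s := hn.trans (by exact_mod_cast h1)
  refine ⟨fun i => g (X (Fin.castLE h3 i)), ?_⟩
  have : AlgebraicIndependent ℂ fun i => g (X i) := by
    have := (MvPolynomial.algebraicIndependent_X (Fin s) ℂ).map' (f := g) hg
    exact this
  exact this.comp _ (Fin.castLE_injective h3)

/-- Among generators of a domain one finds as many algebraically independent ones as the length
of any algebraically independent family. -/
theorem exists_finset_algebraicIndependent {k R ι : Type*} [Field k] [CommRing R] [IsDomain R]
    [Algebra k R] [Finite ι] (x : ι → R) (hx : Algebra.adjoin k (Set.range x) = ⊤) {n : ℕ}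
    {f : Fin n → R} (hf : AlgebraicIndependent k f) :
    ∃ T : Finset ι, T.card = n ∧ AlgebraicIndependent k fun i : T => x i := by
  classical
  have hgen : Algebra.IsAlgebraic (Algebra.adjoin k (Set.range x)) R := by
    rw [hx]
    exact ⟨fun y => isAlgebraic_algebraMap (A := R) (⟨y, trivial⟩ : (⊤ : Subalgebra k R))⟩
  obtain ⟨t, hts, ht⟩ := exists_isTranscendenceBasis_subset (R := k) (Set.range x)
  have hcard := hf.lift_cardinalMk_le_trdeg
  rw [← ht.cardinalMk_eq_trdeg] at hcard
  have hfin : t.Finite := (Set.finite_range _).subset hts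
  have hcard' : n ≤ hfin.toFinset.card := by
    have : Cardinal.mk t = hfin.toFinset.card := by
      rw [← Set.ncard_eq_toFinset_card t hfin]
      have := hfin.to_subtype
      rw [← Nat.card_coe_set_eq, Nat.cast_card]
    rw [this] at hcard
    simpa using hcard
  rcases isEmpty_or_nonempty ι with hι | hι
  · have ht0 : hfin.toFinset = ∅ := by
      rw [Set.Finite.toFinset_eq_empty]
      exact Set.subset_empty_iff.1 (hts.trans (by rw [Set.range_eq_empty]))
    rw [ht0] at hcard'
    refine ⟨∅, by simpa using (hcard'.antisymm (by simp)).symm, ?_⟩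
    exact (algebraicIndependent_empty_type_iff ..).2 (FaithfulSMul.algebraMap_injective k R)
  have hts' : ∀ a ∈ t, ∃ i, x i = a := fun a ha => hts ha
  choose! r hr using hts'
  obtain ⟨t', ht', ht'c⟩ := Finset.exists_subset_card_eq hcard'
  have hinj : Set.InjOn r t := fun a ha b hb hab => by rw [← hr a ha, ← hr b hb, hab]
  refine ⟨t'.image r, ?_, ?_⟩
  · rw [Finset.card_image_of_injOn, ht'c]
    exact hinj.mono fun a ha => hfin.mem_toFinset.1 (ht' ha)
  · have hmem : ∀ i : (t'.image r : Finset ι), x i ∈ t := by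
      rintro ⟨i, hi⟩
      obtain ⟨a, ha, rfl⟩ := Finset.mem_image.1 hi
      have ha' := hfin.mem_toFinset.1 (ht' ha)
      change x (r a) ∈ t
      rw [hr a ha']
      exact ha'
    have := ht.1.comp (fun i : (t'.image r : Finset ι) => (⟨_, hmem i⟩ : t)) (by
      rintro ⟨i, hi⟩ ⟨k, hk⟩ hik
      obtain ⟨a, ha, rfl⟩ := Finset.mem_image.1 hi
      obtain ⟨b, hb, rfl⟩ := Finset.mem_image.1 hk
      have ha' := hr _ (hfin.mem_toFinset.1 (ht' ha))
      have hb' := hr _ (hfin.mem_toFinset.1 (ht' hb))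
      simp only [Subtype.mk.injEq] at hik ⊢
      rw [ha', hb'] at hik
      rw [hik])
    exact this

/-- A set of dimension exceeding `d` contains a subset with prime vanishing ideal modulo which
`d + 1` coordinates are algebraically independent. -/
theorem exists_generic_of_not_zdim_le [Finite ι] {φ : E →ₗ[ℂ] (ι → ℂ)}
    (hφ : Function.Injective φ) {A : Set E} {d : ℕ} (h : ¬ zdim A ≤ d) :
    ∃ S ⊆ A, (vanIdeal φ S).IsPrime ∧ ∃ T : Finset ι, T.card = d + 1 ∧
      AlgebraicIndependent ℂ fun i : T => Ideal.Quotient.mk (vanIdeal φ S) (X (i : ι)) := by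
  classical
  let := zariskiTopology E
  have h0 : ((d + 1 : ℕ) : WithBot ℕ∞) ≤ Order.krullDim (TopologicalSpace.IrreducibleCloseds A) := by
    rw [not_le] at h
    have h' : ((d : ℕ∞) : WithBot ℕ∞) < Order.krullDim (TopologicalSpace.IrreducibleCloseds A) := h
    revert h'
    cases Order.krullDim (TopologicalSpace.IrreducibleCloseds A) with
    | bot => simp
    | coe x =>
      intro h'
      have h2 := Order.add_one_le_of_lt (WithBot.coe_lt_coe.1 h')
      exact_mod_cast h2
  rw [Order.le_krullDim_iff] at h0
  obtain ⟨c, hc⟩ := h0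
  have himg : ∀ s : TopologicalSpace.IrreducibleCloseds A,
      IsIrreducible (Subtype.val '' (s : Set A)) := fun s =>
    s.isIrreducible.image _ continuous_subtype_val.continuousOn
  have hprime := fun s => vanIdeal_isPrime φ (himg s)
  have hanti : ∀ s t : TopologicalSpace.IrreducibleCloseds A, s < t →
      vanIdeal φ (Subtype.val '' (t : Set A)) < vanIdeal φ (Subtype.val '' (s : Set A)) := by
    intro s t hst
    refine lt_of_le_of_ne (fun P hP z hz => hP z (Set.image_mono hst.le hz)) fun heq => ?_
    obtain ⟨x, hxt, hxs⟩ := SetLike.exists_of_lt hst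
    obtain ⟨Z, hZ, hZs⟩ := isClosed_induced_iff.1 s.isClosed
    have hxZ : (x : E) ∉ Z := fun hx => hxs (by
      have : x ∈ (s : Set A) := by rw [← hZs]; exact hx
      exact this)
    obtain ⟨P, hP, hPx⟩ := exists_poly_separating hφ hZ hxZ
    have hPs : P ∈ vanIdeal φ (Subtype.val '' (s : Set A)) := by
      rintro _ ⟨y, hy, rfl⟩
      refine hP _ ?_
      rw [← hZs] at hy
      exact hy
    rw [← heq] at hPs
    exact hPx (hPs _ ⟨x, hxt, rfl⟩)
  let c' : LTSeries (PrimeSpectrum (MvPolynomial ι ℂ)) :=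
    (c.map (β := (PrimeSpectrum (MvPolynomial ι ℂ))ᵒᵈ)
      (fun s => OrderDual.toDual ⟨_, hprime s⟩) (fun s t hst => hanti s t hst)).reverse
  let S := Subtype.val '' (c.last : Set A)
  have := hprime c.last
  have hc' : ∀ i, vanIdeal φ S ≤ (c' i).asIdeal := by
    intro i
    intro P hP z hz
    refine hP z (Set.image_mono ?_ hz)
    exact LTSeries.monotone c (Fin.le_last _)
  obtain ⟨f, hf⟩ := exists_algebraicIndependent_of_primeChain (n := d + 1) (P := vanIdeal φ S) c'
    (by simp [c', LTSeries.map, hc]) hc'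
  refine ⟨S, by rintro _ ⟨y, _, rfl⟩; exact y.2, hprime _, ?_⟩
  refine exists_finset_algebraicIndependent
    (fun i : ι => Ideal.Quotient.mk (vanIdeal φ S) (X i)) ?_ hf
  have h1 := MvPolynomial.adjoin_range_X (R := ℂ) (σ := ι)
  have h2 := congrArg (Subalgebra.map (Ideal.Quotient.mkₐ ℂ (vanIdeal φ S))) h1
  rw [AlgHom.map_adjoin, ← Set.range_comp, Algebra.map_top,
    (AlgHom.range_eq_top _).2 (Ideal.Quotient.mkₐ_surjective ℂ _)] at h2
  exact h2

end ZariskiBasics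

section FieldCalculus

variable (k : Type*) {K : Type*} [Field k] [Field K] [Algebra k K]

/-- The relative algebraic closure in `K` of the subfield generated by `S` over `k`. -/
def acl (S : Set K) : IntermediateField k K :=
  (algebraicClosure (IntermediateField.adjoin k S) K).restrictScalars k

variable {k}

theorem mem_acl {S : Set K} {x : K} :
    x ∈ acl k S ↔ IsAlgebraic (IntermediateField.adjoin k S) x := by
  rw [acl, IntermediateField.mem_restrictScalars, mem_algebraicClosure_iff]

theorem adjoin_le_acl (S : Set K) : IntermediateField.adjoin k S ≤ acl k S := fun x hx =>
  mem_acl.2 (isAlgebraic_algebraMap (⟨x, hx⟩ : IntermediateField.adjoin k S))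

theorem subset_acl (S : Set K) : S ⊆ acl k S := fun _ hx =>
  adjoin_le_acl S (IntermediateField.subset_adjoin k S hx)

theorem mem_of_isAlgebraic_acl {S : Set K} {x : K} (hx : IsAlgebraic (acl k S) x) :
    x ∈ acl k S := by
  rw [mem_acl]
  let L := IntermediateField.adjoin k S
  have : IsAlgebraic (algebraicClosure L K) x := hx
  exact this.restrictScalars L

theorem acl_le {S T : Set K} (h : S ⊆ acl k T) : acl k S ≤ acl k T := by
  intro x hx
  apply mem_of_isAlgebraic_acl
  have hle : IntermediateField.adjoin k S ≤ acl k T := IntermediateField.adjoin_le_iff.2 h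
  rw [mem_acl] at hx
  let := (IntermediateField.inclusion hle).toRingHom.toAlgebra
  have : IsScalarTower (IntermediateField.adjoin k S) (acl k T) K :=
    IsScalarTower.of_algebraMap_eq' rfl
  exact hx.tower_top _

theorem acl_mono {S T : Set K} (h : S ⊆ T) : acl k S ≤ acl k T :=
  acl_le (h.trans (subset_acl T))

theorem acl_isAlgClosed [IsAlgClosed K] (S : Set K) : IsAlgClosed (acl k S) := by
  let L := IntermediateField.adjoin k S
  have : IsAlgClosed (algebraicClosure L K) := (algebraicClosure.isAlgClosure L K).isAlgClosed
  exact this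

/-- An algebraically independent family algebraic over `B` has at most `B.card` members. -/
theorem card_le_of_algebraicIndependent {B : Finset K} {n : ℕ} {y : Fin n → K}
    (hy : AlgebraicIndependent k y) (hB : ∀ i, y i ∈ acl k (B : Set K)) : n ≤ B.card := by
  let M := AlgebraicIndependent.matroid k K
  have h1 : M.Indep (Set.range y) := AlgebraicIndependent.matroid_indep_iff.2 hy.to_subtype_range
  have h2 : Set.range y ⊆ M.closure (B : Set K) := by
    rintro _ ⟨i, rfl⟩
    rw [AlgebraicIndependent.matroid_closure_eq, SetLike.mem_coe,
      Subalgebra.mem_algebraicClosure]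
    have h3 := mem_acl.1 (hB i)
    rwa [IntermediateField.isAlgebraic_adjoin_iff] at h3
  have h3 := (h1.encard_le_eRk_of_subset h2).trans_eq (M.eRk_closure_eq _)
  have h4 := h3.trans (M.eRk_le_encard _)
  rw [Set.encard_coe_eq_coe_finsetCard, ← Set.image_univ, hy.injective.encard_image,
    Set.encard_univ, ENat.card_eq_coe_fintype_card, Fintype.card_fin] at h4
  exact_mod_cast h4

variable (k)

/-- The transcendence degree of `C` over the field generated by `S` is at most `d`. -/
def Dle (S C : Set K) (d : ℕ) : Prop :=
  ∃ B : Finset K, B.card ≤ d ∧ C ⊆ acl k (S ∪ B)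

variable {k}

theorem Dle.mono {S S' C C' : Set K} {d d' : ℕ} (h : Dle k S C d) (hS : S ⊆ acl k S')
    (hC : C' ⊆ acl k (S' ∪ C)) (hd : d ≤ d') : Dle k S' C' d' := by
  obtain ⟨B, hB, hCB⟩ := h
  refine ⟨B, hB.trans hd, hC.trans (acl_le (Set.union_subset ?_ (hCB.trans (acl_le ?_))))⟩
  · exact Set.subset_union_left.trans (subset_acl _)
  · refine Set.union_subset (hS.trans (acl_mono Set.subset_union_left)) ?_
    exact Set.subset_union_right.trans (subset_acl _)

theorem Dle.trans {S C D : Set K} {d e : ℕ} (h : Dle k S C d) (h' : Dle k (S ∪ C) D e) :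
    Dle k S (C ∪ D) (d + e) := by
  classical
  obtain ⟨B, hB, hC⟩ := h
  obtain ⟨B', hB', hD⟩ := h'
  refine ⟨B ∪ B', (Finset.card_union_le _ _).trans (add_le_add hB hB'), ?_⟩
  have h1 : acl k (S ∪ (B : Set K)) ≤ acl k (S ∪ ((B ∪ B' : Finset K) : Set K)) :=
    acl_mono (Set.union_subset_union_right _ (by simp))
  refine Set.union_subset (hC.trans h1) (hD.trans (acl_le ?_))
  refine Set.union_subset (Set.union_subset ?_ (hC.trans h1)) ?_
  · exact Set.subset_union_left.trans (subset_acl _)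
  · refine Set.Subset.trans ?_ (subset_acl _)
    intro x hx
    simp [Finset.mem_coe.1 hx]

theorem Dle.of_subset_acl {S C : Set K} (h : C ⊆ acl k S) (d : ℕ) : Dle k S C d :=
  ⟨∅, by simp, by simpa using h⟩

theorem Dle.range {S : Set K} {ι : Type*} [Fintype ι] (x : ι → K) :
    Dle k S (Set.range x) (Fintype.card ι) := by
  classical
  refine ⟨Finset.univ.image x, Finset.card_image_le, ?_⟩
  refine Set.Subset.trans ?_ (subset_acl _)
  rintro _ ⟨i, rfl⟩
  simp

/-- If all but some of the members of a family are algebraic over those, then only the latter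
count. -/
theorem Dle.range_of_subset {S : Set K} {ι : Type*} [Fintype ι] (x : ι → K) (T : Finset ι)
    (h : ∀ i, i ∉ T → x i ∈ acl k (S ∪ x '' T)) : Dle k S (Set.range x) T.card := by
  classical
  refine ⟨T.image x, Finset.card_image_le, ?_⟩
  rintro _ ⟨i, rfl⟩
  by_cases hi : i ∈ T
  · exact subset_acl _ (Or.inr (by simpa using ⟨i, hi, rfl⟩))
  · simpa using h i hi

theorem Dle.card_le {C : Set K} {d n : ℕ} (h : Dle k ∅ C d) {y : Fin n → K}
    (hy : AlgebraicIndependent k y) (hC : ∀ i, y i ∈ C) : n ≤ d := by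
  obtain ⟨B, hB, hCB⟩ := h
  exact (card_le_of_algebraicIndependent hy fun i => by simpa using hCB (hC i)).trans hB

end FieldCalculus

section Ultraproducts

/-- The ultrapower of `ℂ` along an ultrafilter. -/
def UPow {I : Type*} (U : Ultrafilter I) : Type _ := (U : Filter I).Germ ℂ

instance {I : Type*} (U : Ultrafilter I) : Field (UPow U) :=
  inferInstanceAs (Field ((U : Filter I).Germ ℂ))

/-- The class of a function in the ultrapower, as a ring homomorphism. -/
def toUPowRing {I : Type*} (U : Ultrafilter I) : (I → ℂ) →+* UPow U :=
  Filter.Germ.coeRingHom (U : Filter I)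

instance {I : Type*} (U : Ultrafilter I) : Algebra ℂ (UPow U) :=
  ((toUPowRing U).comp (Pi.constRingHom I ℂ)).toAlgebra

/-- The class of a function in the ultrapower. -/
def toUPow {I : Type*} (U : Ultrafilter I) : (I → ℂ) →ₐ[ℂ] UPow U :=
  { toUPowRing U with commutes' := fun _ => rfl }

variable {I : Type*} {U : Ultrafilter I}

theorem toUPow_eq_iff {f g : I → ℂ} : toUPow U f = toUPow U g ↔ ∀ᶠ i in (U : Filter I), f i = g i :=
  Filter.Germ.coe_eq

theorem toUPow_eq_zero_iff {f : I → ℂ} : toUPow U f = 0 ↔ ∀ᶠ i in (U : Filter I), f i = 0 := by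
  rw [← map_zero (toUPow U), toUPow_eq_iff]
  rfl

theorem toUPow_surjective : Function.Surjective (toUPow U) := fun x =>
  Quotient.inductionOn' x fun f => ⟨f, rfl⟩

theorem toUPow_eval {σ : Type*} (w : σ → I → ℂ) (P : MvPolynomial σ ℂ) :
    toUPow U (fun i => eval (fun s => w s i) P) = aeval (fun s => toUPow U (w s)) P := by
  have h : (fun i => eval (fun s => w s i) P) = aeval w P := by
    funext i
    have := congrArg (fun f : MvPolynomial σ ℂ →ₐ[ℂ] ℂ => f P)
      (show (aeval fun s => w s i) = (Pi.evalAlgHom ℂ (fun _ : I => ℂ) i).comp (aeval w) from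
        MvPolynomial.algHom_ext fun s => by simp)
    rw [← aeval_eq_eval]
    exact this
  rw [h]
  have := congrArg (fun f : MvPolynomial σ ℂ →ₐ[ℂ] UPow U => f P)
    (MvPolynomial.comp_aeval w (toUPow U))
  exact this

instance : IsAlgClosed (UPow U) := by
  refine IsAlgClosed.of_exists_root _ fun p hp hirr => ?_
  choose f hf using fun n => toUPow_surjective (U := U) (p.coeff n)
  have hdeg : p.natDegree ≠ 0 := fun h => by
    rw [hp.natDegree_eq_zero] at h
    exact hirr.not_isUnit (h ▸ isUnit_one)
  have hroot : ∀ i, ∃ x : ℂ, x ^ p.natDegree + ∑ n ∈ Finset.range p.natDegree, f n i * x ^ n = 0 := by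
    intro i
    let q : Polynomial ℂ := Polynomial.X ^ p.natDegree +
      ∑ n ∈ Finset.range p.natDegree, Polynomial.C (f n i) * Polynomial.X ^ n
    have hlt : (∑ n ∈ Finset.range p.natDegree,
        Polynomial.C (f n i) * Polynomial.X ^ n).degree < (p.natDegree : WithBot ℕ) := by
      refine (Polynomial.degree_sum_le _ _).trans_lt ?_
      rw [Finset.sup_lt_iff (WithBot.bot_lt_coe _)]
      intro n hn
      exact (Polynomial.degree_C_mul_X_pow_le _ _).trans_lt
        (by exact_mod_cast Finset.mem_range.1 hn)
    have hq : q.degree = p.natDegree := by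
      rw [Polynomial.degree_add_eq_left_of_degree_lt] <;> rw [Polynomial.degree_X_pow]
      exact hlt
    obtain ⟨x, hx⟩ := IsAlgClosed.exists_root q (by rw [hq]; exact_mod_cast hdeg)
    refine ⟨x, ?_⟩
    simpa [q, Polynomial.eval_finsetSum] using hx
  choose x hx using hroot
  refine ⟨toUPow U x, ?_⟩
  rw [Polynomial.eval_eq_sum_range, Finset.sum_range_succ, hp.coeff_natDegree, one_mul, add_comm]
  simp_rw [← hf, ← map_pow, ← map_mul, ← map_sum, ← map_add]
  rw [toUPow_eq_zero_iff]
  refine Filter.Eventually.of_forall fun i => ?_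
  rw [← hx i]
  simp [Finset.sum_apply]

theorem exists_ultrafilter_extension {I J : Type*} (U : Ultrafilter I) (π : J → I) (B : Set (Set J))
    (hB : B.Nonempty) (hdir : ∀ s ∈ B, ∀ t ∈ B, ∃ r ∈ B, r ⊆ s ∩ t)
    (hne : ∀ s ∈ B, ∀ i, ∃ z ∈ s, π z = i) :
    ∃ W : Ultrafilter J, W.map π = U ∧ ∀ s ∈ B, s ∈ W := by
  let F : Filter J :=
    { sets := {x | ∃ s ∈ B, ∃ u ∈ U, π ⁻¹' u ∩ s ⊆ x}
      univ_sets := by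
        obtain ⟨s, hs⟩ := hB
        exact ⟨s, hs, Set.univ, Filter.univ_mem, by simp⟩
      sets_of_superset := by
        rintro x y ⟨s, hs, u, hu, h⟩ hxy
        exact ⟨s, hs, u, hu, h.trans hxy⟩
      inter_sets := by
        rintro x y ⟨s, hs, u, hu, h⟩ ⟨t, ht, u', hu', h'⟩
        obtain ⟨r, hr, hrst⟩ := hdir s hs t ht
        refine ⟨r, hr, u ∩ u', Filter.inter_mem hu hu', fun z hz => ⟨h ?_, h' ?_⟩⟩
        · exact ⟨hz.1.1, (hrst hz.2).1⟩
        · exact ⟨hz.1.2, (hrst hz.2).2⟩ }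
  have : F.NeBot := by
    rw [← Filter.empty_mem_iff_bot.not.trans Filter.neBot_iff.symm]
    rintro ⟨s, hs, u, hu, h⟩
    obtain ⟨i, hi⟩ := Ultrafilter.nonempty_of_mem hu
    obtain ⟨z, hz, rfl⟩ := hne s hs i
    exact h ⟨hi, hz⟩
  have hW := Ultrafilter.of_le F
  refine ⟨Ultrafilter.of F, ?_, fun s hs => hW ⟨s, hs, Set.univ, Filter.univ_mem, by simp⟩⟩
  refine (Ultrafilter.coe_le_coe.1 fun u hu => ?_)
  obtain ⟨s, hs⟩ := hB
  exact hW ⟨s, hs, u, hu, Set.inter_subset_left⟩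

/-- The generic-point criterion for dimension: if the coordinates of every point of `A` in an
ultrapower have transcendence degree at most `d`, then `A` has dimension at most `d`. -/
theorem zdim_le_of_forall_ultrafilter {E : Type*} [AddCommGroup E] [Module ℂ E] {ι : Type*}
    [Finite ι] {φ : E →ₗ[ℂ] (ι → ℂ)} (hφ : Function.Injective φ) {A : Set E} {d : ℕ}
    (h : ∀ U : Ultrafilter A,
      Dle ℂ ∅ (Set.range fun i => toUPow U (fun a : A => φ (a : E) i)) d) :
    zdim A ≤ d := by
  by_contra hcon
  obtain ⟨S, hSA, hprime, T, hT, hind⟩ := exists_generic_of_not_zdim_le hφ hcon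
  obtain ⟨W, -, hW⟩ := exists_ultrafilter_extension (pure () : Ultrafilter Unit) (fun _ : S => ())
    {s | ∃ G, G ∉ vanIdeal φ S ∧ s = {z : S | eval (φ (z : E)) G ≠ 0}}
    ⟨_, 1, hprime.one_notMem, rfl⟩ (by
      rintro _ ⟨G, hG, rfl⟩ _ ⟨G', hG', rfl⟩
      refine ⟨_, ⟨G * G', fun h => (hprime.mem_or_mem h).elim hG hG', rfl⟩, fun z hz => ?_⟩
      simpa using hz) (by
      rintro _ ⟨G, hG, rfl⟩ ⟨⟩
      rw [mem_vanIdeal] at hG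
      push Not at hG
      obtain ⟨z, hz, hzG⟩ := hG
      exact ⟨⟨z, hz⟩, hzG, rfl⟩)
  let U : Ultrafilter A := W.map (Set.inclusion hSA)
  have hU : ∀ G, G ∉ vanIdeal φ S → aeval (fun i => toUPow U (fun a : A => φ (a : E) i)) G ≠ 0 := by
    intro G hG h0
    rw [← toUPow_eval, toUPow_eq_zero_iff] at h0
    have h1 := hW _ ⟨G, hG, rfl⟩
    have h2 : ∀ᶠ z : S in (W : Filter S), eval (φ (z : E)) G = 0 := h0
    have h3 : ∀ᶠ z : S in (W : Filter S), eval (φ (z : E)) G ≠ 0 := h1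
    obtain ⟨z, hz, hz'⟩ := (h2.and h3).exists
    exact hz' hz
  have hy : AlgebraicIndependent ℂ fun i : T => toUPow U (fun a : A => φ (a : E) (i : ι)) := by
    rw [algebraicIndependent_iff] at hind ⊢
    intro p hp
    refine hind p ?_
    by_contra hne
    have h1 : Ideal.Quotient.mk (vanIdeal φ S) (rename (Subtype.val : T → ι) p) ≠ 0 := by
      have : Ideal.Quotient.mk (vanIdeal φ S) (rename (Subtype.val : T → ι) p) =
          aeval (fun i : T => Ideal.Quotient.mk (vanIdeal φ S) (X (i : ι))) p := by
        have := congrArg (fun f : MvPolynomial T ℂ →ₐ[ℂ] MvPolynomial ι ℂ ⧸ vanIdeal φ S => f p)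
          (show (Ideal.Quotient.mkₐ ℂ (vanIdeal φ S)).comp (rename (Subtype.val : T → ι)) =
            aeval (fun i : T => Ideal.Quotient.mk (vanIdeal φ S) (X (i : ι))) from
            MvPolynomial.algHom_ext fun i => by simp)
        exact this
      rw [this]
      exact hne
    rw [Ne, Ideal.Quotient.eq_zero_iff_mem] at h1
    refine hU _ h1 ?_
    rw [aeval_rename]
    exact hp
  have hy' := hy.comp (T.equivFin.symm) T.equivFin.symm.injective
  have := (h U).card_le hy' fun i => ⟨_, rfl⟩
  omega

end Ultraproducts

section LinearDisjointness

theorem exists_algHom_of_finiteType (k R : Type*) [Field k] [IsAlgClosed k] [CommRing R]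
    [Nontrivial R] [Algebra k R] [Algebra.FiniteType k R] : Nonempty (R →ₐ[k] k) := by
  obtain ⟨m, hm⟩ := Ideal.exists_maximal R
  let := Ideal.Quotient.field m
  have h1 : Module.Finite k (R ⧸ m) := finite_of_finite_type_of_isJacobsonRing k (R ⧸ m)
  have h2 := IsAlgClosed.algebraMap_bijective_of_isIntegral (k := k) (K := R ⧸ m)
  let e : k ≃ₐ[k] (R ⧸ m) := AlgEquiv.ofBijective (Algebra.ofId k (R ⧸ m)) h2
  exact ⟨(e.symm : (R ⧸ m) →ₐ[k] k).comp (Ideal.Quotient.mkₐ k m)⟩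

/-- A nonzero element of a finitely generated subalgebra of a domain over an algebraically closed
field survives at some point. -/
theorem exists_algHom_adjoin_ne_zero {k F : Type*} [Field k] [IsAlgClosed k] [Field F] [Algebra k F]
    {s : Set F} (hs : s.Finite) {x : F} (hx : x ∈ Algebra.adjoin k s) (hx0 : x ≠ 0) :
    ∃ π : Algebra.adjoin k s →ₐ[k] k, π ⟨x, hx⟩ ≠ 0 := by
  let R := Algebra.adjoin k (insert x⁻¹ s)
  have : Algebra.FiniteType k R := (Subalgebra.fg_iff_finiteType _).1
    ((Subalgebra.fg_def).2 ⟨_, hs.insert _, rfl⟩)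
  obtain ⟨π⟩ := exists_algHom_of_finiteType k R
  have hle : Algebra.adjoin k s ≤ R := Algebra.adjoin_mono (Set.subset_insert _ _)
  refine ⟨π.comp (Subalgebra.inclusion hle), fun h => ?_⟩
  have h1 : (Subalgebra.inclusion hle ⟨x, hx⟩) *
      (⟨x⁻¹, Algebra.subset_adjoin (Set.mem_insert _ _)⟩ : R) = 1 :=
    Subtype.ext (mul_inv_cancel₀ hx0)
  have h2 := congrArg π h1
  rw [map_mul, map_one] at h2
  have h3 : π (Subalgebra.inclusion hle ⟨x, hx⟩) = 0 := h
  rw [h3, zero_mul] at h2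
  exact zero_ne_one h2

variable {k F K : Type*} [Field k] [Field F] [Field K] [Algebra k F] [Algebra F K] [Algebra k K]
  [IsScalarTower k F K]

/-- Elements algebraic over a field generated over the algebraically closed field `k` by elements
independent over `F`, and linearly independent over `k`, are linearly independent over `F`. -/
theorem linearIndependent_of_algebraicIndependent [IsAlgClosed k] {ι κ : Type*} [Fintype κ]
    {t : ι → K} (ht : AlgebraicIndependent F t) {f : κ → K} (hf : LinearIndependent k f)
    (halg : ∀ i, IsAlgebraic (Algebra.adjoin k (Set.range t)) (f i)) {g : κ → F}
    (hg : ∑ i, algebraMap F K (g i) * f i = 0) : g = 0 := by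
  classical
  by_contra hne
  obtain ⟨a, ha⟩ := Function.ne_iff.1 hne
  let s : Set F := Set.range g
  have hgs : ∀ i, g i ∈ Algebra.adjoin k s := fun i => Algebra.subset_adjoin ⟨i, rfl⟩
  obtain ⟨π, hπ⟩ := exists_algHom_adjoin_ne_zero (Set.finite_range g) (hgs a) ha
  let R := Algebra.adjoin k s
  let iR : R →+* K := (algebraMap F K).comp (Subalgebra.val R).toRingHom
  let jA : MvPolynomial ι R →+* K := eval₂Hom iR t
  let jC : MvPolynomial ι k →+* K := eval₂Hom (algebraMap k K) t
  let m : MvPolynomial ι k →+* MvPolynomial ι R := MvPolynomial.map (algebraMap k R)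
  have hjm : jA.comp m = jC := by
    refine MvPolynomial.ringHom_ext (fun r => ?_) fun i => ?_
    · simp only [jA, m, jC, iR, RingHom.comp_apply, map_C, coe_eval₂Hom, eval₂_C]
      exact (IsScalarTower.algebraMap_apply k F K r).symm
    · simp [jA, m, jC]
  have hjA : Function.Injective jA := by
    have h1 : Function.Injective (MvPolynomial.map (σ := ι) (Subalgebra.val R).toRingHom) :=
      MvPolynomial.map_injective _ Subtype.val_injective
    have h2 : jA = ((aeval t : MvPolynomial ι F →ₐ[F] K) : MvPolynomial ι F →+* K).comp
        (MvPolynomial.map (Subalgebra.val R).toRingHom) := by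
      refine MvPolynomial.ringHom_ext (fun r => ?_) fun i => ?_ <;> simp [jA, iR]
    have h3 : Function.Injective (aeval t : MvPolynomial ι F →ₐ[F] K) := ht
    rw [h2]
    exact fun x y hxy => h1 (h3 hxy)
  have hm : Function.Injective m :=
    MvPolynomial.map_injective _ (RingHom.injective (algebraMap k R))
  let algA : Algebra (MvPolynomial ι R) K := jA.toAlgebra
  let B := integralClosure (MvPolynomial ι R) K
  let algC : Algebra (MvPolynomial ι k) K := jC.toAlgebra
  have hfaith : FaithfulSMul (MvPolynomial ι R) K :=
    (faithfulSMul_iff_algebraMap_injective _ _).2 hjA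
  have halgC : ∀ i, ∃ c : MvPolynomial ι k, c ≠ 0 ∧ jC.IsIntegralElem (jC c * f i) := by
    intro i
    have h1 := halg i
    rw [Algebra.adjoin_range_eq_range_aeval] at h1
    have h2 : IsAlgebraic (MvPolynomial ι k) (f i) :=
      IsAlgebraic.of_ringHom_of_comp_eq (f := (aeval t : MvPolynomial ι k →ₐ[k] K).rangeRestrict)
        (g := RingHom.id K) (a := f i) h1 (aeval t).rangeRestrict_surjective
        Function.injective_id (RingHom.ext fun p => rfl)
    obtain ⟨c, hc, hci⟩ := h2.exists_integral_multiple
    refine ⟨c, hc, ?_⟩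
    rw [Algebra.smul_def] at hci
    exact hci
  choose c hc hcint using halgC
  let e := ∏ i, c i
  have he : e ≠ 0 := Finset.prod_ne_zero_iff.2 fun i _ => hc i
  have hjC : Function.Injective jC := by
    rw [← hjm]
    exact hjA.comp hm
  have hint : ∀ i, jC.IsIntegralElem (jC e * f i) := by
    intro i
    have : jC e * f i = jC (∏ l ∈ Finset.univ.erase i, c l) * (jC (c i) * f i) := by
      rw [← mul_assoc, ← map_mul, Finset.prod_erase_mul _ _ (Finset.mem_univ i)]
    rw [this]
    exact (RingHom.isIntegralElem_map jC).mul jC (hcint i)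
  have hintA : ∀ i, jC e * f i ∈ B := by
    intro i
    obtain ⟨p, hp, hp0⟩ := hint i
    refine ⟨p.map m, hp.map m, ?_⟩
    rw [Polynomial.eval₂_map]
    change Polynomial.eval₂ (jA.comp m) _ p = 0
    rw [hjm]
    exact hp0
  let b : κ → B := fun i => ⟨jC e * f i, hintA i⟩
  let ψ : MvPolynomial ι R →+* MvPolynomial ι k := MvPolynomial.map π.toRingHom
  have hψm : ψ.comp m = RingHom.id _ := by
    refine MvPolynomial.ringHom_ext (fun r => ?_) fun i => ?_ <;> simp [ψ, m]
  have : (RingHom.ker ψ).IsPrime := RingHom.ker_isPrime ψ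
  have hB : Function.Injective (algebraMap (MvPolynomial ι R) B) := by
    intro p q hpq
    exact hjA (congrArg (Subtype.val : B → K) hpq)
  obtain ⟨Q, -, hQ, hQc⟩ := Ideal.exists_ideal_over_prime_of_isIntegral (S := B) (RingHom.ker ψ) ⊥ (by
    rw [← RingHom.ker_eq_comap_bot, (RingHom.injective_iff_ker_eq_bot _).1 hB]
    exact bot_le)
  let y : B := ∑ i, algebraMap (MvPolynomial ι R) B (C (algebraMap k R (π ⟨g i, hgs i⟩))) * b i
  have hyval : (y : K) = jC e * ∑ i, algebraMap k K (π ⟨g i, hgs i⟩) * f i := by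
    rw [AddSubmonoidClass.coe_finsetSum, Finset.mul_sum]
    refine Finset.sum_congr rfl fun i _ => ?_
    have : ((algebraMap (MvPolynomial ι R) B (C (algebraMap k R (π ⟨g i, hgs i⟩))) : B) : K) =
        algebraMap k K (π ⟨g i, hgs i⟩) := by
      change jA _ = _
      simp only [jA, iR, coe_eval₂Hom, eval₂_C]
      exact (IsScalarTower.algebraMap_apply k F K _).symm
    rw [MulMemClass.coe_mul, this]
    ring
  have hy0 : y ≠ 0 := by
    intro h0
    have h1 : jC e * ∑ i, algebraMap k K (π ⟨g i, hgs i⟩) * f i = 0 := by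
      rw [← hyval, h0]
      rfl
    have h2 := (mul_eq_zero.1 h1).resolve_left ((map_ne_zero_iff _ hjC).2 he)
    simp_rw [← Algebra.smul_def] at h2
    exact hπ (Fintype.linearIndependent_iff.1 hf _ h2 a)
  have hyQ : y ∈ Q := by
    have h1 : y = ∑ i, algebraMap (MvPolynomial ι R) B
        (C (algebraMap k R (π ⟨g i, hgs i⟩)) - C ⟨g i, hgs i⟩) * b i := by
      have h0 : ∑ i, algebraMap (MvPolynomial ι R) B (C ⟨g i, hgs i⟩) * b i = 0 := by
        refine Subtype.ext ?_
        rw [AddSubmonoidClass.coe_finsetSum]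
        have : ∀ i, ((algebraMap (MvPolynomial ι R) B (C ⟨g i, hgs i⟩) * b i : B) : K) =
            jC e * (algebraMap F K (g i) * f i) := by
          intro i
          have : ((algebraMap (MvPolynomial ι R) B (C ⟨g i, hgs i⟩) : B) : K) =
            algebraMap F K (g i) := by
            change jA _ = _
            simp [jA, iR]
          rw [MulMemClass.coe_mul, this]
          ring
        simp_rw [this]
        rw [← Finset.mul_sum, hg, mul_zero]
        rfl
      rw [← sub_zero y, ← h0]
      refine (Finset.sum_sub_distrib (G := B) _ _).symm.trans ?_
      refine Finset.sum_congr rfl fun i _ => ?_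
      rw [map_sub]
      ring
    rw [h1]
    refine Ideal.sum_mem _ fun i _ => Ideal.mul_mem_right _ _ ?_
    rw [← Ideal.mem_comap, hQc, RingHom.mem_ker]
    simp [ψ]
  let algCB : Algebra (MvPolynomial ι k) B := ((algebraMap (MvPolynomial ι R) B).comp m).toAlgebra
  have hyint : IsIntegral (MvPolynomial ι k) y := by
    obtain ⟨p, hp, hp0⟩ : jC.IsIntegralElem (y : K) := by
      rw [hyval, Finset.mul_sum]
      refine IsIntegral.sum (R := MvPolynomial ι k) _ fun i _ => ?_
      change jC.IsIntegralElem _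
      rw [mul_left_comm]
      refine RingHom.IsIntegralElem.mul _ ?_ (hint i)
      have : algebraMap k K (π ⟨g i, hgs i⟩) = jC (C (π ⟨g i, hgs i⟩)) := by simp [jC]
      rw [this]
      exact RingHom.isIntegralElem_map jC
    refine ⟨p, hp, Subtype.ext ?_⟩
    have h5 : B.val.toRingHom.comp (algebraMap (MvPolynomial ι k) B) = jC := by
      rw [← hjm]
      rfl
    have := Polynomial.hom_eval₂ p (algebraMap (MvPolynomial ι k) B) B.val.toRingHom y
    rw [h5] at this
    exact this.trans hp0
  have := Ideal.comap_ne_bot_of_integral_mem hy0 hyQ hyint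
  refine this ?_
  have h3 : Q.comap (algebraMap (MvPolynomial ι k) B) = (RingHom.ker ψ).comap m := by
    rw [← hQc, Ideal.comap_comap]
    rfl
  rw [h3, RingHom.comap_ker, hψm]
  exact (RingHom.injective_iff_ker_eq_bot _).1 Function.injective_id

end LinearDisjointness

section FormSpan

variable {F K σ : Type*} [Field F] [Field K] [Algebra F K]

/-- The space of values at `z` of the forms of degree `d` with coefficients in `F`. -/
def formSpan (F : Type*) [Field F] [Algebra F K] (z : σ → K) (d : ℕ) : Submodule F K :=
  (homogeneousSubmodule σ F d).map (aeval z).toLinearMap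

instance [Finite σ] (z : σ → K) (d : ℕ) : FiniteDimensional F (formSpan F z d) := by
  have := Module.Finite.iff_fg.2 (homogeneousSubmodule_fg (σ := σ) (R := F) d)
  exact Module.Finite.map _ _

/-- If the linear span of a tuple has dimension at least `b + 1`, some point of its locus avoids
finitely many given linear subspaces of dimension at most `b`. -/
theorem exists_specialization_notMem [IsAlgClosed F] [Fintype σ] (z : σ → K) {b : ℕ}
    (hb : b + 1 ≤ Module.finrank F (Submodule.span F (Set.range z)))
    (L : Finset (Submodule F (σ → F))) (hL : ∀ V ∈ L, Module.finrank F V ≤ b) :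
    ∃ x : σ → F, (∀ P : MvPolynomial σ F, aeval z P = 0 → eval x P = 0) ∧ ∀ V ∈ L, x ∉ V := by
  classical
  have key : ∀ V ∈ L, ∃ l : (σ → F) →ₗ[F] F, (∀ x ∈ V, l x = 0) ∧
      ∑ i, algebraMap F K (l (Pi.single i 1)) * z i ≠ 0 := by
    intro V hV
    by_contra! hcon
    let Φ : Module.Dual F (σ → F) →ₗ[F] K :=
      ∑ i, ((LinearMap.toSpanSingleton F K (z i)).comp
        (LinearMap.applyₗ (Pi.single i 1 : σ → F)))
    have hΦ : ∀ l, Φ l = ∑ i, algebraMap F K (l (Pi.single i 1)) * z i := by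
      intro l
      simp [Φ, Algebra.smul_def]
    have h1 : V.dualAnnihilator ≤ LinearMap.ker Φ := by
      intro l hl
      rw [LinearMap.mem_ker, hΦ]
      exact hcon l fun x hx => (Submodule.mem_dualAnnihilator l).1 hl x hx
    have h2 : Submodule.span F (Set.range z) ≤ LinearMap.range Φ := by
      rw [Submodule.span_le]
      rintro _ ⟨i, rfl⟩
      refine ⟨LinearMap.proj i, ?_⟩
      rw [hΦ, Finset.sum_eq_single i]
      · simp
      · intro j _ hj
        simp [Pi.single_apply, hj.symm]
      · simp
    have h3 := LinearMap.finrank_range_add_finrank_ker Φ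
    have h4 := Submodule.finrank_mono h1
    have h5 := Submodule.finrank_mono h2
    have h6 := Subspace.finrank_add_finrank_dualAnnihilator_eq V
    have h7 := hL V hV
    rw [Subspace.dual_finrank_eq] at h3
    omega
  choose! l hl hl0 using key
  have hmem : ∀ i, z i ∈ Algebra.adjoin F (Set.range z) := fun i => Algebra.subset_adjoin ⟨i, rfl⟩
  have hx : ∏ V ∈ L, ∑ i, algebraMap F K (l V (Pi.single i 1)) * z i ∈
      Algebra.adjoin F (Set.range z) :=
    Subalgebra.prod_mem _ fun V _ => Subalgebra.sum_mem _ fun i _ =>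
      Subalgebra.mul_mem _ (Subalgebra.algebraMap_mem _ _) (hmem i)
  obtain ⟨π, hπ⟩ := exists_algHom_adjoin_ne_zero (Set.finite_range z) hx
    (Finset.prod_ne_zero_iff.2 fun V hV => hl0 V hV)
  let y : σ → Algebra.adjoin F (Set.range z) := fun i => ⟨z i, hmem i⟩
  refine ⟨fun i => π (y i), fun P hP => ?_, fun V hV hxV => hπ ?_⟩
  · have h1 : aeval y P = 0 := by
      apply Subtype.val_injective
      exact (comp_aeval_apply y (Algebra.adjoin F (Set.range z)).val P).trans hP
    have h2 := comp_aeval_apply y π P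
    rw [h1, map_zero] at h2
    exact h2.symm
  · have h1 : (⟨_, hx⟩ : Algebra.adjoin F (Set.range z)) =
        ∏ V ∈ L, ∑ i, algebraMap F _ (l V (Pi.single i 1)) * y i := by
      apply Subtype.val_injective
      simp [y]
    rw [h1, map_prod]
    refine Finset.prod_eq_zero hV ?_
    have h2 := hl V hV _ hxV
    rw [LinearMap.pi_apply_eq_sum_univ] at h2
    rw [map_sum, ← h2]
    refine Finset.sum_congr rfl fun i _ => ?_
    rw [map_mul, AlgHom.commutes, smul_eq_mul, mul_comm]
    congr 1
    change l V _ = l V _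
    congr 1
    funext j
    simp [Pi.single_apply, eq_comm]

theorem exists_specializations_general_position [IsAlgClosed F] [Fintype σ] (z : σ → K) {b : ℕ}
    (hb : b + 1 ≤ Module.finrank F (Submodule.span F (Set.range z))) (n : ℕ) :
    ∃ x : ℕ → σ → F, (∀ i < n, ∀ P : MvPolynomial σ F, aeval z P = 0 → eval (x i) P = 0) ∧
      ∀ T ⊆ Finset.range n, T.card ≤ b + 1 → LinearIndepOn F x (T : Set ℕ) := by
  classical
  induction n with
  | zero =>
    refine ⟨0, fun i hi => absurd hi (Nat.not_lt_zero i), fun T hT _ => ?_⟩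
    obtain rfl : T = ∅ := by simpa using hT
    simpa using linearIndepOn_empty F (0 : ℕ → σ → F)
  | succ n ih =>
    obtain ⟨x, hx, hxT⟩ := ih
    obtain ⟨y, hy, hyT⟩ := exists_specialization_notMem z hb
      (((Finset.range n).powerset.filter fun T => T.card ≤ b).image
        fun T : Finset ℕ => Submodule.span F (x '' (T : Set ℕ))) (by
        intro V hV
        obtain ⟨T, hT, rfl⟩ := Finset.mem_image.1 hV
        rw [← Finset.coe_image]
        exact (finrank_span_finset_le_card _).trans
          (Finset.card_image_le.trans (Finset.mem_filter.1 hT).2))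
    have hup : ∀ i, i ≠ n → Function.update x n y i = x i := fun i hi =>
      Function.update_of_ne hi _ _
    have hon : ∀ T ⊆ Finset.range n, Set.EqOn x (Function.update x n y) (T : Set ℕ) := by
      intro T hT i hi
      exact (hup i (Finset.mem_range.1 (hT hi)).ne).symm
    refine ⟨Function.update x n y, fun i hi P hP => ?_, fun T hT hcard => ?_⟩
    · rcases Nat.lt_succ_iff_lt_or_eq.1 hi with h | rfl
      · rw [hup i h.ne]
        exact hx i h P hP
      · rw [Function.update_self]
        exact hy P hP
    · by_cases hn : n ∈ T
      · have hsub : T.erase n ⊆ Finset.range n := by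
          intro i hi
          have h1 := Finset.mem_range.1 (hT (Finset.mem_of_mem_erase hi))
          have h2 := Finset.ne_of_mem_erase hi
          exact Finset.mem_range.2 (by omega)
        have hc : (T.erase n).card ≤ b := by
          rw [Finset.card_erase_of_mem hn]
          omega
        rw [← Finset.insert_erase hn, Finset.coe_insert,
          linearIndepOn_insert (by simp)]
        refine ⟨(hxT _ hsub (by omega)).congr (hon _ hsub), ?_⟩
        rw [Function.update_self, ← Set.EqOn.image_eq (hon _ hsub)]
        exact hyT _ (Finset.mem_image_of_mem _
          (Finset.mem_filter.2 ⟨Finset.mem_powerset.2 hsub, hc⟩))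
      · have hsub : T ⊆ Finset.range n := by
          intro i hi
          have h1 := Finset.mem_range.1 (hT hi)
          have h2 : i ≠ n := fun h => hn (h ▸ hi)
          exact Finset.mem_range.2 (by omega)
        exact (hxT T hsub hcard).congr (hon _ hsub)

/-- Linear forms separating a vector from finitely many others. -/
theorem exists_form_separating [Fintype σ] {ι : Type*} {x : ι → σ → F} {T : Finset ι} {i : ι}
    (hi : i ∉ T) (hind : LinearIndepOn F x (insert i (T : Set ι))) :
    ∃ l : MvPolynomial σ F, l.IsHomogeneous 1 ∧ eval (x i) l = 1 ∧ ∀ j ∈ T, eval (x j) l = 0 := by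
  classical
  have h1 : x i ∉ Submodule.span F (x '' T) := ((linearIndepOn_insert (by simpa using hi)).1 hind).2
  obtain ⟨f, hf0, hf⟩ := Submodule.exists_le_ker_of_notMem h1
  let l : MvPolynomial σ F := ∑ s, C ((f (x i))⁻¹ * f (Pi.single s 1)) * X s
  have hl : ∀ v, eval v l = (f (x i))⁻¹ * f v := by
    intro v
    have h2 := LinearMap.pi_apply_eq_sum_univ f v
    rw [h2, Finset.mul_sum]
    simp only [l, map_sum, map_mul, eval_C, eval_X, smul_eq_mul]
    refine Finset.sum_congr rfl fun s _ => ?_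
    rw [mul_assoc, mul_comm (v s)]
    congr 3
    funext j
    simp [Pi.single_apply, eq_comm]
  have hl1 : l.IsHomogeneous 1 := by
    refine IsHomogeneous.sum Finset.univ _ 1 fun s _ => ?_
    simpa using (isHomogeneous_C σ ((f (x i))⁻¹ * f (Pi.single s 1))).mul (isHomogeneous_X F s)
  refine ⟨l, hl1, ?_, fun j hj => ?_⟩
  · rw [hl, inv_mul_cancel₀ hf0]
  · have : f (x j) = 0 := hf (Submodule.subset_span ⟨j, hj, rfl⟩)
    rw [hl, this, mul_zero]

/-- Hopf-type lower bound for the dimension of the space of forms of degree `d`. -/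
theorem le_finrank_formSpan [IsAlgClosed F] [Fintype σ] (z : σ → K) {b : ℕ}
    (hb : b + 1 ≤ Module.finrank F (Submodule.span F (Set.range z))) (d : ℕ) :
    d * b + 1 ≤ Module.finrank F (formSpan F z d) := by
  classical
  obtain ⟨x, hx, hxT⟩ := exists_specializations_general_position z hb (d * b + 1)
  have key : ∀ i : Fin (d * b + 1), ∃ Q : MvPolynomial σ F, Q.IsHomogeneous d ∧
      ∀ j : Fin (d * b + 1), eval (x j) Q = if i = j then 1 else 0 := by
    intro i
    have hcard : Fintype.card (Fin d × Fin b) =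
        Fintype.card {j : Fin (d * b + 1) // j ≠ i} := by
      rw [Fintype.card_subtype_compl]
      simp
    let e := Fintype.equivOfCardEq hcard
    let T : Fin d → Finset ℕ := fun a => Finset.univ.image fun c : Fin b => ((e (a, c)).1 : ℕ)
    have hT : ∀ a, (i : ℕ) ∉ T a := by
      intro a ha
      obtain ⟨c, -, hc⟩ := Finset.mem_image.1 ha
      exact (e (a, c)).2 (Fin.ext hc)
    have hl : ∀ a, ∃ l : MvPolynomial σ F, l.IsHomogeneous 1 ∧ eval (x i) l = 1 ∧
        ∀ j ∈ T a, eval (x j) l = 0 := by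
      intro a
      refine exists_form_separating (hT a) ?_
      rw [← Finset.coe_insert]
      refine hxT _ ?_ ?_
      · intro j hj
        rcases Finset.mem_insert.1 hj with rfl | hj
        · exact Finset.mem_range.2 i.2
        · obtain ⟨c, -, rfl⟩ := Finset.mem_image.1 hj
          exact Finset.mem_range.2 (Fin.is_lt _)
      · rw [Finset.card_insert_of_notMem (hT a)]
        have := Finset.card_image_le (s := (Finset.univ : Finset (Fin b)))
          (f := fun c : Fin b => ((e (a, c)).1 : ℕ))
        simp only [Finset.card_univ, Fintype.card_fin] at this
        exact Nat.succ_le_succ this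
    choose l hl1 hl2 hl3 using hl
    refine ⟨∏ a, l a, ?_, fun j => ?_⟩
    · have := IsHomogeneous.prod Finset.univ l (fun _ => 1) fun a _ => hl1 a
      simpa using this
    · rw [map_prod]
      split_ifs with hij
      · subst hij
        exact Finset.prod_eq_one fun a _ => hl2 a
      · refine Finset.prod_eq_zero (Finset.mem_univ (e.symm ⟨j, Ne.symm hij⟩).1) ?_
        refine hl3 _ _ (Finset.mem_image.2 ⟨(e.symm ⟨j, Ne.symm hij⟩).2, Finset.mem_univ _, ?_⟩)
        simp
  choose Q hQ hQx using key
  have hind : LinearIndependent F fun i => (⟨aeval z (Q i), Q i, hQ i, rfl⟩ : formSpan F z d) := by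
    rw [Fintype.linearIndependent_iff]
    intro g hg j
    have h1 : aeval z (∑ i, C (g i) * Q i) = 0 := by
      have := congrArg Subtype.val hg
      simpa [Algebra.smul_def] using this
    have h2 := hx j j.2 _ h1
    simpa [hQx] using h2
  simpa using hind.fintype_card_le_finrank

theorem choose_le_finrank_formSpan [Fintype σ] (z : σ → K) {T : Finset σ}
    (hT : AlgebraicIndependent F fun i : T => z i) (d : ℕ) :
    (T.card + d - 1).choose d ≤ Module.finrank F (formSpan F z d) := by
  classical
  let I := (Finset.univ : Finset T).finsuppAntidiag d
  have hmem : ∀ α : I, aeval (fun i : T => z i) (monomial (α : T →₀ ℕ) (1 : F)) ∈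
      formSpan F z d := by
    intro α
    refine ⟨rename Subtype.val (monomial (α : T →₀ ℕ) (1 : F)), ?_, ?_⟩
    · refine IsHomogeneous.rename_isHomogeneous (isHomogeneous_monomial _ ?_)
      have := (Finset.mem_finsuppAntidiag.1 α.2).1
      rw [Finsupp.degree_eq_sum]
      exact this
    · exact aeval_rename _ _ _
  have h1 : LinearIndependent F fun α : I => aeval (fun i : T => z i)
      (monomial (α : T →₀ ℕ) (1 : F)) := by
    have h2 := (basisMonomials T F).linearIndependent.map' (aeval fun i : T => z i).toLinearMap
      (LinearMap.ker_eq_bot.2 hT)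
    have h3 := h2.comp (Subtype.val : I → T →₀ ℕ) Subtype.val_injective
    have h6 : (fun α : I => aeval (fun i : T => z i) (monomial (α : T →₀ ℕ) (1 : F))) =
        (((aeval fun i : T => z i).toLinearMap : MvPolynomial T F →ₗ[F] K) ∘
          ⇑(basisMonomials T F)) ∘ (Subtype.val : I → T →₀ ℕ) := by
      funext α
      simp
    rw [h6]
    exact h3
  have h4 : LinearIndependent F fun α : I => (⟨_, hmem α⟩ : formSpan F z d) :=
    LinearIndependent.of_comp (formSpan F z d).subtype h1
  have h5 := h4.fintype_card_le_finrank
  rw [Fintype.card_coe, Finset.card_finsuppAntidiag_nat_eq_choose] at h5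
  simpa using h5

end FormSpan

section ZeroDrop

theorem exists_finset_card_add_finrank_ker {k V ι : Type*} [Field k] [AddCommGroup V] [Module k V]
    [Fintype ι] (c : ι → V) :
    ∃ T : Finset ι, T.card + Module.finrank k (LinearMap.ker (Fintype.linearCombination k c)) =
      Fintype.card ι ∧ ∀ i, c i ∈ Submodule.span k (c '' T) := by
  classical
  obtain ⟨s, -, -, hspan, hs⟩ := exists_linearIndepOn_extension (K := k) (v := c)
    (linearIndepOn_empty k c) (Set.subset_univ ∅)
  have hspan' : Submodule.span k (Set.range c) = Submodule.span k (c '' s) := by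
    refine le_antisymm ?_ (Submodule.span_mono (Set.image_subset_range _ _))
    rw [Submodule.span_le, ← Set.image_univ]
    exact hspan
  refine ⟨s.toFinset, ?_, fun i => ?_⟩
  · have h1 := LinearMap.finrank_range_add_finrank_ker (Fintype.linearCombination k c)
    rw [Fintype.range_linearCombination, hspan', Module.finrank_fintype_fun_eq_card] at h1
    have h2 : Module.finrank k (Submodule.span k (c '' s)) = s.toFinset.card := by
      rw [Set.image_eq_range]
      have := finrank_span_eq_card (R := k) (b := fun i : s => c i) hs
      rw [this, Set.toFinset_card]
    omega
  · rw [Set.coe_toFinset, ← hspan']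
    exact Submodule.subset_span ⟨i, rfl⟩

/-- Linear disjointness bounds the number of independent coefficients of a relation. -/
theorem exists_finset_span_of_sum_mul_eq_zero {k F K : Type*} [Field k] [Field F] [Field K]
    [Algebra k F] [Algebra F K] [Algebra k K] [IsScalarTower k F K] [IsAlgClosed k]
    {ι τ : Type*} [Fintype ι] {t : τ → K} (ht : AlgebraicIndependent F t) {c : ι → F} {w : ι → K}
    (halg : ∀ i, IsAlgebraic (Algebra.adjoin k (Set.range t)) (w i))
    (hc : ∑ i, algebraMap F K (c i) * w i = 0) :
    ∃ T : Finset ι, T.card + Module.finrank k (Submodule.span k (Set.range w)) ≤ Fintype.card ι ∧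
      ∀ i, c i ∈ Submodule.span k (c '' T) := by
  classical
  obtain ⟨T, hT, hspan⟩ := exists_finset_card_add_finrank_ker (k := k) c
  refine ⟨T, ?_, hspan⟩
  rw [← hT]
  refine Nat.add_le_add_left ?_ _
  let W := Submodule.span k (Set.range w)
  have : FiniteDimensional k W := FiniteDimensional.span_of_finite k (Set.finite_range w)
  let w' : ι → W := fun i => ⟨w i, Submodule.subset_span ⟨i, rfl⟩⟩
  let Φ : Module.Dual k W →ₗ[k] (ι → k) := LinearMap.pi fun i => LinearMap.applyₗ (w' i)
  have hΦ : LinearMap.ker Φ = ⊥ := by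
    rw [LinearMap.ker_eq_bot']
    intro φ hφ
    have h1 : Submodule.span k (Set.range w') = ⊤ := by
      have := Submodule.span_span_coe_preimage (R := k) (s := Set.range w)
      convert this using 2
      ext x
      simp [w', Subtype.ext_iff]
    refine LinearMap.ext_on_range h1 fun i => ?_
    exact congrFun hφ i
  let b := Module.finBasis k W
  have hbalg : ∀ a, IsAlgebraic (Algebra.adjoin k (Set.range t)) ((b a : W) : K) := by
    intro a
    have : ∀ x ∈ W, IsAlgebraic (Algebra.adjoin k (Set.range t)) x := by
      intro x hx
      refine Submodule.span_induction ?_ isAlgebraic_zero (fun x y _ _ => IsAlgebraic.add)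
        (fun r x _ hx => ?_) hx
      · rintro _ ⟨i, rfl⟩
        exact halg i
      · have h2 : r • x = (algebraMap k (Algebra.adjoin k (Set.range t)) r) • x := by
          rw [algebraMap_smul]
        rw [h2]
        exact hx.smul _
    exact this _ (b a).2
  have hbind : LinearIndependent k fun a => ((b a : W) : K) :=
    b.linearIndependent.map' W.subtype (Submodule.ker_subtype W)
  have hsum : ∀ i, w i = ∑ a, algebraMap k K (b.repr (w' i) a) * ((b a : W) : K) := by
    intro i
    have := congrArg Subtype.val (b.sum_repr (w' i))
    rw [AddSubmonoidClass.coe_finsetSum] at this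
    rw [← show ((w' i : W) : K) = w i from rfl, ← this]
    refine Finset.sum_congr rfl fun a _ => ?_
    rw [Submodule.coe_smul, Algebra.smul_def]
  have hzero : (fun a => ∑ i, c i * algebraMap k F (b.repr (w' i) a)) = 0 := by
    refine linearIndependent_of_algebraicIndependent ht hbind hbalg ?_
    rw [← hc]
    simp_rw [map_sum, Finset.sum_mul]
    rw [Finset.sum_comm]
    refine Finset.sum_congr rfl fun i _ => ?_
    rw [hsum i, Finset.mul_sum]
    refine Finset.sum_congr rfl fun a _ => ?_
    rw [map_mul, ← IsScalarTower.algebraMap_apply, mul_assoc]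
  have hle : LinearMap.range Φ ≤ LinearMap.ker (Fintype.linearCombination k c) := by
    rintro _ ⟨φ, rfl⟩
    rw [LinearMap.mem_ker, Fintype.linearCombination_apply]
    have h1 : ∀ i, Φ φ i = ∑ a, b.repr (w' i) a * φ (b a) := by
      intro i
      change φ (w' i) = _
      conv_lhs => rw [← b.sum_repr (w' i)]
      simp only [map_sum, map_smul, smul_eq_mul]
    simp_rw [h1, Finset.sum_smul]
    rw [Finset.sum_comm]
    refine Finset.sum_eq_zero fun a _ => ?_
    have h2 := congrFun hzero a
    simp only [Pi.zero_apply] at h2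
    calc ∑ i, (b.repr (w' i) a * φ (b a)) • c i
        = φ (b a) • ∑ i, c i * algebraMap k F (b.repr (w' i) a) := by
          rw [Finset.smul_sum]
          refine Finset.sum_congr rfl fun i _ => ?_
          simp only [Algebra.smul_def, map_mul]
          ring
      _ = 0 := by rw [h2, smul_zero]
  have h3 := Submodule.finrank_mono hle
  rw [LinearMap.finrank_range_of_inj (LinearMap.ker_eq_bot.1 hΦ), Subspace.dual_finrank_eq] at h3
  exact h3

end ZeroDrop

section IntermediateFields

variable {k F K σ : Type*} [Field k] [Field F] [Field K] [Algebra k F] [Algebra F K]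

theorem algebraicIndependent_of_le {E E' : IntermediateField k F} (h : E ≤ E') {z : σ → K}
    (hz : AlgebraicIndependent E' z) : AlgebraicIndependent E z := by
  let : Algebra E E' := (IntermediateField.inclusion h).toRingHom.toAlgebra
  have : IsScalarTower E E' K := IsScalarTower.of_algebraMap_eq fun _ => rfl
  exact AlgebraicIndependent.restrictScalars (algebraMap E E').injective hz

theorem span_monomials_eq_formSpan [Fintype σ] [DecidableEq σ] (z : σ → K) (d : ℕ) :
    Submodule.span F (Set.range fun α : (Finset.univ : Finset σ).finsuppAntidiag d =>
      aeval z (monomial (α : σ →₀ ℕ) (1 : F))) = formSpan F z d := by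
  have hI : ∀ α : σ →₀ ℕ, α ∈ (Finset.univ : Finset σ).finsuppAntidiag d ↔ α.degree = d := by
    intro α
    rw [Finset.mem_finsuppAntidiag, Finsupp.degree_eq_sum]
    simp
  apply le_antisymm
  · rw [Submodule.span_le]
    rintro _ ⟨α, rfl⟩
    exact ⟨_, isHomogeneous_monomial _ ((hI α).1 α.2), rfl⟩
  · rintro _ ⟨P, hP, rfl⟩
    change aeval z P ∈ _
    rw [P.as_sum, map_sum]
    refine Submodule.sum_mem _ fun α hα => ?_
    have h1 : monomial α (coeff α P) = coeff α P • monomial α (1 : F) := by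
      rw [smul_monomial, smul_eq_mul, mul_one]
    rw [h1, map_smul]
    refine Submodule.smul_mem _ _ (Submodule.subset_span ⟨⟨α, (hI α).2 ?_⟩, rfl⟩)
    rw [Finsupp.degree_eq_weight_one]
    exact hP (mem_support_iff.1 hα)

theorem exists_finset_span_coeff [Fintype σ] [DecidableEq σ] {E E' : IntermediateField k F}
    (h : E ≤ E') (hE : IsAlgClosed E) {z : σ → K} {T : Set σ} (hT : AlgebraicIndepOn E' z T)
    (halg : ∀ i, IsAlgebraic (Algebra.adjoin E (Set.range fun j : T => z j)) (z i))
    {d : ℕ} {Q : MvPolynomial σ F} (hQ : Q.IsHomogeneous d) (h0 : aeval z Q = 0)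
    (hQE : ∀ α, coeff α Q ∈ E') :
    ∃ T' : Finset ((Finset.univ : Finset σ).finsuppAntidiag d),
      T'.card + Module.finrank E (formSpan E z d) ≤ (Fintype.card σ + d - 1).choose d ∧
      ∀ α : (Finset.univ : Finset σ).finsuppAntidiag d, coeff (α : σ →₀ ℕ) Q ∈
        Submodule.span E ((fun β : (Finset.univ : Finset σ).finsuppAntidiag d =>
          coeff (β : σ →₀ ℕ) Q) '' T') := by
  let : Algebra E E' := (IntermediateField.inclusion h).toRingHom.toAlgebra
  have : IsScalarTower E E' K := IsScalarTower.of_algebraMap_eq fun _ => rfl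
  have : IsScalarTower E E' F := IsScalarTower.of_algebraMap_eq fun _ => rfl
  let I := (Finset.univ : Finset σ).finsuppAntidiag d
  have hI : ∀ α : σ →₀ ℕ, α ∈ I ↔ α.degree = d := by
    intro α
    rw [Finset.mem_finsuppAntidiag, Finsupp.degree_eq_sum]
    simp
  let w : I → K := fun α => aeval z (monomial (α : σ →₀ ℕ) (1 : E))
  let c : I → E' := fun α => ⟨coeff α Q, hQE α⟩
  have hw : ∀ α, w α = ∏ i, z i ^ (α : σ →₀ ℕ) i := by
    intro α
    simp [w, aeval_monomial, Finsupp.prod_fintype]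
  have hwalg : ∀ α, IsAlgebraic (Algebra.adjoin E (Set.range fun j : T => z j)) (w α) := by
    intro α
    rw [hw]
    refine Finset.prod_induction _ (IsAlgebraic _) (fun _ _ => IsAlgebraic.mul) isAlgebraic_one
      fun i _ => (halg i).pow _
  have hsum : ∑ α, algebraMap E' K (c α) * w α = 0 := by
    rw [← h0, aeval_def, eval₂_eq']
    simp_rw [hw]
    refine (Finset.sum_coe_sort I fun α => algebraMap F K (coeff α Q) * ∏ i, z i ^ α i).trans ?_
    refine (Finset.sum_subset (fun α hα => (hI α).2 ?_) fun α _ hα => ?_).symm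
    · rw [Finsupp.degree_eq_weight_one]
      exact hQ (mem_support_iff.1 hα)
    · rw [notMem_support_iff.1 hα, map_zero, zero_mul]
  obtain ⟨T', hT'c, hspan⟩ := exists_finset_span_of_sum_mul_eq_zero hT hwalg hsum
  rw [span_monomials_eq_formSpan, Fintype.card_coe, Finset.card_finsuppAntidiag_nat_eq_choose,
    Finset.card_univ] at hT'c
  refine ⟨T', hT'c, fun α => ?_⟩
  have h1 := Submodule.mem_map_of_mem (f := (IsScalarTower.toAlgHom E E' F).toLinearMap) (hspan α)
  rw [Submodule.map_span, ← Set.image_comp] at h1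
  exact h1

end IntermediateFields

section Rho

variable {k F K σ : Type*} [Field k] [Field F] [Field K] [Algebra k F] [Algebra F K] [Fintype σ]

variable (k) in
/-- The transcendence degree of the tuple `z` over the algebraic closure of the subfield
generated by `S`. -/
def rho (S : Set F) (z : σ → K) : ℕ := by
  classical
  exact (Finset.univ.powerset.filter fun T : Finset σ =>
    AlgebraicIndepOn (acl k S) z (T : Set σ)).sup Finset.card

theorem le_rho {S : Set F} {z : σ → K} {T : Finset σ}
    (hT : AlgebraicIndepOn (acl k S) z (T : Set σ)) : T.card ≤ rho k S z := by
  classical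
  exact Finset.le_sup (f := Finset.card) (Finset.mem_filter.2 ⟨by simp, hT⟩)

theorem exists_card_eq_rho (S : Set F) (z : σ → K) :
    ∃ T : Finset σ, AlgebraicIndepOn (acl k S) z (T : Set σ) ∧ T.card = rho k S z := by
  classical
  have hne : (Finset.univ.powerset.filter fun T : Finset σ =>
      AlgebraicIndepOn (acl k S) z (T : Set σ)).Nonempty := by
    refine ⟨∅, Finset.mem_filter.2 ⟨by simp, ?_⟩⟩
    rw [Finset.coe_empty]
    exact (algebraicIndependent_empty_type_iff).2 (algebraMap (acl k S) K).injective
  obtain ⟨T, hT, h⟩ := Finset.exists_mem_eq_sup _ hne Finset.card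
  exact ⟨T, (Finset.mem_filter.1 hT).2, h.symm⟩

theorem AlgebraicIndepOn.acl_mono {S S' : Set F} (h : S ⊆ acl k S') {z : σ → K} {T : Set σ}
    (hT : AlgebraicIndepOn (acl k S') z T) : AlgebraicIndepOn (acl k S) z T :=
  algebraicIndependent_of_le (acl_le h) hT

theorem rho_anti {S S' : Set F} (h : S ⊆ acl k S') (z : σ → K) : rho k S' z ≤ rho k S z := by
  obtain ⟨T, hT, hc⟩ := exists_card_eq_rho (k := k) S' z
  rw [← hc]
  exact le_rho (AlgebraicIndepOn.acl_mono h hT)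

theorem rho_le_card {S : Set F} {z : σ → K} {B : Finset σ}
    (h : ∀ i, z i ∈ Submodule.span (acl k S) (z '' B)) : rho k S z ≤ B.card := by
  classical
  obtain ⟨T, hT, hc⟩ := exists_card_eq_rho (k := k) S z
  rw [← hc]
  have h1 : AlgebraicIndependent (acl k S) fun i : Fin T.card => z (T.equivFin.symm i) :=
    AlgebraicIndependent.comp hT _ T.equivFin.symm.injective
  refine (card_le_of_algebraicIndependent (B := B.image z) h1 fun i => ?_).trans Finset.card_image_le
  have h2 : Submodule.span (acl k S) (z '' B) ≤
      (acl (acl k S) ((B.image z : Finset K) : Set K)).toSubalgebra.toSubmodule := by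
    rw [Submodule.span_le, ← Finset.coe_image]
    exact subset_acl _
  exact h2 (h _)

theorem card_le_rho_of_field {S : Set F} {z : σ → K} {T : Finset σ}
    (hT : AlgebraicIndepOn F z (T : Set σ)) : T.card ≤ rho k S z :=
  le_rho (AlgebraicIndependent.restrictScalars (algebraMap (acl k S) F).injective hT)

variable [IsAlgClosed F]

/-- The coefficients of a form vanishing at `z` are constrained as soon as adjoining them does not
drop the transcendence degree of `z`. -/
theorem dle_coeff_of_rho_le {S : Set F} {z : σ → K} {d : ℕ} {Q : MvPolynomial σ F}
    (hQ : Q.IsHomogeneous d) (h0 : aeval z Q = 0)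
    (hrho : rho k S z ≤ rho k (S ∪ Set.range fun α => coeff α Q) z) :
    Dle k S (Set.range fun α => coeff α Q) ((Fintype.card σ + d - 1).choose d -
      Module.finrank (acl k S) (formSpan (acl k S) z d)) := by
  classical
  set S' := S ∪ Set.range fun α => coeff α Q with hS'
  obtain ⟨T, hT, hc⟩ := exists_card_eq_rho (k := k) S' z
  have hSS : S ⊆ acl k S' := Set.subset_union_left.trans (subset_acl _)
  have hT' := AlgebraicIndepOn.acl_mono hSS hT
  have halg : ∀ i, IsAlgebraic (Algebra.adjoin (acl k S) (Set.range fun j : (T : Set σ) => z j))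
      (z i) := by
    intro i
    by_cases hi : i ∈ T
    · exact isAlgebraic_algebraMap (⟨z i, Algebra.subset_adjoin ⟨⟨i, hi⟩, rfl⟩⟩ :
        Algebra.adjoin (acl k S) (Set.range fun j : (T : Set σ) => z j))
    · by_contra htr
      have h1 : AlgebraicIndepOn (acl k S) z (insert i (T : Set σ)) := by
        refine hT'.insert ?_
        rw [Set.image_eq_range]
        exact htr
      rw [← Finset.coe_insert] at h1
      have := le_rho h1
      rw [Finset.card_insert_of_notMem hi] at this
      omega
  let I := (Finset.univ : Finset σ).finsuppAntidiag d
  have hI : ∀ α : σ →₀ ℕ, α ∈ I ↔ α.degree = d := by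
    intro α
    rw [Finset.mem_finsuppAntidiag, Finsupp.degree_eq_sum]
    simp
  have hcoef : ∀ α, coeff α Q ∈ acl k S' := fun α =>
    subset_acl _ (Set.mem_union_right _ ⟨α, rfl⟩)
  obtain ⟨T', hT'c, hspan⟩ := exists_finset_span_coeff (acl_le hSS) (acl_isAlgClosed S) hT halg
    hQ h0 hcoef
  have h1 : Dle k S (Set.range fun α : I => coeff (α : σ →₀ ℕ) Q) T'.card := by
    refine Dle.range_of_subset _ _ fun α _ => ?_
    have h2 : ∀ x ∈ Submodule.span (acl k S) ((fun β : I => coeff (β : σ →₀ ℕ) Q) '' T'),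
        x ∈ acl k (S ∪ (fun β : I => coeff (β : σ →₀ ℕ) Q) '' T') := by
      intro x hx
      refine Submodule.span_induction (fun y hy => subset_acl _ (Set.mem_union_right _ hy))
        (zero_mem _) (fun _ _ _ _ => add_mem) (fun r y _ hy => ?_) hx
      exact mul_mem (acl_mono Set.subset_union_left r.2) hy
    exact h2 _ (hspan α)
  refine h1.mono (subset_acl _) ?_ (by omega)
  rintro _ ⟨α, rfl⟩
  by_cases hα : α ∈ I
  · exact subset_acl _ (Set.mem_union_right _ ⟨⟨α, hα⟩, rfl⟩)
  · have : coeff α Q = 0 := hQ.coeff_eq_zero fun h => hα ((hI α).2 h)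
    simp only [this]
    exact zero_mem _

end Rho

section Counting

theorem choose_two_le_choose : ∀ {N d : ℕ}, 2 ≤ d → d + 2 ≤ N → N.choose 2 ≤ N.choose d := by
  intro N
  induction N with
  | zero => intro d _ h; omega
  | succ N ih =>
    intro d h2 h
    rcases h2.eq_or_lt with rfl | h3
    · exact le_rfl
    rcases h.eq_or_lt with h4 | h4
    · rw [← h4, Nat.choose_symm_add]
    obtain ⟨e, rfl⟩ : ∃ e, d = e + 1 := ⟨d - 1, by omega⟩
    rw [Nat.choose_succ_succ' N e, Nat.choose_succ_succ' N 1, one_add_one_eq_two]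
    have h5 := ih (d := e) (by omega) (by omega)
    have h6 := ih (d := e + 1) (by omega) (by omega)
    have h7 : N.choose 1 ≤ N.choose 2 := by
      rw [Nat.choose_one_right, Nat.choose_two_right, Nat.le_div_iff_mul_le (by norm_num)]
      exact Nat.mul_le_mul_left _ (by omega)
    omega

theorem exists_late_stationary_step {f : ℕ → ℕ} (hf : ∀ i, f (i + 1) ≤ f i) {m : ℕ}
    (h0 : f 0 ≤ m + 1) (hm : 2 ≤ f m) :
    ∃ i < m, f i = f (i + 1) ∧ 2 + (m - 1 - i) ≤ f i := by
  by_contra! hcon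
  have key : ∀ t ≤ m, 2 + t ≤ f (m - t) := by
    intro t
    induction t with
    | zero => intro _; simpa using hm
    | succ t ih =>
      intro ht
      have h1 := ih (by omega)
      have h2 := hf (m - (t + 1))
      have h3 := hcon (m - (t + 1)) (by omega)
      rw [show m - (t + 1) + 1 = m - t by omega] at h2 h3
      by_contra h4
      have h5 := h3 (by omega)
      omega
  have := key m le_rfl
  simp at this
  omega

theorem le_card_stationary_steps (f : ℕ → ℕ) (hf : ∀ i, f (i + 1) ≤ f i) (m : ℕ) :
    m + f m ≤ ((Finset.range m).filter fun i => f i = f (i + 1)).card + f 0 := by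
  induction m with
  | zero => simp
  | succ m ih =>
    rw [Finset.range_add_one, Finset.filter_insert]
    have := hf m
    split_ifs with h
    · rw [Finset.card_insert_of_notMem (by simp)]
      omega
    · omega

theorem sum_range_card_le_sum {g : ℕ → ℕ} (hg : Monotone g) (Z : Finset ℕ) :
    ∑ i ∈ Finset.range Z.card, g i ≤ ∑ i ∈ Z, g i := by
  induction Z using Finset.induction_on_max with
  | empty => simp
  | insert a Z ha ih =>
    have hn : a ∉ Z := fun h => lt_irrefl _ (ha a h)
    rw [Finset.card_insert_of_notMem hn, Finset.sum_range_succ, Finset.sum_insert hn, add_comm]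
    refine add_le_add (hg ?_) ih
    have : Z ⊆ Finset.range a := fun x hx => Finset.mem_range.2 (ha x hx)
    simpa using Finset.card_le_card this

end Counting

theorem Dle.iUnion_lt {k K : Type*} [Field k] [Field K] [Algebra k K] {S : Set K} {C : ℕ → Set K}
    {w : ℕ → ℕ} {m : ℕ}
    (h : ∀ i < m, Dle k (S ∪ ⋃ j < i, C j) (C i) (w i)) :
    Dle k S (⋃ i < m, C i) (∑ i ∈ Finset.range m, w i) := by
  induction m with
  | zero => exact Dle.of_subset_acl (by simp) _
  | succ m ih =>
    rw [Set.biUnion_lt_succ, Finset.sum_range_succ]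
    exact (ih fun i hi => h i (by omega)).trans (h m (by omega))

/-- The set of coefficients of a polynomial. -/
abbrev coeffSet {σ F : Type*} [CommSemiring F] (Q : MvPolynomial σ F) : Set F :=
  Set.range fun α => coeff α Q

section Regularity

variable {k F K σ : Type*} [Field k] [Field F] [Field K] [Algebra k F] [Algebra F K] [Fintype σ]

theorem dle_coeffSet {S : Set F} {d : ℕ} {Q : MvPolynomial σ F} (hQ : Q.IsHomogeneous d) :
    Dle k S (coeffSet Q) ((Fintype.card σ + d - 1).choose d) := by
  classical
  let I := (Finset.univ : Finset σ).finsuppAntidiag d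
  have h1 : Dle k S (Set.range fun α : I => coeff (α : σ →₀ ℕ) Q) _ := Dle.range _
  rw [Fintype.card_coe, Finset.card_finsuppAntidiag_nat_eq_choose, Finset.card_univ] at h1
  refine h1.mono (subset_acl _) ?_ le_rfl
  rintro _ ⟨α, rfl⟩
  by_cases hα : α ∈ I
  · exact subset_acl _ (Set.mem_union_right _ ⟨⟨α, hα⟩, rfl⟩)
  · have : coeff α Q = 0 := hQ.coeff_eq_zero fun h => hα (by
      rw [Finset.mem_finsuppAntidiag, ← h, Finsupp.degree_eq_sum]; simp)
    simp only [this]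
    exact zero_mem _

theorem finrank_formSpan_le (z : σ → K) (d : ℕ) :
    Module.finrank F (formSpan F z d) ≤ (Fintype.card σ + d - 1).choose d := by
  classical
  rw [← span_monomials_eq_formSpan]
  refine (finrank_range_le_card _).trans_eq ?_
  rw [Fintype.card_coe, Finset.card_finsuppAntidiag_nat_eq_choose, Finset.card_univ]

theorem finrank_span_le_of_intermediateField (E : IntermediateField k F) (z : σ → K) :
    Module.finrank F (Submodule.span F (Set.range z)) ≤
      Module.finrank E (Submodule.span E (Set.range z)) := by
  obtain ⟨s, hs, hspan, hli⟩ := exists_linearIndependent F (Set.range z)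
  have hfin : s.Finite := (Set.finite_range z).subset hs
  have := hfin.fintype
  rw [← hspan, finrank_span_set_eq_card hli, Set.toFinset_card]
  have h1 : LinearIndependent E ((↑) : s → K) := hli.restrict_scalars
    fun a b h => by simpa [Algebra.smul_def] using h
  have : FiniteDimensional E (Submodule.span E (Set.range z)) :=
    FiniteDimensional.span_of_finite E (Set.finite_range z)
  let y : s → Submodule.span E (Set.range z) := fun x => ⟨x, Submodule.subset_span (hs x.2)⟩
  have h2 : LinearIndependent E y :=
    LinearIndependent.of_comp (Submodule.span E (Set.range z)).subtype h1
  exact h2.fintype_card_le_finrank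

variable [IsAlgClosed F]

theorem exists_dle_of_rho_le {S : Set F} {z : σ → K} {d D : ℕ} {Q : MvPolynomial σ F}
    (hQ : Q.IsHomogeneous d) (h0 : aeval z Q = 0)
    (hrho : rho k S z ≤ rho k (S ∪ coeffSet Q) z)
    (hD : D ≤ Module.finrank (acl k S) (formSpan (acl k S) z d)) :
    ∃ w, Dle k S (coeffSet Q) w ∧ w + D ≤ (Fintype.card σ + d - 1).choose d := by
  refine ⟨_, dle_coeff_of_rho_le hQ h0 hrho, ?_⟩
  have := finrank_formSpan_le (F := acl k S) z d
  omega

theorem mul_add_one_le_finrank_formSpan (S : Set F) {z : σ → K} {b : ℕ}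
    (hb : b + 1 ≤ Module.finrank F (Submodule.span F (Set.range z))) (d : ℕ) :
    d * b + 1 ≤ Module.finrank (acl k S) (formSpan (acl k S) z d) := by
  have := acl_isAlgClosed (k := k) S
  exact le_finrank_formSpan (F := acl k S) z
    (hb.trans (finrank_span_le_of_intermediateField (acl k S) z)) d

theorem choose_rho_le_finrank_formSpan (S : Set F) (z : σ → K) (d : ℕ) :
    (rho k S z + d - 1).choose d ≤ Module.finrank (acl k S) (formSpan (acl k S) z d) := by
  obtain ⟨T, hT, hc⟩ := exists_card_eq_rho (k := k) S z
  rw [← hc]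
  exact choose_le_finrank_formSpan z hT d

variable {S : Set F} {z : σ → K} {m b : ℕ} {Q : ℕ → MvPolynomial σ F}

theorem exists_dle_iUnion_of_steps
    (hQ : ∀ i < m, (Q i).IsHomogeneous (i + 2))
    {D : ℕ → ℕ}
    (h : ∀ i < m, D i ≠ 0 → ∃ w, Dle k (S ∪ ⋃ j < i, coeffSet (Q j)) (coeffSet (Q i)) w ∧
      w + D i ≤ (Fintype.card σ + (i + 2) - 1).choose (i + 2)) :
    ∃ e, Dle k S (⋃ i < m, coeffSet (Q i)) e ∧ e + ∑ i ∈ Finset.range m, D i ≤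
      ∑ i ∈ Finset.range m, (Fintype.card σ + (i + 2) - 1).choose (i + 2) := by
  have h' : ∀ i, ∃ w, i < m → Dle k (S ∪ ⋃ j < i, coeffSet (Q j)) (coeffSet (Q i)) w ∧
      w + D i ≤ (Fintype.card σ + (i + 2) - 1).choose (i + 2) := by
    intro i
    by_cases hi : i < m
    · by_cases hD : D i = 0
      · exact ⟨_, fun _ => ⟨dle_coeffSet (hQ i hi), by omega⟩⟩
      · obtain ⟨w, hw⟩ := h i hi hD
        exact ⟨w, fun _ => hw⟩
    · exact ⟨0, fun h => absurd h hi⟩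
  choose w hw using h'
  refine ⟨_, Dle.iUnion_lt fun i hi => (hw i hi).1, ?_⟩
  rw [← Finset.sum_add_distrib]
  exact Finset.sum_le_sum fun i hi => (hw i (Finset.mem_range.1 hi)).2

theorem rho_step_le (C : ℕ → Set F) (i : ℕ) :
    rho k (S ∪ ⋃ j < i + 1, C j) z ≤ rho k (S ∪ ⋃ j < i, C j) z := by
  refine rho_anti (Set.Subset.trans ?_ (subset_acl _)) z
  rw [Set.biUnion_lt_succ, ← Set.union_assoc]
  exact Set.subset_union_left

theorem exists_dle_of_rho_le_length
    (hQ : ∀ i < m, (Q i).IsHomogeneous (i + 2)) (h0 : ∀ i < m, aeval z (Q i) = 0)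
    (h2 : ∀ S : Set F, 2 ≤ rho k S z)
    (hb : Module.finrank F (Submodule.span F (Set.range z)) = b + 1)
    (hm : rho k S z ≤ m + 1) :
    ∃ e, Dle k S (⋃ i < m, coeffSet (Q i)) e ∧ e + min ((m + 2).choose 2) ((m + 1) * b + 1) ≤
      ∑ i ∈ Finset.range m, (Fintype.card σ + (i + 2) - 1).choose (i + 2) := by
  obtain ⟨i, hi, hfi, hle⟩ := exists_late_stationary_step
    (f := fun i => rho k (S ∪ ⋃ j < i, coeffSet (Q j)) z) (rho_step_le _) (m := m)
    (by simpa using hm) (h2 _)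
  simp only [Set.biUnion_lt_succ, ← Set.union_assoc] at hfi
  obtain ⟨e, he, hes⟩ := exists_dle_iUnion_of_steps (k := k) (S := S) (m := m) hQ
    (D := fun j => if j = i then min ((m + 2).choose 2) ((m + 1) * b + 1) else 0) fun j hj hD => by
      obtain rfl : j = i := by by_contra h; simp [h] at hD
      rw [if_pos rfl]
      refine exists_dle_of_rho_le (hQ j hj) (h0 j hj) hfi.le ?_
      by_cases hjm : j + 2 ≤ m
      · refine (min_le_left _ _).trans (le_trans ?_ (choose_rho_le_finrank_formSpan _ z _))
        refine (choose_two_le_choose (d := j + 2) (by omega) (by omega)).trans ?_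
        exact Nat.choose_le_choose _ (by omega)
      · refine (min_le_right _ _).trans ?_
        obtain rfl : m = j + 1 := by omega
        exact mul_add_one_le_finrank_formSpan _ hb.ge _
  refine ⟨e, he, ?_⟩
  rwa [Finset.sum_ite_eq' , if_pos (Finset.mem_range.2 hi)] at hes

theorem exists_dle_of_rho_le_finrank
    (hQ : ∀ i < m, (Q i).IsHomogeneous (i + 2)) (h0 : ∀ i < m, aeval z (Q i) = 0)
    (h2 : ∀ S : Set F, 2 ≤ rho k S z)
    (hb : Module.finrank F (Submodule.span F (Set.range z)) = b + 1)
    (hr : rho k S z ≤ b + 1) :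
    ∃ e, Dle k S (⋃ i < m, coeffSet (Q i)) e ∧
      e + ∑ i ∈ Finset.range (m + 1 - b), ((i + 2) * b + 1) ≤
      ∑ i ∈ Finset.range m, (Fintype.card σ + (i + 2) - 1).choose (i + 2) := by
  set f := fun i => rho k (S ∪ ⋃ j < i, coeffSet (Q j)) z with hf
  obtain ⟨e, he, hes⟩ := exists_dle_iUnion_of_steps (k := k) (S := S) (m := m) hQ
    (D := fun j => if f j = f (j + 1) then (j + 2) * b + 1 else 0) fun j hj hD => by
      have hfj : f j = f (j + 1) := by by_contra h; simp [h] at hD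
      rw [if_pos hfj]
      simp only [hf, Set.biUnion_lt_succ, ← Set.union_assoc] at hfj
      exact exists_dle_of_rho_le (hQ j hj) (h0 j hj) hfj.le
        (mul_add_one_le_finrank_formSpan _ hb.ge _)
  refine ⟨e, he, le_trans (Nat.add_le_add_left ?_ _) hes⟩
  rw [← Finset.sum_filter]
  refine le_trans ?_ (sum_range_card_le_sum (fun i j h => by gcongr) _)
  refine Finset.sum_le_sum_of_subset (Finset.range_mono ?_)
  have h3 := le_card_stationary_steps f (rho_step_le _) m
  have h4 : 2 ≤ f m := h2 _
  have h5 : f 0 ≤ b + 1 := by simpa [hf] using hr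
  omega

theorem exists_dle_of_finrank_span
    (hQ : ∀ i < m, (Q i).IsHomogeneous (i + 2)) (h0 : ∀ i < m, aeval z (Q i) = 0)
    (h2 : ∀ S : Set F, 2 ≤ rho k S z)
    (hb : Module.finrank F (Submodule.span F (Set.range z)) = b + 1) :
    ∃ e, Dle k S (⋃ i < m, coeffSet (Q i)) e ∧
      e + ∑ i ∈ Finset.range (m + 1 - b), ((i + 2) * b + 1) ≤
      (∑ i ∈ Finset.range m, (Fintype.card σ + (i + 2) - 1).choose (i + 2)) +
        (b + 1) * (Fintype.card σ - (b + 1)) := by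
  classical
  obtain ⟨B, hBc, hB⟩ : ∃ B : Finset σ, B.card = b + 1 ∧
      ∀ i, z i ∈ Submodule.span F (z '' B) := by
    obtain ⟨s, hs, hspan, hli⟩ := exists_linearIndependent F (Set.range z)
    have hfin : s.Finite := (Set.finite_range z).subset hs
    have := hfin.fintype
    choose g hg using fun x : s => hs x.2
    have hginj : Function.Injective g := fun x y h => Subtype.ext (by rw [← hg x, ← hg y, h])
    have him : z '' ((Finset.univ.image g : Finset σ) : Set σ) = s := by
      ext x
      simp only [Finset.coe_image, Finset.coe_univ, Set.image_univ, Set.mem_image,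
        Set.mem_range, exists_exists_eq_and]
      constructor
      · rintro ⟨y, rfl⟩
        rw [hg]
        exact y.2
      · intro hx
        exact ⟨⟨x, hx⟩, hg _⟩
    refine ⟨Finset.univ.image g, ?_, fun i => ?_⟩
    · rw [Finset.card_image_of_injective _ hginj, Finset.card_univ, ← hb, ← hspan,
        finrank_span_set_eq_card hli, Set.toFinset_card]
    · rw [him, hspan]
      exact Submodule.subset_span ⟨i, rfl⟩
  have hex : ∀ i, ∃ c : B → F, z i = ∑ j, c j • z j := by
    intro i
    have := hB i
    rw [Submodule.mem_span_image_finset_iff_exists_fun] at this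
    obtain ⟨c, hc⟩ := this
    exact ⟨c, hc.symm⟩
  choose c hc using hex
  let ev : {i // i ∉ B} × B → F := fun p => c p.1 p.2
  have hdev : Dle k S (Set.range ev) ((b + 1) * (Fintype.card σ - (b + 1))) := by
    have := Dle.range (k := k) (S := S) ev
    rwa [Fintype.card_prod, Fintype.card_coe, hBc, Fintype.card_subtype_compl, mul_comm,
      Fintype.card_coe, hBc] at this
  have hrho : rho k (S ∪ Set.range ev) z ≤ b + 1 := by
    rw [← hBc]
    refine rho_le_card fun i => ?_
    by_cases hi : i ∈ B
    · exact Submodule.subset_span ⟨i, hi, rfl⟩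
    · rw [hc i]
      refine Submodule.sum_mem _ fun j _ => ?_
      have hmem : c i j ∈ acl k (S ∪ Set.range ev) :=
        subset_acl _ (Set.mem_union_right _ ⟨(⟨i, hi⟩, j), rfl⟩)
      exact Submodule.smul_mem _ (⟨c i j, hmem⟩ : acl k (S ∪ Set.range ev))
        (Submodule.subset_span ⟨j, j.2, rfl⟩)
  obtain ⟨e, he, hes⟩ := exists_dle_of_rho_le_finrank hQ h0 h2 hb hrho
  refine ⟨_, (hdev.trans he).mono (subset_acl _) ?_ le_rfl, by omega⟩
  exact Set.Subset.trans (Set.subset_union_right.trans Set.subset_union_right) (subset_acl _)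

end Regularity

section PolyOver

variable {k F σ : Type*} [Field k] [Field F] [Algebra k F]

/-- The polynomials with coefficients in an intermediate field. -/
def polyOver (σ : Type*) (E : IntermediateField k F) : Subring (MvPolynomial σ F) :=
  (MvPolynomial.map (σ := σ) (algebraMap E F)).range

variable {E : IntermediateField k F}

theorem coeff_mem_of_mem_polyOver {P : MvPolynomial σ F} (hP : P ∈ polyOver σ E) (α : σ →₀ ℕ) :
    coeff α P ∈ E := by
  obtain ⟨Q, rfl⟩ := hP
  rw [coeff_map]
  exact (coeff α Q).2

theorem C_mem_polyOver {c : F} (hc : c ∈ E) : C c ∈ polyOver σ E := ⟨C ⟨c, hc⟩, by simp⟩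

theorem X_mem_polyOver (i : σ) : X i ∈ polyOver σ E := ⟨X i, by simp⟩

theorem mem_polyOver {P : MvPolynomial σ F} : P ∈ polyOver σ E ↔ ∀ α, coeff α P ∈ E := by
  refine ⟨coeff_mem_of_mem_polyOver, fun h => ?_⟩
  rw [P.as_sum]
  refine sum_mem fun α _ => ⟨monomial α ⟨_, h α⟩, ?_⟩
  rw [map_monomial]
  rfl

theorem aeval_mem_polyOver {τ : Type*} {s : τ → MvPolynomial σ F} (hs : ∀ i, s i ∈ polyOver σ E)
    {P : MvPolynomial τ F} (hP : P ∈ polyOver τ E) : aeval s P ∈ polyOver σ E := by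
  obtain ⟨Q, rfl⟩ := hP
  induction Q using MvPolynomial.induction_on with
  | C a =>
    rw [map_C, aeval_C]
    exact C_mem_polyOver a.2
  | add p q hp hq =>
    rw [map_add, map_add]
    exact add_mem hp hq
  | mul_X p i hp =>
    rw [map_mul, map_mul, map_X, aeval_X]
    exact mul_mem hp (hs i)

theorem mem_polyOver_acl_of_coeffSet_subset {S : Set F} {P : MvPolynomial σ F}
    (h : coeffSet P ⊆ S) : P ∈ polyOver σ (acl k S) :=
  mem_polyOver.2 fun α => subset_acl _ (h ⟨α, rfl⟩)

theorem coeffSet_subset_acl {S : Set F} {P : MvPolynomial σ F} (h : P ∈ polyOver σ (acl k S)) :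
    coeffSet P ⊆ acl k S := by
  rintro _ ⟨α, rfl⟩
  exact mem_polyOver.1 h α

end PolyOver

section Lift

theorem map_toUPow_congr {I σ : Type*} (U : Ultrafilter I) {P Q : MvPolynomial σ (I → ℂ)}
    (h : ∀ᶠ i in (U : Filter I), map (Pi.evalRingHom (fun _ : I => ℂ) i) P =
      map (Pi.evalRingHom (fun _ : I => ℂ) i) Q) :
    map (toUPow U : (I → ℂ) →+* UPow U) P = map (toUPow U : (I → ℂ) →+* UPow U) Q := by
  ext α
  rw [coeff_map, coeff_map]
  refine toUPow_eq_iff.2 (h.mono fun i hi => ?_)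
  have := congrArg (coeff α) hi
  rwa [coeff_map, coeff_map] at this

variable {I σ : Type*} [Fintype σ] [DecidableEq σ]

/-- The degree `d` part of a family of complex polynomials, as a polynomial over the ring of
functions. -/
def liftPoly (d : ℕ) (p : I → MvPolynomial σ ℂ) : MvPolynomial σ (I → ℂ) :=
  ∑ α ∈ (Finset.univ : Finset σ).finsuppAntidiag d, monomial α fun i => coeff α (p i)

theorem isHomogeneous_liftPoly (d : ℕ) (p : I → MvPolynomial σ ℂ) :
    (liftPoly d p).IsHomogeneous d := by
  refine IsHomogeneous.sum _ _ _ fun α hα => isHomogeneous_monomial _ ?_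
  rw [Finset.mem_finsuppAntidiag] at hα
  rw [Finsupp.degree_eq_sum, hα.1]

theorem coeff_liftPoly (d : ℕ) (p : I → MvPolynomial σ ℂ) {α : σ →₀ ℕ} (hα : α.degree = d) :
    coeff α (liftPoly d p) = fun i => coeff α (p i) := by
  rw [liftPoly, coeff_sum]
  simp only [coeff_monomial]
  rw [Finset.sum_ite_eq' , if_pos]
  rw [Finset.mem_finsuppAntidiag, ← hα, Finsupp.degree_eq_sum]
  simp

theorem map_liftPoly {d : ℕ} {p : I → MvPolynomial σ ℂ} {i : I} (h : (p i).IsHomogeneous d) :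
    map (Pi.evalRingHom (fun _ : I => ℂ) i) (liftPoly d p) = p i := by
  ext α
  rw [coeff_map]
  by_cases hα : α.degree = d
  · rw [coeff_liftPoly d p hα]
    rfl
  · rw [(isHomogeneous_liftPoly d p).coeff_eq_zero hα, h.coeff_eq_zero hα, map_zero]

variable (U : Ultrafilter I)

/-- The ultraproduct of a family of forms. -/
def ultraPoly (d : ℕ) (p : I → MvPolynomial σ ℂ) : MvPolynomial σ (UPow U) :=
  map (toUPow U : (I → ℂ) →+* UPow U) (liftPoly d p)

theorem isHomogeneous_ultraPoly (d : ℕ) (p : I → MvPolynomial σ ℂ) :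
    (ultraPoly U d p).IsHomogeneous d := (isHomogeneous_liftPoly d p).map _

theorem coeff_ultraPoly (d : ℕ) (p : I → MvPolynomial σ ℂ) {α : σ →₀ ℕ} (hα : α.degree = d) :
    coeff α (ultraPoly U d p) = toUPow U fun i => coeff α (p i) := by
  rw [ultraPoly, coeff_map, coeff_liftPoly d p hα]
  rfl

end Lift

section Rank

variable {k F σ : Type*} [Field k] [Field F] [Algebra k F]

theorem dle_gram {τ : Type*} [Fintype τ] {r : ℕ} (L : Fin r → τ → F) (S : Set F) :
    ∃ e, Dle k S (Set.range fun p : τ × τ => ∑ a, L a p.1 * L a p.2) e ∧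
      e + (Fintype.card τ - r + 1).choose 2 ≤ (Fintype.card τ + 1).choose 2 := by
  classical
  set A : τ → τ → F := fun i j => ∑ a, L a i * L a j with hA
  let u : τ → (Fin r → F) := fun i a => L a i
  obtain ⟨B, hBr, hBt, hB⟩ : ∃ B : Finset τ, B.card ≤ r ∧ B.card ≤ Fintype.card τ ∧
      ∀ i, u i ∈ Submodule.span F (u '' B) := by
    obtain ⟨s, hs, hspan, hli⟩ := exists_linearIndependent F (Set.range u)
    have hfin : s.Finite := (Set.finite_range u).subset hs
    have := hfin.fintype
    choose g hg using fun x : s => hs x.2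
    have hginj : Function.Injective g := fun x y h => Subtype.ext (by rw [← hg x, ← hg y, h])
    have him : u '' ((Finset.univ.image g : Finset τ) : Set τ) = s := by
      ext x
      simp only [Finset.coe_image, Finset.coe_univ, Set.image_univ, Set.mem_image,
        Set.mem_range, exists_exists_eq_and]
      constructor
      · rintro ⟨y, rfl⟩
        rw [hg]
        exact y.2
      · intro hx
        exact ⟨⟨x, hx⟩, hg _⟩
    refine ⟨Finset.univ.image g, ?_, Finset.card_le_univ _, fun i => ?_⟩
    · rw [Finset.card_image_of_injective _ hginj, Finset.card_univ]
      simpa using hli.fintype_card_le_finrank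
    · rw [him, hspan]
      exact Submodule.subset_span ⟨i, rfl⟩
  have hex : ∀ i, ∃ c : B → F, u i = ∑ j, c j • u j := by
    intro i
    have := hB i
    rw [Submodule.mem_span_image_finset_iff_exists_fun] at this
    obtain ⟨c, hc⟩ := this
    exact ⟨c, hc.symm⟩
  choose c hc using hex
  have hL : ∀ a i, L a i = ∑ j : B, c i j * L a j := fun a i => by
    have := congrFun (hc i) a
    simpa [u] using this
  let ev : {i // i ∉ B} × B → F := fun p => c p.1 p.2
  let ev' : Sym2 B → F := Sym2.lift ⟨fun j j' => A j j', fun j j' => by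
    simp only [hA]; exact Finset.sum_congr rfl fun a _ => mul_comm _ _⟩
  have h1 : Dle k S (Set.range (Sum.elim ev ev')) _ := Dle.range _
  rw [Fintype.card_sum, Fintype.card_prod, Fintype.card_subtype_compl, Fintype.card_coe,
    Sym2.card, Fintype.card_coe] at h1
  refine ⟨_, h1.mono (subset_acl _) ?_ le_rfl, ?_⟩
  · have hev : ∀ i (j : B), i ∉ B → c i j ∈ acl k (S ∪ Set.range (Sum.elim ev ev')) :=
      fun i j hi => subset_acl _ (Set.mem_union_right _ ⟨Sum.inl (⟨i, hi⟩, j), rfl⟩)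
    have hev' : ∀ j j' : B, A j j' ∈ acl k (S ∪ Set.range (Sum.elim ev ev')) :=
      fun j j' => subset_acl _ (Set.mem_union_right _ ⟨Sum.inr s(j, j'), rfl⟩)
    have hAsymm : ∀ i j, A i j = A j i := fun i j => by
      simp only [hA]; exact Finset.sum_congr rfl fun a _ => mul_comm _ _
    have hA1 : ∀ i i', A i i' = ∑ j : B, c i j * A j i' := fun i i' => by
      simp only [hA, Finset.mul_sum]
      rw [Finset.sum_comm]
      refine Finset.sum_congr rfl fun a _ => ?_
      rw [hL a i, Finset.sum_mul]
      exact Finset.sum_congr rfl fun j _ => by ring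
    have hA2 : ∀ (j : B) i, A j i ∈ acl k (S ∪ Set.range (Sum.elim ev ev')) := by
      intro j i
      by_cases hi : i ∈ B
      · exact hev' j ⟨i, hi⟩
      · rw [hAsymm, hA1]
        refine sum_mem fun j' _ => mul_mem (hev i j' hi) (hev' _ _)
    rintro _ ⟨⟨i, i'⟩, rfl⟩
    change A i i' ∈ _
    by_cases hi : i ∈ B
    · exact hA2 ⟨i, hi⟩ i'
    · rw [hA1]
      exact sum_mem fun j' _ => mul_mem (hev i j' hi) (hA2 _ _)
  · obtain ⟨t, ht⟩ : ∃ t, Fintype.card τ = B.card + t := ⟨_, (Nat.add_sub_cancel' hBt).symm⟩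
    have h2 : (Fintype.card τ - r + 1).choose 2 ≤ (t + 1).choose 2 :=
      Nat.choose_le_choose _ (by omega)
    have h3 : ∀ a b : ℕ, b * a + (a + 1).choose 2 + (b + 1).choose 2 = (a + b + 1).choose 2 := by
      intro a b
      have h4 : ∀ n : ℕ, 2 * (n + 1).choose 2 = (n + 1) * n := fun n => by
        rw [Nat.choose_two_right, Nat.add_sub_cancel, mul_comm,
          Nat.div_mul_cancel (by simpa using (Nat.even_mul_pred_self (n + 1)).two_dvd)]
      nlinarith [h4 a, h4 b, h4 (a + b)]
    have h4 := h3 B.card t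
    rw [ht, Nat.add_sub_cancel_left]
    rw [ht] at h2
    omega

/-- The variety of quadratic forms which are sums of `r` squares has the expected dimension. -/
theorem dle_coeffSet_sum_sq {τ : Type*} [Fintype τ] (f : τ → σ) {r : ℕ} (L : Fin r → τ → F)
    (S : Set F) :
    ∃ e, Dle k S (coeffSet (∑ a, (∑ i, C (L a i) * X (f i)) ^ 2 : MvPolynomial σ F)) e ∧
      e + (Fintype.card τ - r + 1).choose 2 ≤ (Fintype.card τ + 1).choose 2 := by
  obtain ⟨e, he, hes⟩ := dle_gram (k := k) L S
  refine ⟨e, he.mono (subset_acl _) (coeffSet_subset_acl ?_) le_rfl, hes⟩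
  have h : (∑ a, (∑ i, C (L a i) * X (f i)) ^ 2 : MvPolynomial σ F) =
      ∑ i, ∑ j, C (∑ a, L a i * L a j) * (X (f i) * X (f j)) := by
    simp only [sq, Finset.sum_mul_sum]
    simp only [map_sum, Finset.sum_mul]
    rw [Finset.sum_comm]
    refine Finset.sum_congr rfl fun i _ => ?_
    refine Finset.sum_comm.trans ?_
    refine Finset.sum_congr rfl fun j _ => Finset.sum_congr rfl fun a _ => ?_
    rw [C_mul]
    ring
  rw [h]
  refine sum_mem fun i _ => sum_mem fun j _ => mul_mem (C_mem_polyOver ?_)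
    (mul_mem (X_mem_polyOver _) (X_mem_polyOver _))
  exact subset_acl _ (Set.mem_union_right _ ⟨(i, j), rfl⟩)

end Rank

section Extend

variable {k F σ : Type*} [Field k] [Field F] [Algebra k F] [IsAlgClosed F] [Fintype σ] {S : Set F}
  {Q : ℕ → MvPolynomial σ F}

theorem exists_dle_iUnion_of_single {m : ℕ} (hQ : ∀ i < m, (Q i).IsHomogeneous (i + 2))
    {i₀ : ℕ} (hi₀ : i₀ < m) {w c : ℕ} (h : Dle k S (coeffSet (Q i₀)) w)
    (hc : w + c ≤ (Fintype.card σ + (i₀ + 2) - 1).choose (i₀ + 2)) :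
    ∃ e, Dle k S (⋃ i < m, coeffSet (Q i)) e ∧ e + c ≤
      ∑ i ∈ Finset.range m, (Fintype.card σ + (i + 2) - 1).choose (i + 2) := by
  obtain ⟨e, he, hes⟩ := exists_dle_iUnion_of_steps (k := k) (S := S) hQ
    (D := fun j => if j = i₀ then c else 0) fun j hj hD => by
      obtain rfl : j = i₀ := by by_contra h; simp [h] at hD
      rw [if_pos rfl]
      refine ⟨w, h.mono (Set.subset_union_left.trans (subset_acl _)) ?_ le_rfl, hc⟩
      exact Set.subset_union_right.trans (subset_acl _)
  refine ⟨e, he, ?_⟩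
  rwa [Finset.sum_ite_eq', if_pos (Finset.mem_range.2 hi₀)] at hes

theorem exists_dle_iUnion_extend {m n : ℕ} (hmn : m ≤ n)
    (hQ : ∀ i < n, (Q i).IsHomogeneous (i + 2)) {c : ℕ}
    (h : ∃ e, Dle k S (⋃ i < m, coeffSet (Q i)) e ∧ e + c ≤
      ∑ i ∈ Finset.range m, (Fintype.card σ + (i + 2) - 1).choose (i + 2)) :
    ∃ e, Dle k S (⋃ i < n, coeffSet (Q i)) e ∧ e + c ≤
      ∑ i ∈ Finset.range n, (Fintype.card σ + (i + 2) - 1).choose (i + 2) := by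
  induction n, hmn using Nat.le_induction with
  | base => exact h
  | succ n hmn ih =>
    obtain ⟨e, he, hes⟩ := ih fun i hi => hQ i (by omega)
    rw [Set.biUnion_lt_succ, Finset.sum_range_succ]
    exact ⟨_, he.trans (dle_coeffSet (hQ n (by omega))), by omega⟩

end Extend

section GenericPoint

variable {I σ : Type} [Fintype σ]

/-- The set `V` has an irreducible closure on which the coordinates in `T` are independent. -/
def IsGeneric (V : Set (σ → ℂ)) (T : Finset σ) : Prop :=
  (vanIdeal (LinearMap.id : (σ → ℂ) →ₗ[ℂ] (σ → ℂ)) V).IsPrime ∧ ∀ P : MvPolynomial T ℂ, P ≠ 0 →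
    rename Subtype.val P ∉ vanIdeal (LinearMap.id : (σ → ℂ) →ₗ[ℂ] (σ → ℂ)) V

theorem isGeneric_univ (T : Finset σ) : IsGeneric (Set.univ : Set (σ → ℂ)) T := by
  have h : vanIdeal (LinearMap.id : (σ → ℂ) →ₗ[ℂ] (σ → ℂ)) Set.univ = ⊥ := by
    rw [eq_bot_iff]
    intro P hP
    exact MvPolynomial.funext fun z => by simpa using hP z (Set.mem_univ _)
  refine ⟨h ▸ Ideal.isPrime_bot, fun P hP => ?_⟩
  rw [h, Ideal.mem_bot]
  exact fun h0 => hP (rename_injective _ Subtype.val_injective (by rw [h0, map_zero]))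

/-- The pullback of ultrapowers along a map of index types. -/
def upowMap {J : Type} {U : Ultrafilter I} {W : Ultrafilter J} (π : J → I) (h : W.map π = U) :
    UPow U →+* UPow W :=
  RingHom.liftOfSurjective (toUPow U : (I → ℂ) →+* UPow U) toUPow_surjective
    ⟨(toUPow W : (J → ℂ) →+* UPow W).comp (RingHom.pi fun y => Pi.evalRingHom (fun _ : I => ℂ) (π y)),
      by
        intro f hf
        rw [RingHom.mem_ker] at hf ⊢
        have h1 := toUPow_eq_zero_iff.1 hf
        refine toUPow_eq_zero_iff.2 ?_
        rw [← h] at h1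
        exact h1⟩

theorem upowMap_toUPow {J : Type} {U : Ultrafilter I} {W : Ultrafilter J} (π : J → I)
    (h : W.map π = U) (f : I → ℂ) : upowMap π h (toUPow U f) = toUPow W (f ∘ π) :=
  RingHom.liftOfRightInverse_comp_apply _ _ _ _ _

theorem exists_generic_point (U : Ultrafilter I) {V : I → Set (σ → ℂ)} {T : Finset σ}
    (hV : ∀ᶠ i in (U : Filter I), IsGeneric (V i) T) :
    ∃ (K : Type) (_ : Field K) (_ : Algebra (UPow U) K) (z : σ → K),
      (∀ P : MvPolynomial σ (I → ℂ),
        (∀ᶠ i in (U : Filter I), ∀ x ∈ V i,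
          eval x (map (Pi.evalRingHom (fun _ : I => ℂ) i) P) = 0) →
        aeval z (map (toUPow U : (I → ℂ) →+* UPow U) P) = 0) ∧
      AlgebraicIndepOn (UPow U) z (T : Set σ) := by
  classical
  wlog hall : ∀ i, IsGeneric (V i) T generalizing V
  · obtain ⟨K, hf, ha, z, hz, hT⟩ := this
      (V := fun i => if IsGeneric (V i) T then V i else Set.univ)
      (Filter.Eventually.of_forall fun i => by
        split_ifs with h
        · exact h
        · exact isGeneric_univ T)
      (fun i => by
        split_ifs with h
        · exact h
        · exact isGeneric_univ T)
    refine ⟨K, hf, ha, z, fun P hP => hz P ?_, hT⟩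
    filter_upwards [hP, hV] with i hi hVi
    rwa [if_pos hVi]
  let J : Type := Σ i, V i
  let π : J → I := Sigma.fst
  obtain ⟨W, hWU, hW⟩ := exists_ultrafilter_extension U π
    {s | ∃ G : I → MvPolynomial σ ℂ,
      (∀ i, G i ∉ vanIdeal (LinearMap.id : (σ → ℂ) →ₗ[ℂ] (σ → ℂ)) (V i)) ∧
      s = {y : J | eval (y.2 : σ → ℂ) (G y.1) ≠ 0}}
    ⟨_, fun _ => 1, fun i => (hall i).1.one_notMem, rfl⟩ (by
      rintro _ ⟨G, hG, rfl⟩ _ ⟨G', hG', rfl⟩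
      refine ⟨_, ⟨fun i => G i * G' i, fun i => ?_, rfl⟩, fun y hy => ?_⟩
      · exact fun h => ((hall i).1.mem_or_mem h).elim (hG i) (hG' i)
      · simpa using hy) (by
      rintro _ ⟨G, hG, rfl⟩ i
      have := hG i
      rw [mem_vanIdeal] at this
      push Not at this
      obtain ⟨x, hx, hne⟩ := this
      exact ⟨⟨i, x, hx⟩, hne, rfl⟩)
  let : Algebra (UPow U) (UPow W) := (upowMap π hWU).toAlgebra
  let z : σ → UPow W := fun s => toUPow W fun y => (y.2 : σ → ℂ) s
  have hz : ∀ P : MvPolynomial σ (I → ℂ), aeval z (map (toUPow U : (I → ℂ) →+* UPow U) P) =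
      toUPow W fun y => eval (y.2 : σ → ℂ) (map (Pi.evalRingHom (fun _ : I => ℂ) (π y)) P) := by
    intro P
    induction P using MvPolynomial.induction_on with
    | C a =>
      rw [map_C, aeval_C]
      refine (upowMap_toUPow π hWU a).trans (congrArg _ ?_)
      funext y
      simp [map_C]
    | add p q hp hq =>
      rw [map_add, map_add, hp, hq, ← map_add]
      refine congrArg _ (funext fun y => ?_)
      simp
    | mul_X p s hp =>
      rw [map_mul, map_mul, hp, map_X, aeval_X, ← map_mul]
      refine congrArg _ (funext fun y => ?_)
      simp
  refine ⟨UPow W, inferInstance, inferInstance, z, fun P hP => ?_, ?_⟩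
  · rw [hz, toUPow_eq_zero_iff]
    have h1 : ∀ᶠ y in (W : Filter J), ∀ x ∈ V (π y),
        eval x (map (Pi.evalRingHom (fun _ : I => ℂ) (π y)) P) = 0 := by
      rw [← hWU] at hP
      exact hP
    exact h1.mono fun y hy => hy _ y.2.2
  · rw [AlgebraicIndepOn, algebraicIndependent_iff]
    intro p hp
    by_contra hne
    obtain ⟨P, rfl⟩ := map_surjective (toUPow U : (I → ℂ) →+* UPow U) toUPow_surjective p
    have h0 : aeval z (map (toUPow U : (I → ℂ) →+* UPow U)
        (rename (Subtype.val : T → σ) P)) = 0 := by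
      rw [map_rename, aeval_rename]
      exact hp
    have hev : ∀ᶠ i in (U : Filter I), map (Pi.evalRingHom (fun _ : I => ℂ) i) P ≠ 0 := by
      have : ¬ ∀ᶠ i in (U : Filter I), map (Pi.evalRingHom (fun _ : I => ℂ) i) P = 0 := fun h =>
        hne ((map_toUPow_congr U (Q := 0) (h.mono fun i hi => by rw [hi, map_zero])).trans
          (map_zero _))
      exact Ultrafilter.eventually_not.2 this
    rw [hz, toUPow_eq_zero_iff] at h0
    let G : I → MvPolynomial σ ℂ := fun i =>
      if map (Pi.evalRingHom (fun _ : I => ℂ) i) P = 0 then 1 else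
        rename Subtype.val (map (Pi.evalRingHom (fun _ : I => ℂ) i) P)
    have hG : ∀ i, G i ∉ vanIdeal (LinearMap.id : (σ → ℂ) →ₗ[ℂ] (σ → ℂ)) (V i) := by
      intro i
      simp only [G]
      split_ifs with h
      · exact (hall i).1.one_notMem
      · exact (hall i).2 _ h
    have h2 : ∀ᶠ y in (W : Filter J), eval (y.2 : σ → ℂ) (G y.1) ≠ 0 := hW _ ⟨G, hG, rfl⟩
    have h3 : ∀ᶠ y in (W : Filter J), map (Pi.evalRingHom (fun _ : I => ℂ) (π y)) P ≠ 0 := by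
      rw [← hWU] at hev
      exact hev
    obtain ⟨y, hy0, hy2, hy3⟩ := (h0.and (h2.and h3)).exists
    apply hy2
    simp only [G]
    rw [if_neg hy3, ← map_rename]
    exact hy0

end GenericPoint

theorem isHomogeneous_one_eq_sum {R σ : Type*} [CommSemiring R] [Fintype σ] {L : MvPolynomial σ R}
    (hL : L.IsHomogeneous 1) : L = ∑ i, C (coeff (Finsupp.single i 1) L) * X i := by
  classical
  ext α
  rw [coeff_sum]
  simp only [coeff_C_mul, coeff_X]
  by_cases hα : α.degree = 1
  · obtain ⟨i, rfl⟩ : α ∈ Set.range fun a : σ => Finsupp.single a 1 := by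
      rw [Finsupp.range_single_one]
      exact hα
    rw [Finset.sum_eq_single i]
    · simp
    · intro j _ hj
      rw [if_neg (by simpa [Finsupp.single_left_inj] using hj), mul_zero]
    · simp
  · rw [hL.coeff_eq_zero hα, Finset.sum_eq_zero]
    intro i _
    rw [if_neg (by rintro rfl; simp at hα), mul_zero]

section RegularityBound

theorem two_mul_sum_range (b k : ℕ) :
    2 * ∑ i ∈ Finset.range k, ((i + 2) * b + 1) = b * (k * (k + 3)) + 2 * k := by
  induction k with
  | zero => simp
  | succ k ih =>
    rw [Finset.sum_range_succ, mul_add, ih]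
    ring

variable {k F K σ : Type*} [Field k] [Field F] [Field K] [Algebra k F] [Algebra F K] [Fintype σ]
  [IsAlgClosed F]

theorem two_le_rho {z : σ → K} {T : Finset σ} (hT : AlgebraicIndepOn F z (T : Set σ))
    (hc : T.card = 2) (S : Set F) : 2 ≤ rho k S z := hc ▸ card_le_rho_of_field hT

theorem two_le_finrank_span {z : σ → K} {T : Finset σ} (hT : AlgebraicIndepOn F z (T : Set σ))
    (hc : T.card = 2) : 2 ≤ Module.finrank F (Submodule.span F (Set.range z)) := by
  have : FiniteDimensional F (Submodule.span F (Set.range z)) :=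
    FiniteDimensional.span_of_finite F (Set.finite_range z)
  have h : LinearIndependent F fun i : {i // i ∈ (T : Set σ)} => z i := hT.linearIndependent
  let y : {i // i ∈ (T : Set σ)} → Submodule.span F (Set.range z) :=
    fun i => ⟨z i, Submodule.subset_span ⟨i, rfl⟩⟩
  have h2 : LinearIndependent F y :=
    LinearIndependent.of_comp (Submodule.span F (Set.range z)).subtype h
  have := h2.fintype_card_le_finrank
  simpa [hc] using this

variable {S : Set F} {z : σ → K} {m D : ℕ} {Q : ℕ → MvPolynomial σ F}
  {T : Finset σ}

theorem exists_dle_of_common_zero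
    (hQ : ∀ i < m, (Q i).IsHomogeneous (i + 2)) (h0 : ∀ i < m, aeval z (Q i) = 0)
    (hT : AlgebraicIndepOn F z (T : Set σ)) (hc : T.card = 2)
    {S' : Set F} {w : ℕ} (hSS : Dle k S S' w)
    (hrho : rho k (S ∪ S') z ≤ m + 1)
    (hD : ∀ b, 1 ≤ b → b + 1 ≤ Fintype.card σ →
      D + w ≤ min ((m + 2).choose 2) ((m + 1) * b + 1) ∨
      D + (b + 1) * (Fintype.card σ - (b + 1)) ≤
        ∑ i ∈ Finset.range (m + 1 - b), ((i + 2) * b + 1)) :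
    ∃ e, Dle k S (⋃ i < m, coeffSet (Q i)) e ∧ e + D ≤
      ∑ i ∈ Finset.range m, (Fintype.card σ + (i + 2) - 1).choose (i + 2) := by
  have h2 : ∀ S : Set F, 2 ≤ rho k S z := two_le_rho hT hc
  have h3 := two_le_finrank_span hT hc
  have h4 : Module.finrank F (Submodule.span F (Set.range z)) ≤ Fintype.card σ :=
    finrank_range_le_card z
  obtain ⟨b, hb⟩ : ∃ b, Module.finrank F (Submodule.span F (Set.range z)) = b + 1 :=
    ⟨_, (Nat.sub_add_cancel (by omega)).symm⟩
  rcases hD b (by omega) (by omega) with h | h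
  · obtain ⟨e, he, hes⟩ := exists_dle_of_rho_le_length hQ h0 h2 hb hrho
    refine ⟨w + e, (hSS.trans he).mono (subset_acl _) ?_ le_rfl, by omega⟩
    exact Set.Subset.trans (Set.subset_union_right.trans Set.subset_union_right) (subset_acl _)
  · obtain ⟨e, he, hes⟩ := exists_dle_of_finrank_span (S := S) hQ h0 h2 hb
    exact ⟨e, he, by omega⟩

theorem exists_dle_of_common_zero_hyperplane
    (hQ : ∀ i < m, (Q i).IsHomogeneous (i + 2)) (h0 : ∀ i < m, aeval z (Q i) = 0)
    (hT : AlgebraicIndepOn F z (T : Set σ)) (hc : T.card = 2)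
    {M : ℕ} (hM : 10 ≤ M) (hσ : Fintype.card σ = M)
    (hm : m + 2 = M) (hD : 2 * D ≤ (M - 6) * (M - 5)) {L : MvPolynomial σ F}
    (hL : L.IsHomogeneous 1) (hL0 : L ≠ 0) (hLz : aeval z L = 0) (hLS : coeffSet L ⊆ S) :
    ∃ e, Dle k S (⋃ i < m, coeffSet (Q i)) e ∧ e + D ≤
      ∑ i ∈ Finset.range m, (Fintype.card σ + (i + 2) - 1).choose (i + 2) := by
  classical
  refine exists_dle_of_common_zero (S' := ∅) (w := 0) hQ h0 hT hc
    (Dle.of_subset_acl (by simp) _) ?_ ?_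
  · have hLsum := isHomogeneous_one_eq_sum hL
    obtain ⟨i₀, hi₀⟩ : ∃ i, coeff (Finsupp.single i 1) L ≠ 0 := by
      by_contra! h
      exact hL0 (by rw [hLsum]; simp [h])
    have h5 : ∑ i, coeff (Finsupp.single i 1) L • z i = 0 := by
      rw [hLsum] at hLz
      simpa [Algebra.smul_def] using hLz
    refine (rho_le_card (B := Finset.univ.erase i₀) fun i => ?_).trans ?_
    · by_cases hi : i = i₀
      · subst hi
        rw [← Finset.add_sum_erase _ _ (Finset.mem_univ i)] at h5
        have h6 : z i = ∑ j ∈ Finset.univ.erase i,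
            (-(coeff (Finsupp.single i 1) L)⁻¹ * coeff (Finsupp.single j 1) L) • z j := by
          simp only [mul_smul, neg_smul, Finset.sum_neg_distrib]
          rw [← Finset.smul_sum, ← smul_neg, ← eq_neg_of_add_eq_zero_left h5, smul_smul,
            inv_mul_cancel₀ hi₀, one_smul]
        rw [h6]
        have hmem : ∀ j, coeff (Finsupp.single j 1) L ∈ acl k (S ∪ ∅) := fun j =>
          subset_acl _ (Set.mem_union_left _ (hLS ⟨_, rfl⟩))
        refine Submodule.sum_mem _ fun j hj => ?_
        exact Submodule.smul_mem _ (⟨_, mul_mem (neg_mem (inv_mem (hmem i))) (hmem j)⟩ :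
          acl k (S ∪ ∅)) (Submodule.subset_span ⟨j, hj, rfl⟩)
      · exact Submodule.subset_span ⟨i, by simpa using hi, rfl⟩
    · rw [Finset.card_erase_of_mem (Finset.mem_univ _), Finset.card_univ]
      omega
  · intro b hb1 hbM
    rw [hσ] at hbM ⊢
    obtain ⟨N, rfl⟩ : ∃ N, M = N + 10 := ⟨M - 10, by omega⟩
    obtain rfl : m = N + 8 := by omega
    rw [show N + 10 - 6 = N + 4 by omega, show N + 10 - 5 = N + 5 by omega] at hD
    by_cases hb : N + 2 ≤ 2 * b
    · left
      rw [le_min_iff]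
      constructor
      · have : (N + 8 + 2).choose 2 * 2 = (N + 10) * (N + 9) := by
          rw [Nat.choose_two_right, Nat.div_mul_cancel
            (by simpa using (Nat.even_mul_pred_self (N + 8 + 2)).two_dvd)]
          rfl
        nlinarith
      · nlinarith
    · right
      obtain ⟨t, ht⟩ : ∃ t, N + 9 = b + t := ⟨N + 9 - b, by omega⟩
      have h7 := two_mul_sum_range b (N + 8 + 1 - b)
      rw [show N + 8 + 1 - b = t by omega] at h7 ⊢
      rw [show N + 10 - (b + 1) = t by omega]
      rcases hb1.eq_or_lt with rfl | hb2
      · obtain rfl : t = N + 8 := by omega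
        nlinarith
      · have h8 : 2 * (N + 7) ≤ b * t := by
          obtain ⟨b', rfl⟩ : ∃ b', b = b' + 2 := ⟨b - 2, by omega⟩
          obtain rfl : t = N + 7 - b' := by omega
          obtain ⟨u, hu⟩ : ∃ u, N + 7 = b' + u := ⟨N + 7 - b', by omega⟩
          rw [hu, Nat.add_sub_cancel_left]
          nlinarith
        have h9 : N + 17 ≤ 2 * t := by omega
        nlinarith

theorem exists_dle_of_common_zero_subspace
    (hQ : ∀ i < m, (Q i).IsHomogeneous (i + 2)) (h0 : ∀ i < m, aeval z (Q i) = 0)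
    (hT : AlgebraicIndepOn F z (T : Set σ)) (hc : T.card = 2)
    {M c : ℕ} (hM : 10 ≤ M) (hσ : Fintype.card σ = M)
    (hcM : c ≤ 2) (hm : m + 1 + c = M) (hD : 2 * D + 12 ≤ (M - 7) * (M - 6))
    {B : Finset σ} (hB : B.card + c = M) {a : σ → B → F} (ha : ∀ i, z i = ∑ j, a i j • z j) :
    ∃ e, Dle k S (⋃ i < m, coeffSet (Q i)) e ∧ e + D ≤
      ∑ i ∈ Finset.range m, (Fintype.card σ + (i + 2) - 1).choose (i + 2) := by
  classical
  let ev : {i // i ∉ B} × B → F := fun p => a p.1 p.2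
  have hdev : Dle k S (Set.range ev) (c * (m + 1)) := by
    have := Dle.range (k := k) (S := S) ev
    rwa [Fintype.card_prod, Fintype.card_coe, Fintype.card_subtype_compl,
      Fintype.card_coe, show Fintype.card σ - B.card = c by omega,
      show B.card = m + 1 by omega] at this
  have hrho : rho k (S ∪ Set.range ev) z ≤ m + 1 := by
    rw [show m + 1 = B.card by omega]
    refine rho_le_card fun i => ?_
    by_cases hi : i ∈ B
    · exact Submodule.subset_span ⟨i, hi, rfl⟩
    · rw [ha i]
      refine Submodule.sum_mem _ fun j _ => ?_
      have hmem : a i j ∈ acl k (S ∪ Set.range ev) :=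
        subset_acl _ (Set.mem_union_right _ ⟨(⟨i, hi⟩, j), rfl⟩)
      exact Submodule.smul_mem _ (⟨a i j, hmem⟩ : acl k (S ∪ Set.range ev))
        (Submodule.subset_span ⟨j, j.2, rfl⟩)
  refine exists_dle_of_common_zero hQ h0 hT hc hdev hrho ?_
  intro b hb1 hbM
  rw [hσ] at hbM ⊢
  obtain ⟨N, rfl⟩ : ∃ N, M = N + 10 := ⟨M - 10, by omega⟩
  rw [show N + 10 - 7 = N + 3 by omega, show N + 10 - 6 = N + 4 by omega] at hD
  by_cases hb : N + 4 ≤ 2 * b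
  · left
    have h5 : (m + 2).choose 2 * 2 = (m + 2) * (m + 1) := by
      rw [Nat.choose_two_right, Nat.div_mul_cancel
        (by simpa using (Nat.even_mul_pred_self (m + 2)).two_dvd)]
      rfl
    rw [le_min_iff]
    interval_cases c
    · obtain rfl : m = N + 9 := by omega
      constructor <;> nlinarith
    · obtain rfl : m = N + 8 := by omega
      constructor <;> nlinarith
    · obtain rfl : m = N + 7 := by omega
      constructor <;> nlinarith
  · right
    obtain ⟨t, ht⟩ : ∃ t, N + 8 = b + t := ⟨N + 8 - b, by omega⟩
    have h6 : ∑ i ∈ Finset.range t, ((i + 2) * b + 1) ≤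
        ∑ i ∈ Finset.range (m + 1 - b), ((i + 2) * b + 1) :=
      Finset.sum_le_sum_of_subset (Finset.range_mono (by omega))
    refine le_trans ?_ h6
    have h7 := two_mul_sum_range b t
    rw [show N + 10 - (b + 1) = t + 1 by omega]
    rcases hb1.eq_or_lt with rfl | hb2
    · obtain rfl : t = N + 7 := by omega
      nlinarith
    · have h8 : 2 * (N + 8) ≤ b * (t + 2) := by
        obtain ⟨b', rfl⟩ : ∃ b', b = b' + 2 := ⟨b - 2, by omega⟩
        obtain rfl : t = N + 6 - b' := by omega
        obtain ⟨u, hu⟩ : ∃ u, N + 6 = b' + u := ⟨N + 6 - b', by omega⟩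
        rw [show N + 6 - b' = u by omega, show N = b' + u - 6 by omega]
        have : b' + u - 6 + 8 = b' + u + 2 := by omega
        rw [this]
        nlinarith
      obtain ⟨u, rfl⟩ : ∃ u, t = u + 1 := ⟨t - 1, by omega⟩
      have h9 : N + 11 ≤ 2 * u := by omega
      nlinarith

end RegularityBound

section LocalEquation

variable {N : ℕ}

/-- The local equation `chartShift`, as a polynomial in the affine coordinates of the chart. -/
def locShift (G : MvPolynomial (Fin N) ℂ) (v : Fin N → ℂ) (j : Fin N) :
    MvPolynomial {i // i ≠ j} ℂ :=
  bind₁ (fun i => if h : i ≠ j then C (v i) + X ⟨i, h⟩ else C (v i)) G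

/-- The homogeneous components of the local equation, in the affine coordinates of the chart. -/
def locComp (k : ℕ) (G : MvPolynomial (Fin N) ℂ) (v : Fin N → ℂ) (j : Fin N) :
    MvPolynomial {i // i ≠ j} ℂ :=
  homogeneousComponent k (locShift G v j)

variable (G : MvPolynomial (Fin N) ℂ) (v : Fin N → ℂ) (j : Fin N)

theorem rename_locShift : rename Subtype.val (locShift G v j) = chartShift G v j := by
  rw [locShift, chartShift]
  rw [← AlgHom.comp_apply]
  congr 1
  apply MvPolynomial.algHom_ext
  intro i
  by_cases h : i = j
  · simp [h]
  · simp [h]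

theorem rename_locComp (k : ℕ) : rename Subtype.val (locComp k G v j) = chartComp k G v j := by
  rw [locComp, chartComp, ← rename_locShift, rename_homogeneousComponent]

theorem isHomogeneous_locComp (k : ℕ) : (locComp k G v j).IsHomogeneous k :=
  homogeneousComponent_isHomogeneous _ _

theorem totalDegree_locShift_le : (locShift G v j).totalDegree ≤ G.totalDegree := by
  rw [locShift, bind₁, aeval_def, eval₂_eq]
  refine totalDegree_finsetSum_le fun d hd => (totalDegree_mul _ _).trans ?_
  rw [algebraMap_eq, totalDegree_C, zero_add]
  refine (totalDegree_finsetProd _ _).trans ((Finset.sum_le_sum fun i _ => ?_).trans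
    (le_totalDegree hd))
  refine (totalDegree_pow _ _).trans ((Nat.mul_le_mul_left _ ?_).trans (mul_one _).le)
  split_ifs
  · refine (totalDegree_add _ _).trans ?_
    simp
  · simp

theorem sum_locComp {M : ℕ} (hG : G.totalDegree ≤ M) :
    ∑ k ∈ Finset.range (M + 1), locComp k G v j = locShift G v j := by
  have h := sum_homogeneousComponent (locShift G v j)
  have h1 := totalDegree_locShift_le G v j
  rw [← h]
  refine (Finset.sum_subset (Finset.range_mono (by omega)) fun k _ hk => ?_).symm
  exact homogeneousComponent_eq_zero _ _ (by simpa using hk)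

theorem locComp_zero : locComp 0 G v j = C (eval v G) := by
  rw [locComp, homogeneousComponent_zero, ← constantCoeff_eq]
  congr 1
  have h : ((aeval fun _ : {i // i ≠ j} => (0 : ℂ)).comp (bind₁ fun i : Fin N =>
      if h : i ≠ j then C (v i) + X (⟨i, h⟩ : {i // i ≠ j}) else C (v i)) :
      MvPolynomial (Fin N) ℂ →ₐ[ℂ] ℂ) = aeval v := by
    apply MvPolynomial.algHom_ext
    intro i
    by_cases h : i = j
    · simp [h]
    · simp [h]
  have h1 := congrArg (fun f => f G) h
  rw [locShift]
  simpa [constantCoeff_eq, aeval_def, eval₂_zero_apply] using h1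

end LocalEquation

section Dehomogenize

variable {R ι : Type*} [CommRing R] [DecidableEq ι]

/-- Setting the `j`-th variable to one. -/
def dehom (R : Type*) [CommRing R] (j : ι) : MvPolynomial ι R →ₐ[R] MvPolynomial {i // i ≠ j} R :=
  aeval fun i => if h : i ≠ j then X ⟨i, h⟩ else 1

theorem dehom_monomial [Fintype ι] (j : ι) (α : ι →₀ ℕ) (c : R) :
    dehom R j (monomial α c) = monomial (α.subtypeDomain (· ≠ j)) c := by
  rw [dehom, aeval_monomial, monomial_eq, algebraMap_eq, Finsupp.prod_fintype _ _ (by simp),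
    Finsupp.prod_fintype _ _ (by simp)]
  congr 1
  rw [← Fintype.prod_subtype_mul_prod_subtype (· ≠ j), Finset.prod_eq_one (s := Finset.univ)
    (f := fun i : {x // ¬ x ≠ j} => _), mul_one]
  · refine Finset.prod_congr rfl fun i _ => ?_
    rw [dif_pos i.2]
    rfl
  · intro i _
    rw [dif_neg i.2, one_pow]

theorem coeff_eq_coeff_dehom [Fintype ι] (j : ι) {P : MvPolynomial ι R} {M : ℕ}
    (hP : P.IsHomogeneous M) {α : ι →₀ ℕ} (hα : α.degree = M) :
    coeff α P = coeff (α.subtypeDomain (· ≠ j)) (dehom R j P) := by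
  have hinj : ∀ β : ι →₀ ℕ, β.degree = M →
      β.subtypeDomain (· ≠ j) = α.subtypeDomain (· ≠ j) → β = α := by
    intro β hβ h
    have h1 : ∀ i, i ≠ j → β i = α i := fun i hi => DFunLike.congr_fun h ⟨i, hi⟩
    rw [← hα, Finsupp.degree_eq_sum, Finsupp.degree_eq_sum,
      ← Finset.add_sum_erase _ _ (Finset.mem_univ j),
      ← Finset.add_sum_erase _ _ (Finset.mem_univ j)] at hβ
    have h2 : ∑ i ∈ Finset.univ.erase j, β i = ∑ i ∈ Finset.univ.erase j, α i :=
      Finset.sum_congr rfl fun i hi => h1 i (Finset.ne_of_mem_erase hi)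
    ext i
    by_cases hi : i = j
    · subst hi; omega
    · exact h1 i hi
  conv_rhs => rw [P.as_sum, map_sum, coeff_sum]
  simp only [dehom_monomial, coeff_monomial]
  by_cases hs : α ∈ P.support
  · rw [Finset.sum_eq_single_of_mem α hs fun β hβ hne => if_neg fun h =>
      hne (hinj β (by_contra fun h' => (mem_support_iff.1 hβ) (hP.coeff_eq_zero h')) h),
      if_pos rfl]
  · rw [notMem_support_iff.1 hs]
    refine (Finset.sum_eq_zero fun β hβ => if_neg fun h => hs ?_).symm
    rwa [← hinj β (by_contra fun h' => (mem_support_iff.1 hβ) (hP.coeff_eq_zero h')) h]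

theorem map_dehom {R' : Type*} [CommRing R'] (f : R →+* R') (j : ι) (P : MvPolynomial ι R) :
    map f (dehom R j P) = dehom R' j (map f P) := by
  rw [dehom, dehom, map_aeval, coe_eval₂Hom, aeval_def, eval₂_map]
  congr 1
  · ext : 1
    simp
  · funext i
    split_ifs <;> simp

theorem map_aeval_X_sub_C {R' σ : Type*} [CommRing R'] (f : R →+* R') (w : σ → R)
    (P : MvPolynomial σ R) :
    map f (aeval (fun s => X s - C (w s)) P) = aeval (fun s => X s - C (f (w s))) (map f P) := by
  rw [map_aeval, coe_eval₂Hom, aeval_def, eval₂_map]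
  congr 1
  · ext : 1
    simp
  · funext i
    simp

theorem aeval_locShift {N : ℕ} (G : MvPolynomial (Fin N) ℂ) (v : Fin N → ℂ) (j : Fin N)
    (hv : v j = 1) :
    aeval (fun i : {i // i ≠ j} => X i - C (v i)) (locShift G v j) = dehom ℂ j G := by
  rw [locShift, dehom, ← AlgHom.comp_apply]
  congr 1
  apply MvPolynomial.algHom_ext
  intro i
  by_cases h : i = j
  · simp [h, hv]
  · simp [h, algebraMap_eq]

end Dehomogenize

section Recover

variable {I : Type} (U : Ultrafilter I) {M : ℕ} (j : Fin (M + 1))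

theorem coeffSet_ultraPoly_subset (G : I → MvPolynomial (Fin (M + 1)) ℂ)
    (hG : ∀ i, (G i).IsHomogeneous M) (v : I → Fin (M + 1) → ℂ)
    (hv : ∀ᶠ i in (U : Filter I), v i j = 1 ∧ eval (v i) (G i) = 0) :
    coeffSet (ultraPoly U M G) ⊆ acl ℂ (Set.range (fun s : {s // s ≠ j} =>
        toUPow U fun i => v i s) ∪
      ⋃ d ∈ Finset.range M, coeffSet (ultraPoly U (d + 1) fun i => locComp (d + 1) (G i) (v i) j)) := by
  classical
  set S := Set.range (fun s : {s // s ≠ j} => toUPow U fun i => v i s) ∪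
      ⋃ d ∈ Finset.range M, coeffSet (ultraPoly U (d + 1) fun i => locComp (d + 1) (G i) (v i) j)
    with hS
  have key : dehom _ j (ultraPoly U M G) =
      aeval (fun s : {s // s ≠ j} => X s - C ((toUPow U : (I → ℂ) →+* UPow U) fun i => v i s))
        (∑ d ∈ Finset.range M, ultraPoly U (d + 1) fun i => locComp (d + 1) (G i) (v i) j) := by
    have h1 := map_aeval_X_sub_C (toUPow U : (I → ℂ) →+* UPow U)
        (fun (s : {s // s ≠ j}) i => v i s)
        (∑ d ∈ Finset.range M, liftPoly (d + 1) fun i => locComp (d + 1) (G i) (v i) j)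
    have h2 : map (toUPow U : (I → ℂ) →+* UPow U)
        (∑ d ∈ Finset.range M, liftPoly (d + 1) fun i => locComp (d + 1) (G i) (v i) j) =
        ∑ d ∈ Finset.range M, ultraPoly U (d + 1) fun i => locComp (d + 1) (G i) (v i) j :=
      map_sum _ _ _
    rw [← h2, ← h1, ultraPoly, ← map_dehom]
    refine map_toUPow_congr U (hv.mono fun i hi => ?_)
    rw [map_dehom, map_liftPoly (hG i), map_aeval_X_sub_C, map_sum,
      ← aeval_locShift _ _ _ hi.1, ← sum_locComp _ _ _ (hG i).totalDegree_le,
      Finset.sum_range_succ', locComp_zero, hi.2, map_zero, add_zero]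
    refine congrArg (aeval fun s : {s // s ≠ j} => X s - C (v i s)) ?_
    exact Finset.sum_congr rfl fun d _ => (map_liftPoly (i := i)
      (p := fun i => locComp (d + 1) (G i) (v i) j) (isHomogeneous_locComp _ _ _ _)).symm
  rintro _ ⟨α, rfl⟩
  by_cases hα : α.degree = M
  · change coeff α _ ∈ _
    rw [coeff_eq_coeff_dehom j (isHomogeneous_ultraPoly U M G) hα, key]
    refine coeff_mem_of_mem_polyOver (aeval_mem_polyOver (fun s => ?_) ?_) _
    · exact sub_mem (X_mem_polyOver _)
        (C_mem_polyOver (subset_acl _ (Or.inl ⟨s, rfl⟩)))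
    · refine sum_mem fun d hd => mem_polyOver_acl_of_coeffSet_subset ?_
      exact Set.subset_union_of_subset_right (Set.subset_biUnion_of_mem
        (u := fun d => coeffSet (ultraPoly U (d + 1) fun i => locComp (d + 1) (G i) (v i) j)) hd) _
  · change coeff α _ ∈ _
    rw [(isHomogeneous_ultraPoly U M G).coeff_eq_zero hα]
    exact zero_mem _

end Recover

section SumOfSquares

variable {ι : Type*}

/-- The linear form with the given coefficients. -/
def linForm {R : Type*} [CommRing R] [Fintype ι] (l : ι → R) : MvPolynomial ι R := ∑ i, C (l i) * X i

theorem isHomogeneous_linForm {R : Type*} [CommRing R] [Fintype ι] (l : ι → R) :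
    (linForm l).IsHomogeneous 1 :=
  IsHomogeneous.sum _ _ _ fun i _ => isHomogeneous_C_mul_X _ _

theorem map_linForm {R R' : Type*} [CommRing R] [CommRing R'] [Fintype ι] (f : R →+* R')
    (l : ι → R) : map f (linForm l) = linForm fun i => f (l i) := by
  simp [linForm]

theorem eval_linForm {R : Type*} [CommRing R] [Fintype ι] (l w : ι → R) :
    eval w (linForm l) = ∑ i, l i * w i := by
  simp [linForm]

theorem exists_sum_sq [Fintype ι] (q : MvPolynomial ι ℂ) (hq : q.IsHomogeneous 2) :
    ∃ (r : ℕ) (l : Fin r → ι → ℂ), q = ∑ a, linForm (l a) ^ 2 := by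
  classical
  suffices h : ∃ (T : Type) (_ : Fintype T) (l : T → ι → ℂ), q = ∑ a, linForm (l a) ^ 2 by
    obtain ⟨T, _, l, hl⟩ := h
    refine ⟨Fintype.card T, fun a => l ((Fintype.equivFin T).symm a), hl.trans ?_⟩
    exact (Equiv.sum_comp (Fintype.equivFin T).symm fun a => linForm (l a) ^ 2).symm
  rw [q.as_sum]
  have hmon : ∀ α ∈ q.support, ∃ (T : Type) (_ : Fintype T) (l : T → ι → ℂ),
      monomial α (coeff α q) = ∑ a, linForm (l a) ^ 2 := by
    intro α hα
    have h2 : α.degree = 2 := by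
      by_contra h
      exact (mem_support_iff.1 hα) (hq.coeff_eq_zero h)
    obtain ⟨i, k, rfl⟩ : ∃ i k, α = Finsupp.single i 1 + Finsupp.single k 1 := by
      have h0 : α ≠ 0 := by rintro rfl; simp at h2
      obtain ⟨i, hi⟩ := Finsupp.ne_iff.1 h0
      have hle : Finsupp.single i 1 ≤ α := by
        rw [Finsupp.single_le_iff]
        exact Nat.one_le_iff_ne_zero.2 hi
      obtain ⟨β, rfl⟩ := exists_add_of_le hle
      rw [map_add, Finsupp.degree_single] at h2
      have h1 : β.degree = 1 := by omega
      have h0 : β ≠ 0 := by rintro rfl; simp at h1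
      obtain ⟨k, hk⟩ := Finsupp.ne_iff.1 h0
      have hle : Finsupp.single k 1 ≤ β := by
        rw [Finsupp.single_le_iff]
        exact Nat.one_le_iff_ne_zero.2 hk
      obtain ⟨γ, rfl⟩ := exists_add_of_le hle
      rw [map_add, Finsupp.degree_single] at h1
      have : γ = 0 := (Finsupp.degree_eq_zero_iff γ).1 (by omega)
      exact ⟨i, k, by rw [this, add_zero]⟩
    set c := coeff (Finsupp.single i 1 + Finsupp.single k 1) q
    obtain ⟨s, hs⟩ := IsAlgClosed.exists_pow_nat_eq c (n := 2) (by norm_num)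
    refine ⟨Fin 2, inferInstance, ![fun x => s / 2 * (if x = i then 1 else 0) +
      s / 2 * (if x = k then 1 else 0), fun x => Complex.I * s / 2 * (if x = i then 1 else 0) -
      Complex.I * s / 2 * (if x = k then 1 else 0)], ?_⟩
    apply MvPolynomial.funext
    intro w
    simp [Fin.sum_univ_two, eval_linForm, eval_monomial, Finsupp.prod_add_index', pow_add,
      add_mul, sub_mul, Finset.sum_add_distrib, Finset.sum_sub_distrib, ← hs]
    have := Complex.I_sq
    linear_combination (-(s^2 * (w i - w k)^2/4)) * this
  suffices h : ∀ A : Finset (ι →₀ ℕ), A ⊆ q.support → ∃ (T : Type) (_ : Fintype T)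
      (l : T → ι → ℂ), ∑ α ∈ A, monomial α (coeff α q) = ∑ a, linForm (l a) ^ 2 from
    h _ subset_rfl
  intro A hA
  induction A using Finset.induction_on with
  | empty => exact ⟨Empty, inferInstance, Empty.elim, by simp⟩
  | insert α A hα ih =>
    obtain ⟨T, _, l, hl⟩ := ih ((Finset.subset_insert _ _).trans hA)
    obtain ⟨T', _, l', hl'⟩ := hmon α (hA (Finset.mem_insert_self _ _))
    refine ⟨T' ⊕ T, inferInstance, Sum.elim l' l, ?_⟩
    rw [Finset.sum_insert hα, hl, hl', Fintype.sum_sum_type]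
    rfl

/-- A quadratic form of rank at most `r` on a set is a sum of `r` squares there. -/
theorem exists_sum_sq_of_rankOn_le {n r : ℕ} {q : MvPolynomial (Fin n) ℂ} (hq : q.IsHomogeneous 2)
    {A : Set (Fin n → ℂ)} (h : rankOn q A ≤ r) :
    ∃ l : Fin r → Fin n → ℂ, ∀ z ∈ A, eval z q = ∑ a, (∑ i, l a i * z i) ^ 2 := by
  have hne : {r : ℕ | ∃ l : Fin r → ((Fin n → ℂ) →ₗ[ℂ] ℂ),
      ∀ z ∈ A, MvPolynomial.eval z q = ∑ i, l i z ^ 2}.Nonempty := by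
    obtain ⟨r, l, hl⟩ := exists_sum_sq q hq
    refine ⟨r, fun a => ∑ i, l a i • LinearMap.proj i, fun z _ => ?_⟩
    rw [hl]
    simp [eval_linForm]
  obtain ⟨l, hl⟩ := Nat.sInf_mem hne
  refine ⟨fun a i => if h : (a : ℕ) < rankOn q A then l ⟨a, h⟩ (Pi.single i 1) else 0,
    fun z hz => ?_⟩
  rw [hl z hz]
  have h1 : ∀ a, l a z = ∑ i, l a (Pi.single i 1) * z i := by
    intro a
    conv_lhs => rw [← Finset.univ_sum_single z]
    rw [map_sum]
    refine Finset.sum_congr rfl fun i _ => ?_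
    have : (Pi.single i (z i) : Fin n → ℂ) = z i • Pi.single i 1 := by
      rw [← Pi.single_smul', smul_eq_mul, mul_one]
    rw [this, map_smul, smul_eq_mul, mul_comm]
  obtain ⟨t, rfl⟩ := Nat.exists_eq_add_of_le h
  rw [Fin.sum_univ_add]
  rw [Finset.sum_eq_zero (s := Finset.univ) (f := fun a : Fin t => _), add_zero]
  · refine Finset.sum_congr rfl fun a _ => ?_
    rw [h1]
    simp [rankOn]
  · intro a _
    simp

end SumOfSquares

section RankConditions

theorem eval_bind₁_apply {R σ τ : Type*} [CommRing R] (w : τ → R) (s : σ → MvPolynomial τ R)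
    (P : MvPolynomial σ R) : eval w (bind₁ s P) = eval (fun i => eval w (s i)) P := by
  rw [← coe_aeval_eq_eval, ← coe_aeval_eq_eval]
  exact aeval_bind₁ _ _ _

theorem homogeneousComponent_mul {R σ : Type*} [CommRing R] {p : MvPolynomial σ R} {a : ℕ}
    (hp : p.IsHomogeneous a) (b : ℕ) (q : MvPolynomial σ R) :
    homogeneousComponent (a + b) (p * q) = p * homogeneousComponent b q := by
  conv_lhs => rw [← sum_homogeneousComponent q, Finset.mul_sum, map_sum]
  have h : ∀ i, homogeneousComponent (a + b) (p * homogeneousComponent i q) =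
      if i = b then p * homogeneousComponent b q else 0 := by
    intro i
    rw [homogeneousComponent_of_mem (hp.mul (homogeneousComponent_isHomogeneous i q))]
    by_cases h : i = b
    · simp [h]
    · rw [if_neg (by omega), if_neg h]
  simp only [h]
  rw [Finset.sum_ite_eq']
  split_ifs with hb
  · rfl
  · rw [homogeneousComponent_eq_zero _ _ (by simpa using hb), mul_zero]

theorem exists_eq_linForm_mul {σ : Type*} [Fintype σ] {c : σ → ℂ} {i₀ : σ} (hc : c i₀ ≠ 0)
    {P : MvPolynomial σ ℂ} {d : ℕ} (hP : P.IsHomogeneous (d + 1))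
    (h : ∀ w, eval w (linForm c) = 0 → eval w P = 0) :
    ∃ m : MvPolynomial σ ℂ, m.IsHomogeneous d ∧ P = linForm c * m := by
  classical
  let s : σ → MvPolynomial σ ℂ := fun i => if i = i₀ then X i₀ - C (c i₀)⁻¹ * linForm c else X i
  have h0 : bind₁ s P = 0 := by
    apply MvPolynomial.funext
    intro w
    rw [map_zero, eval_bind₁_apply]
    refine h _ ?_
    rw [eval_linForm, ← Finset.add_sum_erase _ _ (Finset.mem_univ i₀)]
    have h1 : ∑ i ∈ Finset.univ.erase i₀, c i * eval w (s i) = ∑ i ∈ Finset.univ.erase i₀, c i * w i :=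
      Finset.sum_congr rfl fun i hi => by simp [s, Finset.ne_of_mem_erase hi]
    rw [h1]
    have h2 := eval_linForm c w
    rw [← Finset.add_sum_erase _ _ (Finset.mem_univ i₀)] at h2
    simp only [s, if_true, map_sub, map_mul, eval_C, eval_X, h2]
    field_simp
    ring
  have hmem : P ∈ Ideal.span {linForm c} := by
    rw [← Ideal.Quotient.eq_zero_iff_mem]
    have h1 : Ideal.Quotient.mkₐ ℂ (Ideal.span {linForm c}) P =
        (Ideal.Quotient.mkₐ ℂ (Ideal.span {linForm c})) (bind₁ s P) := by
      rw [← AlgHom.comp_apply]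
      congr 1
      apply MvPolynomial.algHom_ext
      intro i
      by_cases hi : i = i₀
      · subst hi
        have h3 : Ideal.Quotient.mkₐ ℂ (Ideal.span {linForm c}) (linForm c) = 0 :=
          Ideal.Quotient.eq_zero_iff_mem.2 (Ideal.mem_span_singleton_self _)
        simp only [AlgHom.comp_apply, bind₁_X_right, s, if_true, map_sub, map_mul, h3, mul_zero,
          sub_zero]
      · simp [s, hi]
    rw [h0, map_zero] at h1
    exact h1
  obtain ⟨m, hm⟩ := Ideal.mem_span_singleton.1 hmem
  refine ⟨homogeneousComponent d m, homogeneousComponent_isHomogeneous _ _, ?_⟩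
  have h1 := congrArg (homogeneousComponent (d + 1)) hm
  rw [homogeneousComponent_eq_self hP] at h1
  rw [h1, add_comm, homogeneousComponent_mul (isHomogeneous_linForm c)]

theorem eval_chartComp {N : ℕ} (k : ℕ) (G : MvPolynomial (Fin N) ℂ) (v : Fin N → ℂ) (j : Fin N)
    (z : Fin N → ℂ) :
    eval z (chartComp k G v j) = eval (fun s : {i // i ≠ j} => z s) (locComp k G v j) := by
  rw [← rename_locComp, eval_rename]
  rfl

/-- Extension by zero to the ambient space of the chart. -/
def extZero {N : ℕ} (j : Fin N) (w : {i // i ≠ j} → ℂ) : Fin N → ℂ :=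
  fun i => if h : i ≠ j then w ⟨i, h⟩ else 0

theorem extZero_self {N : ℕ} (j : Fin N) (w : {i // i ≠ j} → ℂ) : extZero j w j = 0 := by
  simp [extZero]

theorem extZero_coe {N : ℕ} (j : Fin N) (w : {i // i ≠ j} → ℂ) (s : {i // i ≠ j}) :
    extZero j w s = w s := by
  simp [extZero, s.2]

theorem eval_extZero_chartComp {N : ℕ} (k : ℕ) (G : MvPolynomial (Fin N) ℂ) (v : Fin N → ℂ)
    (j : Fin N) (w : {i // i ≠ j} → ℂ) :
    eval (extZero j w) (chartComp k G v j) = eval w (locComp k G v j) := by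
  rw [eval_chartComp]
  simp only [extZero_coe]

theorem sum_mul_extZero {N : ℕ} (l : Fin N → ℂ) (j : Fin N) (w : {i // i ≠ j} → ℂ) :
    ∑ i, l i * extZero j w i = ∑ s : {i // i ≠ j}, l s * w s := by
  rw [Fintype.sum_eq_add_sum_subtype_ne _ j, extZero_self, mul_zero, zero_add]
  simp only [extZero_coe]

theorem isHomogeneous_chartComp {N : ℕ} (k : ℕ) (G : MvPolynomial (Fin N) ℂ) (v : Fin N → ℂ)
    (j : Fin N) : (chartComp k G v j).IsHomogeneous k :=
  homogeneousComponent_isHomogeneous _ _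

theorem locComp_two_eq_sum_sq {N : ℕ} {G : MvPolynomial (Fin N) ℂ} {v : Fin N → ℂ} {j : Fin N}
    {r : ℕ} (h : rankOn (chartComp 2 G v j) {z | z j = 0} ≤ r) :
    ∃ l : Fin r → {i // i ≠ j} → ℂ, locComp 2 G v j = ∑ a, linForm (l a) ^ 2 := by
  obtain ⟨l, hl⟩ := exists_sum_sq_of_rankOn_le (isHomogeneous_chartComp 2 G v j) h
  refine ⟨fun a s => l a s, MvPolynomial.funext fun w => ?_⟩
  rw [← eval_extZero_chartComp, hl _ (extZero_self j w)]
  simp [eval_linForm, sum_mul_extZero]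

theorem locComp_two_eq_sum_sq_add {N : ℕ} {G : MvPolynomial (Fin N) ℂ} {v : Fin N → ℂ} {j : Fin N}
    {r : ℕ} (h : rankOn (chartComp 2 G v j)
      {z | z j = 0 ∧ eval z (chartComp 1 G v j) = 0} ≤ r)
    {c : {i // i ≠ j} → ℂ} (hcq : locComp 1 G v j = linForm c) {i₀ : {i // i ≠ j}}
    (hc : c i₀ ≠ 0) :
    ∃ (l : Fin r → {i // i ≠ i₀} → ℂ) (m : {i // i ≠ j} → ℂ), locComp 2 G v j =
      ∑ a, (∑ i : {i // i ≠ i₀}, C (l a i) * X (i : {i // i ≠ j})) ^ 2 + linForm c * linForm m := by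
  obtain ⟨l, hl⟩ := exists_sum_sq_of_rankOn_le (isHomogeneous_chartComp 2 G v j) h
  let l' : Fin r → {i // i ≠ i₀} → ℂ := fun a s => l a s - l a i₀ * (c i₀)⁻¹ * c s
  obtain ⟨m, hm, hP⟩ := exists_eq_linForm_mul (d := 1) hc (P := locComp 2 G v j -
    ∑ a, (∑ i : {i // i ≠ i₀}, C (l' a i) * X (i : {i // i ≠ j})) ^ 2) (by
      refine (isHomogeneous_locComp _ _ _ _).sub (IsHomogeneous.sum _ _ _ fun a _ => ?_)
      exact (IsHomogeneous.sum _ _ _ fun i _ => isHomogeneous_C_mul_X _ _).pow 2) (by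
      intro w hw
      rw [map_sub, sub_eq_zero, ← eval_extZero_chartComp, hl _ ⟨extZero_self j w, by
        rw [eval_extZero_chartComp, hcq, hw]⟩, map_sum]
      refine Finset.sum_congr rfl fun a _ => ?_
      rw [sum_mul_extZero, map_pow, map_sum]
      congr 1
      simp only [map_mul, eval_C, eval_X, l', sub_mul, Finset.sum_sub_distrib]
      rw [eval_linForm, Fintype.sum_eq_add_sum_subtype_ne _ i₀] at hw
      rw [Fintype.sum_eq_add_sum_subtype_ne _ i₀]
      simp only [mul_assoc, ← Finset.mul_sum]
      rw [eq_neg_of_add_eq_zero_right hw]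
      field_simp
      ring)
  refine ⟨l', fun i => coeff (Finsupp.single i 1) m, ?_⟩
  have h1 : linForm (fun i => coeff (Finsupp.single i 1) m) = m := (isHomogeneous_one_eq_sum hm).symm
  rw [h1, ← hP]
  ring

variable {I : Type} (U : Ultrafilter I)

theorem ultraPoly_eq_map {σ : Type*} [Fintype σ] [DecidableEq σ] {d : ℕ}
    {p : I → MvPolynomial σ ℂ} (hp : ∀ i, (p i).IsHomogeneous d) {P : MvPolynomial σ (I → ℂ)}
    (h : ∀ᶠ i in (U : Filter I), p i = map (Pi.evalRingHom (fun _ : I => ℂ) i) P) :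
    ultraPoly U d p = map (toUPow U : (I → ℂ) →+* UPow U) P := by
  refine map_toUPow_congr U (h.mono fun i hi => ?_)
  rw [map_liftPoly (hp i), hi]

end RankConditions

section SingleForm

variable {k F σ : Type*} [Field k] [Field F] [Algebra k F] {S : Set F}

theorem dle_coeffSet_of_mem_polyOver {ι : Type*} [Fintype ι] (x : ι → F) {P : MvPolynomial σ F}
    (h : P ∈ polyOver σ (acl k (S ∪ Set.range x))) : Dle k S (coeffSet P) (Fintype.card ι) :=
  (Dle.range x).mono (subset_acl _) (coeffSet_subset_acl h) le_rfl

theorem linForm_mem_polyOver [Fintype σ] {E : IntermediateField k F} {l : σ → F}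
    (h : ∀ i, l i ∈ E) : linForm l ∈ polyOver σ E :=
  sum_mem fun i _ => mul_mem (C_mem_polyOver (h i)) (X_mem_polyOver _)

theorem exists_dle_iUnion_of_single_of_lt [Fintype σ] [IsAlgClosed F] {Q : ℕ → MvPolynomial σ F}
    {m : ℕ} (hQ : ∀ i < m, (Q i).IsHomogeneous (i + 2))
    {i₀ : ℕ} (hi₀ : i₀ < m) {w c : ℕ}
    (h : Dle k (S ∪ ⋃ i < i₀, coeffSet (Q i)) (coeffSet (Q i₀)) w)
    (hc : w + c ≤ (Fintype.card σ + (i₀ + 2) - 1).choose (i₀ + 2)) :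
    ∃ e, Dle k S (⋃ i < m, coeffSet (Q i)) e ∧ e + c ≤
      ∑ i ∈ Finset.range m, (Fintype.card σ + (i + 2) - 1).choose (i + 2) := by
  obtain ⟨e, he, hes⟩ := exists_dle_iUnion_of_steps (k := k) (S := S) hQ
    (D := fun j => if j = i₀ then c else 0) fun j hj hD => by
      obtain rfl : j = i₀ := by by_contra h; simp [h] at hD
      exact ⟨w, h, by rwa [if_pos rfl]⟩
  refine ⟨e, he, ?_⟩
  rwa [Finset.sum_ite_eq', if_pos (Finset.mem_range.2 hi₀)] at hes

end SingleForm

section UltraConditions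

theorem exists_linForm_of_isHomogeneous_one {N : ℕ} (j : Fin N) {l : MvPolynomial (Fin N) ℂ}
    (hl : l.IsHomogeneous 1) : ∃ l' : {i // i ≠ j} → ℂ,
      ∀ w, eval (extZero j w) l = eval w (linForm l') := by
  refine ⟨fun s => coeff (Finsupp.single (s : Fin N) 1) l, fun w => ?_⟩
  conv_lhs => rw [isHomogeneous_one_eq_sum hl]
  rw [eval_linForm, ← sum_mul_extZero (fun i => coeff (Finsupp.single i 1) l)]
  simp

theorem locComp_three_of_not_R23 {M : ℕ} {G : MvPolynomial (Fin (M + 1)) ℂ}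
    {v : Fin (M + 1) → ℂ} {j : Fin (M + 1)} (h : ¬ ChartR23 G v j) :
    ∃ l : Fin 4 → {i // i ≠ j} → ℂ, locComp 3 G v j =
      linForm (l 0) * linForm (l 1) * linForm (l 2) + linForm (l 3) * locComp 2 G v j := by
  rw [ChartR23, not_not] at h
  obtain ⟨a, b, l, l₁, l₂, l₃, ha, hb, hl, h1, h2, h3, h⟩ := h
  have hhom : ∀ {x}, x ∈ Submodule.span ℂ ({a, b} : Set (MvPolynomial (Fin (M + 1)) ℂ)) →
      x.IsHomogeneous 1 := by
    intro x hx
    have hle : Submodule.span ℂ ({a, b} : Set (MvPolynomial (Fin (M + 1)) ℂ)) ≤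
        homogeneousSubmodule _ ℂ 1 := by
      rw [Submodule.span_le]
      rintro y (rfl | rfl)
      · exact ha
      · exact hb
    exact hle hx
  obtain ⟨m1, hm1⟩ := exists_linForm_of_isHomogeneous_one j (hhom h1)
  obtain ⟨m2, hm2⟩ := exists_linForm_of_isHomogeneous_one j (hhom h2)
  obtain ⟨m3, hm3⟩ := exists_linForm_of_isHomogeneous_one j (hhom h3)
  obtain ⟨m, hm⟩ := exists_linForm_of_isHomogeneous_one j hl
  refine ⟨![m1, m2, m3, m], MvPolynomial.funext fun w => ?_⟩
  rw [← eval_extZero_chartComp, h]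
  simp [hm1, hm2, hm3, hm, eval_extZero_chartComp]

variable {I : Type} (U : Ultrafilter I) {M : ℕ} {j : Fin (M + 1)}
  {G : I → MvPolynomial (Fin (M + 1)) ℂ} {v : I → Fin (M + 1) → ℂ}

theorem map_liftPoly_locComp (d : ℕ) (a : I) : map (Pi.evalRingHom (fun _ : I => ℂ) a)
    (liftPoly d fun a => locComp d (G a) (v a) j) = locComp d (G a) (v a) j :=
  map_liftPoly (p := fun a => locComp d (G a) (v a) j) (isHomogeneous_locComp _ _ _ _)

/-- The degree `d` term of the ultraproduct of the local equations. -/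
def ultraComp {M : ℕ} (j : Fin (M + 1)) (G : I → MvPolynomial (Fin (M + 1)) ℂ)
    (v : I → Fin (M + 1) → ℂ) (d : ℕ) : MvPolynomial {i // i ≠ j} (UPow U) :=
  ultraPoly U d fun a => locComp d (G a) (v a) j

theorem isHomogeneous_ultraComp (d : ℕ) : (ultraComp U j G v d).IsHomogeneous d :=
  isHomogeneous_ultraPoly _ _ _

theorem ultraComp_eq_map {d : ℕ} {P : MvPolynomial {i // i ≠ j} (I → ℂ)}
    (h : ∀ᶠ a in (U : Filter I), locComp d (G a) (v a) j =
      map (Pi.evalRingHom (fun _ : I => ℂ) a) P) :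
    ultraComp U j G v d = map (toUPow U : (I → ℂ) →+* UPow U) P :=
  ultraPoly_eq_map U (fun _ => isHomogeneous_locComp _ _ _ _) h

variable (S : Set (UPow U))

theorem dle_ultraComp_two_of_rank {r : ℕ} (h : ∀ᶠ a in (U : Filter I),
    rankOn (chartComp 2 (G a) (v a) j) {z | z j = 0} ≤ r) :
    ∃ e, Dle ℂ S (coeffSet (ultraComp U j G v 2)) e ∧
      e + (M - r + 1).choose 2 ≤ (M + 1).choose 2 := by
  obtain ⟨l, hl⟩ := (h.mono fun a ha => locComp_two_eq_sum_sq ha).choice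
  have h1 : ultraComp U j G v 2 =
      ∑ b, (∑ i, C (toUPow U fun a => l a b i) * X i) ^ 2 := by
    rw [ultraComp_eq_map U (P := ∑ b, linForm (fun i a => l a b i) ^ 2)]
    · simp [linForm]
    · refine hl.mono fun a ha => ?_
      rw [ha]
      simp [map_linForm]
  obtain ⟨e, he, hes⟩ := dle_coeffSet_sum_sq (k := ℂ) id
    (fun b i => toUPow U fun a => l a b i : Fin r → {i // i ≠ j} → UPow U) S
  rw [h1]
  refine ⟨e, he, ?_⟩
  simpa [Fintype.card_subtype_compl] using hes

theorem dle_ultraComp_two_of_rank_hyperplane {r : ℕ} (hr : r + 1 ≤ M)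
    (h1 : ∀ᶠ a in (U : Filter I), chartComp 1 (G a) (v a) j ≠ 0)
    (hS : coeffSet (ultraComp U j G v 1) ⊆ S) (h : ∀ᶠ a in (U : Filter I),
    rankOn (chartComp 2 (G a) (v a) j) {z | z j = 0 ∧ eval z (chartComp 1 (G a) (v a) j) = 0} ≤ r) :
    ∃ e, Dle ℂ S (coeffSet (ultraComp U j G v 2)) e ∧
      e + (M - r).choose 2 ≤ (M + 1).choose 2 := by
  classical
  set c : I → {i // i ≠ j} → ℂ := fun a i => coeff (Finsupp.single i 1) (locComp 1 (G a) (v a) j)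
    with hcdef
  have hc : ∀ a, locComp 1 (G a) (v a) j = linForm (c a) := fun a =>
    isHomogeneous_one_eq_sum (isHomogeneous_locComp _ _ _ _)
  obtain ⟨i₀, hi₀⟩ : ∃ i₀, ∀ᶠ a in (U : Filter I), c a i₀ ≠ 0 := by
    refine Ultrafilter.eventually_exists_iff.1 (h1.mono fun a ha => ?_)
    by_contra! h0
    refine ha ?_
    rw [← rename_locComp, hc]
    simp [linForm, h0]
  obtain ⟨lm, hlm⟩ : ∃ lm : I → (Fin r → {i // i ≠ i₀} → ℂ) × ({i // i ≠ j} → ℂ),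
      ∀ᶠ a in (U : Filter I), locComp 2 (G a) (v a) j = ∑ b, (∑ i : {i // i ≠ i₀},
        C ((lm a).1 b i) * X (i : {i // i ≠ j})) ^ 2 + linForm (c a) * linForm (lm a).2 := by
    refine (h.and hi₀).mono (q := fun a => ∃ lm : (Fin r → {i // i ≠ i₀} → ℂ) ×
      ({i // i ≠ j} → ℂ), locComp 2 (G a) (v a) j = ∑ b, (∑ i : {i // i ≠ i₀},
        C (lm.1 b i) * X (i : {i // i ≠ j})) ^ 2 + linForm (c a) * linForm lm.2)
      (fun a ha => ?_) |>.choice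
    obtain ⟨l, m, h⟩ := locComp_two_eq_sum_sq_add ha.1 (hc a) ha.2
    exact ⟨(l, m), h⟩
  set L : Fin r → {i // i ≠ i₀} → UPow U := fun b i => toUPow U fun a => (lm a).1 b i
  set m : {i // i ≠ j} → UPow U := fun i => toUPow U fun a => (lm a).2 i
  have h2 : ultraComp U j G v 2 = ∑ b, (∑ i : {i // i ≠ i₀},
      C (L b i) * X (i : {i // i ≠ j})) ^ 2 + ultraComp U j G v 1 * linForm m := by
    rw [ultraComp_eq_map U (P := ∑ b, (∑ i : {i // i ≠ i₀},
      C (fun a => (lm a).1 b i) * X (i : {i // i ≠ j})) ^ 2 + linForm (fun i a => c a i) *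
        linForm (fun i a => (lm a).2 i)),
      ultraComp_eq_map U (d := 1) (P := linForm (fun i a => c a i))]
    · simp [map_linForm, L, m]
    · refine .of_forall fun a => ?_
      rw [hc, map_linForm]
      rfl
    · refine hlm.mono fun a ha => ?_
      rw [ha]
      simp [map_linForm]
  obtain ⟨e, he, hes⟩ := dle_coeffSet_sum_sq (k := ℂ)
    (fun i : {i // i ≠ i₀} => (i : {i // i ≠ j})) L S
  have h3 : Dle ℂ S (coeffSet (∑ b, (∑ i : {i // i ≠ i₀}, C (L b i) * X (i : {i // i ≠ j})) ^ 2) ∪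
      Set.range m) (e + Fintype.card {i // i ≠ j}) := he.trans (Dle.range m)
  rw [h2]
  refine ⟨_, h3.mono (subset_acl _) (coeffSet_subset_acl ?_) le_rfl, ?_⟩
  · refine add_mem (mem_polyOver_acl_of_coeffSet_subset ?_) (mul_mem
      (mem_polyOver_acl_of_coeffSet_subset (hS.trans Set.subset_union_left))
      (linForm_mem_polyOver fun i => subset_acl _ ?_))
    · exact Set.subset_union_left.trans Set.subset_union_right
    · exact Or.inr (Or.inr ⟨i, rfl⟩)
  · simp only [Fintype.card_subtype_compl, Fintype.card_fin, Fintype.card_unique,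
      Nat.add_sub_cancel, ne_eq] at hes ⊢
    obtain ⟨t, rfl⟩ : ∃ t, M = r + t + 1 := ⟨M - 1 - r, by omega⟩
    rw [show r + t + 1 - 1 - r + 1 = t + 1 by omega, show r + t + 1 - 1 + 1 = r + t + 1 by omega]
      at hes
    rw [show r + t + 1 - r = t + 1 by omega, Nat.choose_succ_succ' (r + t + 1) 1, Nat.choose_one_right,
      one_add_one_eq_two]
    omega

theorem dle_ultraComp_three_of_not_R23 (hS : coeffSet (ultraComp U j G v 2) ⊆ S)
    (h : ∀ᶠ a in (U : Filter I), ¬ ChartR23 (G a) (v a) j) :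
    Dle ℂ S (coeffSet (ultraComp U j G v 3)) (4 * M) := by
  obtain ⟨l, hl⟩ := (h.mono fun a ha => locComp_three_of_not_R23 ha).choice
  have h1 : ultraComp U j G v 3 = linForm (fun i => toUPow U fun a => l a 0 i) *
      linForm (fun i => toUPow U fun a => l a 1 i) * linForm (fun i => toUPow U fun a => l a 2 i) +
      linForm (fun i => toUPow U fun a => l a 3 i) * ultraComp U j G v 2 := by
    rw [ultraComp_eq_map U (P := linForm (fun i a => l a 0 i) * linForm (fun i a => l a 1 i) *
      linForm (fun i a => l a 2 i) + linForm (fun i a => l a 3 i) *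
        liftPoly 2 fun a => locComp 2 (G a) (v a) j)]
    · simp [map_linForm, ultraComp, ultraPoly]
    · refine hl.mono fun a ha => ?_
      rw [ha]
      simp only [map_add, map_mul, map_linForm]
      rw [map_liftPoly_locComp]
      rfl
  have h2 := dle_coeffSet_of_mem_polyOver (k := ℂ) (S := S) (P := ultraComp U j G v 3)
    (fun x : Fin 4 × {i // i ≠ j} => toUPow U fun a => l a x.1 x.2) (by
      have h3 : ∀ b i, (toUPow U fun a => l a b i) ∈ acl ℂ (S ∪ Set.range
          (fun x : Fin 4 × {i // i ≠ j} => toUPow U fun a => l a x.1 x.2)) := fun b i =>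
        subset_acl _ (Or.inr ⟨(b, i), rfl⟩)
      rw [h1]
      exact add_mem (mul_mem (mul_mem (linForm_mem_polyOver (h3 _)) (linForm_mem_polyOver (h3 _)))
        (linForm_mem_polyOver (h3 _))) (mul_mem (linForm_mem_polyOver (h3 _))
          (mem_polyOver_acl_of_coeffSet_subset (hS.trans Set.subset_union_left))))
  simpa [Fintype.card_subtype_compl] using h2

end UltraConditions

section Regularity

theorem exists_isGeneric_of_not_zdim_le {N d : ℕ} {j : Fin N} {A : Set (Fin N → ℂ)}
    (hA : ∀ z ∈ A, z j = 0) (h : ¬ zdim A ≤ d) :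
    ∃ (V : Set ({i // i ≠ j} → ℂ)) (T : Finset {i // i ≠ j}), IsGeneric V T ∧ T.card = d + 1 ∧
      ∀ w ∈ V, extZero j w ∈ A := by
  classical
  obtain ⟨S, hSA, hS, T, hT, hind⟩ := exists_generic_of_not_zdim_le
    (φ := (LinearMap.id : (Fin N → ℂ) →ₗ[ℂ] (Fin N → ℂ))) Function.injective_id h
  have hjT : j ∉ T := by
    intro hj
    refine hind.ne_zero ⟨j, hj⟩ (Ideal.Quotient.eq_zero_iff_mem.2 ?_)
    intro z hz
    simpa using hA z (hSA hz)
  have hmem : ∀ P : MvPolynomial {i // i ≠ j} ℂ,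
      P ∈ vanIdeal (LinearMap.id : ({i // i ≠ j} → ℂ) →ₗ[ℂ] _) {w | extZero j w ∈ S} ↔
      rename Subtype.val P ∈ vanIdeal (LinearMap.id : (Fin N → ℂ) →ₗ[ℂ] (Fin N → ℂ)) S := by
    intro P
    simp only [mem_vanIdeal, LinearMap.id_apply, eval_rename, Set.mem_ofPred_eq]
    refine ⟨fun h z hz => h _ ?_, fun h w hw => ?_⟩
    · have : extZero j (z ∘ Subtype.val) = z := by
        funext i
        by_cases hi : i = j
        · subst hi
          rw [extZero_self, hA z (hSA hz)]
        · simp [extZero, hi]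
      rwa [this]
    · convert h _ hw using 2
      congr 1
      funext s
      exact (extZero_coe j w s).symm
  refine ⟨{w | extZero j w ∈ S}, T.subtype (· ≠ j), ⟨?_, fun P hP hmemP => hP ?_⟩, ?_,
    fun w hw => hSA hw⟩
  · have : vanIdeal (LinearMap.id : ({i // i ≠ j} → ℂ) →ₗ[ℂ] _) {w | extZero j w ∈ S} =
        (vanIdeal (LinearMap.id : (Fin N → ℂ) →ₗ[ℂ] (Fin N → ℂ)) S).comap
          (rename (R := ℂ) (Subtype.val : {i // i ≠ j} → Fin N)).toRingHom := by
      ext P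
      exact hmem P
    rw [this]
    exact Ideal.comap_isPrime _ _
  · rw [hmem] at hmemP
    let g : {x // x ∈ T.subtype (· ≠ j)} → T := fun x => ⟨x.1, Finset.mem_subtype.1 x.2⟩
    have hg : Function.Injective g := fun x y hxy => by
      have := congrArg Subtype.val hxy
      exact Subtype.ext (Subtype.ext this)
    refine rename_injective g hg ?_
    rw [map_zero]
    refine (algebraicIndependent_iff.1 hind) _ ?_
    have h1 : ∀ Q : MvPolynomial {x // x ∈ T} ℂ, aeval (fun i : {x // x ∈ T} => Ideal.Quotient.mk (vanIdeal
        (LinearMap.id : (Fin N → ℂ) →ₗ[ℂ] (Fin N → ℂ)) S) (X (i : Fin N))) Q =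
        Ideal.Quotient.mkₐ ℂ _ (rename Subtype.val Q) := by
      intro Q
      rw [← AlgHom.comp_apply]
      congr 1
      apply MvPolynomial.algHom_ext
      intro i
      simp
    rw [h1, rename_rename]
    rw [rename_rename] at hmemP
    exact Ideal.Quotient.eq_zero_iff_mem.2 hmemP
  · rw [Finset.card_subtype, Finset.filter_true_of_mem, hT]
    intro i hi h
    exact hjT (h ▸ hi)

theorem exists_finset_coordinates {V ι : Type*} [AddCommGroup V] [Module ℂ V]
    [FiniteDimensional ℂ V] [Fintype ι] (u : ι → Module.Dual ℂ V)
    (hV : Module.finrank ℂ V ≤ Fintype.card ι) :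
    ∃ (B : Finset ι) (a : ι → B → ℂ), B.card = Module.finrank ℂ V ∧
      ∀ i, u i = ∑ b, a i b • u b := by
  classical
  obtain ⟨κ, f, hf, hspan, hli⟩ := exists_linearIndependent' ℂ u
  have := Fintype.ofInjective f hf
  have hcard : (Finset.univ.image f).card ≤ Module.finrank ℂ V := by
    rw [Finset.card_image_of_injective _ hf, Finset.card_univ, ← Subspace.dual_finrank_eq]
    exact hli.fintype_card_le_finrank
  obtain ⟨B, hB, -, hBc⟩ := Finset.exists_subsuperset_card_eq (Finset.subset_univ (Finset.univ.image f))
    hcard (by rwa [Finset.card_univ])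
  have h : ∀ i, ∃ a : B → ℂ, u i = ∑ b, a b • u b := by
    intro i
    have hi : u i ∈ Submodule.span ℂ (u '' B) := by
      have h1 : u i ∈ Submodule.span ℂ (Set.range u) := Submodule.subset_span ⟨i, rfl⟩
      rw [← hspan] at h1
      refine Submodule.span_mono ?_ h1
      rintro _ ⟨x, rfl⟩
      exact ⟨f x, hB (Finset.mem_image_of_mem _ (Finset.mem_univ _)), rfl⟩
    rw [Submodule.mem_span_image_finset_iff_exists_fun] at hi
    obtain ⟨c, hc⟩ := hi
    exact ⟨c, hc.symm⟩
  choose a ha using h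
  exact ⟨B, a, hBc, ha⟩

variable {I : Type} (U : Ultrafilter I) {M : ℕ} {j : Fin (M + 1)}
  {G : I → MvPolynomial (Fin (M + 1)) ℂ} {v : I → Fin (M + 1) → ℂ} (S : Set (UPow U))

theorem ultraComp_one_ne_zero (h1 : ∀ᶠ a in (U : Filter I), chartComp 1 (G a) (v a) j ≠ 0) :
    ultraComp U j G v 1 ≠ 0 := by
  obtain ⟨i₀, hi₀⟩ : ∃ i₀ : {i // i ≠ j}, ∀ᶠ a in (U : Filter I),
      coeff (Finsupp.single i₀ 1) (locComp 1 (G a) (v a) j) ≠ 0 := by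
    refine Ultrafilter.eventually_exists_iff.1 (h1.mono fun a ha => ?_)
    by_contra! h0
    refine ha ?_
    rw [← rename_locComp, isHomogeneous_one_eq_sum (isHomogeneous_locComp (G a) (v a) j 1)]
    simp [h0]
  intro h0
  have h2 := congrArg (coeff (Finsupp.single i₀ 1)) h0
  rw [ultraComp, coeff_ultraPoly _ _ _ (Finsupp.degree_single _ _), coeff_zero,
    toUPow_eq_zero_iff] at h2
  obtain ⟨a, ha, ha'⟩ := (h2.and hi₀).exists
  exact ha' ha

theorem exists_dle_of_not_R11 (hM : 10 ≤ M) {D : ℕ} (hD : 2 * D ≤ (M - 6) * (M - 5))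
    (h1 : ∀ᶠ a in (U : Filter I), chartComp 1 (G a) (v a) j ≠ 0)
    (hS : coeffSet (ultraComp U j G v 1) ⊆ S)
    (h : ∀ᶠ a in (U : Filter I), ¬ ChartR11 (G a) (v a) j) :
    ∃ e, Dle ℂ S (⋃ i < M - 1, coeffSet (ultraComp U j G v (i + 2))) e ∧ e + D ≤
      ∑ i ∈ Finset.range (M - 1), (M + (i + 2) - 1).choose (i + 2) := by
  have hcard : Fintype.card {i // i ≠ j} = M := by simp [Fintype.card_subtype_compl]
  obtain ⟨T, hT⟩ : ∃ T : Finset {i // i ≠ j}, ∀ᶠ a in (U : Filter I),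
      ∃ V : Set ({i // i ≠ j} → ℂ), IsGeneric V T ∧ T.card = 2 ∧
        ∀ w ∈ V, ∀ i ∈ Finset.Icc 1 (M - 1), eval w (locComp i (G a) (v a) j) = 0 := by
    refine Ultrafilter.eventually_exists_iff.1 (h.mono fun a ha => ?_)
    obtain ⟨V, T, hV, hT, hVA⟩ := exists_isGeneric_of_not_zdim_le (j := j) (d := 1)
      (A := {z : Fin (M + 1) → ℂ | z j = 0 ∧ ∀ i ∈ Finset.Icc 1 (M - 1),
        eval z (chartComp i (G a) (v a) j) = 0}) (fun z hz => hz.1) (by simpa [ChartR11] using ha)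
    refine ⟨T, V, hV, hT, fun w hw i hi => ?_⟩
    rw [← eval_extZero_chartComp]
    exact (hVA w hw).2 i hi
  obtain ⟨V, hV⟩ := hT.choice
  obtain ⟨_, -, hTc, -⟩ := hT.exists.choose_spec
  obtain ⟨K, _, _, z, hz, hind⟩ := exists_generic_point U (hV.mono fun a ha => ha.1)
  have hz0 : ∀ i ∈ Finset.Icc 1 (M - 1), aeval z (ultraComp U j G v i) = 0 := by
    intro i hi
    refine hz _ (hV.mono fun a ha x hx => ?_)
    rw [map_liftPoly_locComp]
    exact ha.2.2 x hx i hi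
  let : Algebra ℂ K := ((algebraMap (UPow U) K).comp (algebraMap ℂ (UPow U))).toAlgebra
  have := exists_dle_iUnion_extend (k := ℂ) (S := S) (m := M - 2) (n := M - 1)
    (Q := fun i => ultraComp U j G v (i + 2)) (c := D) (by omega)
    (fun i _ => isHomogeneous_ultraComp U _)
    (exists_dle_of_common_zero_hyperplane (z := z) (fun i _ => isHomogeneous_ultraComp U _)
      (fun i hi => hz0 _ (Finset.mem_Icc.2 ⟨by omega, by omega⟩)) hind hTc hM hcard (by omega) hD
      (isHomogeneous_ultraComp U 1)
      (ultraComp_one_ne_zero U h1) (hz0 _ (Finset.mem_Icc.2 ⟨by omega, by omega⟩)) hS)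
  simpa only [hcard] using this

theorem exists_dle_of_not_R21 (hM : 10 ≤ M) {D : ℕ} (hD : 2 * D + 12 ≤ (M - 7) * (M - 6))
    (h : ∀ᶠ a in (U : Filter I), ¬ ChartR21 (G a) (v a) j) :
    ∃ e, Dle ℂ S (⋃ i < M - 1, coeffSet (ultraComp U j G v (i + 2))) e ∧ e + D ≤
      ∑ i ∈ Finset.range (M - 1), (M + (i + 2) - 1).choose (i + 2) := by
  have hcard : Fintype.card {i // i ≠ j} = M := by simp [Fintype.card_subtype_compl]
  obtain ⟨⟨c, T, B⟩, hT⟩ : ∃ x : Fin 3 × Finset {i // i ≠ j} × Finset {i // i ≠ j},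
      ∀ᶠ a in (U : Filter I), ∃ Vb : Set ({i // i ≠ j} → ℂ) × ({i // i ≠ j} → x.2.2 → ℂ),
        IsGeneric Vb.1 x.2.1 ∧ x.2.1.card = 2 ∧ x.2.2.card + x.1 = M ∧
        (∀ w ∈ Vb.1, ∀ i ∈ Finset.Icc 2 (M - x.1), eval w (locComp i (G a) (v a) j) = 0) ∧
        ∀ w ∈ Vb.1, ∀ i, w i = ∑ b, Vb.2 i b * w b := by
    refine Ultrafilter.eventually_exists_iff.1 (h.mono fun a ha => ?_)
    simp only [ChartR21] at ha
    push Not at ha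
    obtain ⟨c, hc, Pl, hPl, hfr, ha⟩ := ha
    have hc2 : c < 3 := by
      rcases hc with rfl | rfl | rfl <;> norm_num
    have hker : ∀ z ∈ Pl, z j = 0 := fun z hz => by simpa using hPl hz
    obtain ⟨V, T, hV, hT, hVA⟩ := exists_isGeneric_of_not_zdim_le (j := j) (d := 1)
      (A := {z : Fin (M + 1) → ℂ | z ∈ Pl ∧ ∀ i ∈ Finset.Icc 2 (M - c),
        eval z (chartComp i (G a) (v a) j) = 0}) (fun z hz => hker z hz.1) (by simpa using ha)
    obtain ⟨B, b, hB, hb⟩ := exists_finset_coordinates (fun s : {i // i ≠ j} =>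
      (LinearMap.proj (R := ℂ) (φ := fun _ : Fin (M + 1) => ℂ) (s : Fin (M + 1))).comp Pl.subtype)
      (by rw [hfr, hcard]; omega)
    refine ⟨(⟨c, hc2⟩, T, B), (V, b), hV, hT, ?_, fun w hw i hi => ?_, fun w hw i => ?_⟩
    · rw [hB, hfr]
      simp only
      omega
    · rw [← eval_extZero_chartComp]
      exact (hVA w hw).2 i hi
    · have := LinearMap.congr_fun (hb i) ⟨_, (hVA w hw).1⟩
      simpa [extZero_coe, LinearMap.sum_apply] using this
  obtain ⟨Vb, hV⟩ := hT.choice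
  obtain ⟨_, -, hTc, hBc, -⟩ := hT.exists.choose_spec
  obtain ⟨K, _, _, z, hz, hind⟩ := exists_generic_point U (hV.mono fun a ha => ha.1)
  have hz0 : ∀ i ∈ Finset.Icc 2 (M - c), aeval z (ultraComp U j G v i) = 0 := by
    intro i hi
    refine hz _ (hV.mono fun a ha x hx => ?_)
    rw [map_liftPoly_locComp]
    exact ha.2.2.2.1 x hx i hi
  let : Algebra ℂ K := ((algebraMap (UPow U) K).comp (algebraMap ℂ (UPow U))).toAlgebra
  have hza : ∀ i, z i = ∑ b : B, (toUPow U fun a => (Vb a).2 i b) • z b := by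
    intro i
    have := hz (X i - ∑ b : B, C (fun a => (Vb a).2 i b) * X (b : {i // i ≠ j}))
      (hV.mono fun a ha x hx => by
        simpa [sub_eq_zero] using ha.2.2.2.2 x hx i)
    simp only [map_sub, map_X, map_sum, map_mul, map_C, aeval_X, aeval_C, sub_eq_zero] at this
    simpa [Algebra.smul_def] using this
  have hc2 := c.2
  have := exists_dle_iUnion_extend (k := ℂ) (S := S) (m := M - 1 - c) (n := M - 1)
    (Q := fun i => ultraComp U j G v (i + 2)) (c := D) (by omega)
    (fun i _ => isHomogeneous_ultraComp U _)
    (exists_dle_of_common_zero_subspace (c := c) (z := z) (fun i _ => isHomogeneous_ultraComp U _)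
      (fun i hi => hz0 _ (Finset.mem_Icc.2 ⟨by omega, by omega⟩)) hind hTc hM hcard (by omega)
      (by omega) hD hBc hza)
  simpa only [hcard] using this

end Regularity

section SingularPoint

theorem four_mul_add_le_choose_three {M D : ℕ} (hM : 10 ≤ M) (hD : 2 * D ≤ (M - 6) * (M - 5)) :
    4 * M + D ≤ (M + 2).choose 3 := by
  obtain ⟨a, rfl⟩ := Nat.exists_eq_add_of_le hM
  have h := Nat.add_one_mul_choose_eq (10 + a + 1) 2
  have h2 := Nat.add_one_mul_choose_eq (10 + a) 1
  rw [Nat.choose_one_right] at h2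
  obtain ⟨h3, h4⟩ : 10 + a - 6 = a + 4 ∧ 10 + a - 5 = a + 5 := by omega
  rw [h3, h4] at hD
  have h5 : (10 + a + 2).choose 3 * 6 = (a + 12) * (a + 11) * (a + 10) := by
    have : (10 + a + 1 + 1) = 10 + a + 2 := rfl
    rw [this] at h
    have h6 : (10 + a + 1).choose 2 * 2 = (10 + a + 1) * (10 + a) := h2.symm
    nlinarith
  nlinarith

variable {I : Type} (U : Ultrafilter I) {M : ℕ} {j : Fin (M + 1)}
  {G : I → MvPolynomial (Fin (M + 1)) ℂ} {v : I → Fin (M + 1) → ℂ} (S : Set (UPow U))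

theorem exists_dle_of_singular (hM : 10 ≤ M) {D : ℕ} (hD : 2 * D + 12 ≤ (M - 7) * (M - 6))
    (h : ∀ᶠ a in (U : Filter I), ¬ (ChartR21 (G a) (v a) j ∧ ChartR22 (G a) (v a) j ∧
      ChartR23 (G a) (v a) j)) :
    ∃ e, Dle ℂ S (⋃ i < M - 1, coeffSet (ultraComp U j G v (i + 2))) e ∧ e + D ≤
      ∑ i ∈ Finset.range (M - 1), (M + (i + 2) - 1).choose (i + 2) := by
  have hcard : Fintype.card {i // i ≠ j} = M := by simp [Fintype.card_subtype_compl]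
  have h' : ∀ᶠ a in (U : Filter I), ¬ ChartR21 (G a) (v a) j ∨ ¬ ChartR22 (G a) (v a) j ∨
      ¬ ChartR23 (G a) (v a) j := h.mono fun a ha => by tauto
  rw [Ultrafilter.eventually_or, Ultrafilter.eventually_or] at h'
  rcases h' with h | h | h
  · exact exists_dle_of_not_R21 U S hM hD h
  · obtain ⟨e, he, hes⟩ := dle_ultraComp_two_of_rank (G := G) (v := v) (j := j) U S (r := 7) (h.mono fun a ha => by
      rw [ChartR22] at ha; omega)
    have h1 : (M - 7 + 1).choose 2 = (M - 6) * (M - 7) / 2 := by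
      rw [Nat.choose_two_right]
      congr 2; omega
    rw [mul_comm] at h1
    have := exists_dle_iUnion_of_single (k := ℂ) (S := S) (m := M - 1)
      (Q := fun i => ultraComp U j G v (i + 2)) (fun i _ => isHomogeneous_ultraComp U _)
      (i₀ := 0) (by omega) (c := D) he (by
        rw [hcard]
        simp only [zero_add, Nat.add_succ_sub_one]
        omega)
    simpa only [hcard] using this
  · have h3 := dle_ultraComp_three_of_not_R23 U (S ∪ coeffSet (ultraComp U j G v 2))
      Set.subset_union_right h
    have := exists_dle_iUnion_of_single_of_lt (k := ℂ) (S := S) (m := M - 1)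
      (Q := fun i => ultraComp U j G v (i + 2)) (fun i _ => isHomogeneous_ultraComp U _)
      (i₀ := 1) (by omega) (c := D) (by simpa using h3) (by
        rw [hcard]
        refine four_mul_add_le_choose_three hM (le_trans ?_ (Nat.mul_le_mul
          (show M - 7 ≤ M - 6 by omega) (show M - 6 ≤ M - 5 by omega)))
        omega)
    simpa only [hcard] using this

end SingularPoint

section LinearSubstitution

variable {R ι σ : Type*} [CommRing R] [Fintype σ]

/-- The restriction of polynomials along the linear map sending the standard basis to `b`. -/
def linSubst (b : σ → ι → R) : MvPolynomial ι R →ₐ[R] MvPolynomial σ R :=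
  aeval fun i => linForm fun s => b s i

theorem linSubst_X (b : σ → ι → R) (i : ι) : linSubst b (X i) = linForm fun s => b s i :=
  aeval_X _ _

theorem eval_linSubst (b : σ → ι → R) (y : σ → R) (P : MvPolynomial ι R) :
    eval y (linSubst b P) = eval (fun i => ∑ s, b s i * y s) P := by
  rw [linSubst, ← coe_aeval_eq_eval, ← coe_aeval_eq_eval]
  simp only [RingHom.coe_coe]
  rw [← AlgHom.comp_apply, comp_aeval]
  simp [linForm]

theorem isHomogeneous_linSubst (b : σ → ι → R) {P : MvPolynomial ι R} {d : ℕ}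
    (hP : P.IsHomogeneous d) : (linSubst b P).IsHomogeneous d := by
  have := hP.aeval (fun i => linForm fun s => b s i) (fun i => isHomogeneous_linForm _)
  rwa [one_mul] at this

theorem linSubst_homogeneousComponent (b : σ → ι → R) (P : MvPolynomial ι R) (d : ℕ) :
    linSubst b (homogeneousComponent d P) = homogeneousComponent d (linSubst b P) := by
  conv_rhs => rw [← sum_homogeneousComponent P, map_sum, map_sum]
  simp only [homogeneousComponent_of_mem
    (isHomogeneous_linSubst b (homogeneousComponent_isHomogeneous _ P))]
  rw [Finset.sum_ite_eq]
  split_ifs with h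
  · rfl
  · rw [homogeneousComponent_eq_zero _ _ (by simpa using h), map_zero]

theorem map_linSubst {R' : Type*} [CommRing R'] (f : R →+* R') (b : σ → ι → R)
    (P : MvPolynomial ι R) :
    map f (linSubst b P) = linSubst (fun s i => f (b s i)) (map f P) := by
  induction P using MvPolynomial.induction_on with
  | C r => simp [linSubst]
  | add p q hp hq => simp only [map_add, hp, hq]
  | mul_X p i hp => simp only [map_mul, hp, map_X, linSubst_X, map_linForm]

end LinearSubstitution

section SubspaceIdeal

variable {ι σ κ : Type*} [Fintype ι] [Fintype σ] {V : Submodule ℂ (ι → ℂ)}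
  (b : Module.Basis σ ℂ V)

theorem exists_linSubst_section : ∃ c : ι → σ → ℂ,
    (∀ z ∈ V, ∀ i, z i = ∑ s, (b s : ι → ℂ) i * ∑ i', c i' s * z i') ∧
    ∀ s, ∑ i, C (c i s) * linSubst (fun s => (b s : ι → ℂ)) (X i) = X s := by
  classical
  obtain ⟨p, hp⟩ := V.subtype.exists_leftInverse_of_injective V.ker_subtype
  have hpz : ∀ z : V, p z = z := fun z => LinearMap.congr_fun hp z
  have hc : ∀ z : ι → ℂ, ∀ s, ∑ i, b.repr (p (Pi.single i 1)) s * z i = b.repr (p z) s := by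
    intro z s
    conv_rhs => rw [← Finset.univ_sum_single z]
    simp only [map_sum, Finsupp.coe_finsetSum, Finset.sum_apply]
    refine Finset.sum_congr rfl fun i _ => ?_
    have : (Pi.single i (z i) : ι → ℂ) = z i • Pi.single i 1 := by
      rw [← Pi.single_smul, smul_eq_mul, mul_one]
    rw [this, map_smul, map_smul, Finsupp.smul_apply, smul_eq_mul, mul_comm]
  refine ⟨fun i s => b.repr (p (Pi.single i 1)) s, fun z hz i => ?_, fun s => ?_⟩
  · simp only [hc]
    have := congrArg (fun x : V => (x : ι → ℂ) i) (b.sum_repr (p z))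
    rw [hpz ⟨z, hz⟩] at this
    simp only [Submodule.coe_sum, Submodule.coe_smul, Finset.sum_apply, Pi.smul_apply,
      smul_eq_mul] at this
    rw [← this]
    refine Finset.sum_congr rfl fun s _ => ?_
    rw [hpz ⟨z, hz⟩, mul_comm]
  · refine MvPolynomial.funext fun y => ?_
    simp only [map_sum, map_mul, eval_C, eval_linSubst, eval_X]
    rw [hc]
    have : (fun i => ∑ s, (b s : ι → ℂ) i * y s) = ((∑ s, y s • b s : V) : ι → ℂ) := by
      funext i
      simp [Submodule.coe_sum, mul_comm]
    rw [this, hpz]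
    simp [Finsupp.single_apply]

theorem linSubst_surjective : Function.Surjective (linSubst fun s => (b s : ι → ℂ)) := by
  obtain ⟨c, -, hc⟩ := exists_linSubst_section b
  intro P
  induction P using MvPolynomial.induction_on with
  | C r => exact ⟨C r, by simp [linSubst]⟩
  | add p q hp hq =>
    obtain ⟨p, rfl⟩ := hp
    obtain ⟨q, rfl⟩ := hq
    exact ⟨p + q, map_add _ _ _⟩
  | mul_X p s hp =>
    obtain ⟨p, rfl⟩ := hp
    refine ⟨p * ∑ i, C (c i s) * X i, ?_⟩
    rw [map_mul, ← hc s, map_sum]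
    congr 1
    refine Finset.sum_congr rfl fun i _ => ?_
    rw [map_mul]
    simp [linSubst]

theorem exists_sum_of_forall_eq_zero [Fintype κ] {l : κ → ι → ℂ} {m : ι → ℂ}
    (h : ∀ z : ι → ℂ, (∀ k, ∑ i, l k i * z i = 0) → ∑ i, m i * z i = 0) :
    ∃ a : κ → ℂ, ∀ i, m i = ∑ k, a k * l k i := by
  classical
  have := mem_span_of_iInf_ker_le_ker (𝕜 := ℂ) (L := fun k => Fintype.linearCombination ℂ (l k))
    (K := Fintype.linearCombination ℂ m) (fun z hz => by
      simp only [Submodule.mem_iInf, LinearMap.mem_ker, Fintype.linearCombination_apply,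
        smul_eq_mul] at hz ⊢
      simpa [mul_comm] using h z fun k => by simpa [mul_comm] using hz k)
  rw [Submodule.mem_span_range_iff_exists_fun] at this
  obtain ⟨a, ha⟩ := this
  refine ⟨a, fun i => ?_⟩
  have := LinearMap.congr_fun ha (Pi.single i 1)
  simpa [LinearMap.sum_apply, Fintype.linearCombination_apply_single] using this.symm

theorem ker_linSubst [Fintype κ] {l : κ → ι → ℂ} (hV : ∀ z, z ∈ V ↔ ∀ k, ∑ i, l k i * z i = 0) :
    RingHom.ker (linSubst fun s => (b s : ι → ℂ)) =
      Ideal.span (Set.range fun k => linForm (l k)) := by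
  classical
  apply le_antisymm
  · obtain ⟨c, hc, -⟩ := exists_linSubst_section b
    have hX : ∀ i, (X i : MvPolynomial ι ℂ) - ∑ s, C ((b s : ι → ℂ) i) * linForm (fun i' => c i' s) ∈
        Ideal.span (Set.range fun k => linForm (l k)) := by
      intro i
      have h1 : (X i : MvPolynomial ι ℂ) -
          ∑ s, C ((b s : ι → ℂ) i) * linForm (fun i' => c i' s) =
          linForm (fun i' => (if i' = i then 1 else 0) - ∑ s, (b s : ι → ℂ) i * c i' s) := by
        refine MvPolynomial.funext fun z => ?_
        simp only [map_sub, eval_X, map_sum, map_mul, eval_C, eval_linForm, sub_mul, ite_mul,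
          one_mul, zero_mul, Finset.sum_sub_distrib, Finset.sum_ite_eq', Finset.mem_univ, if_true,
          Finset.mul_sum, Finset.sum_mul]
        rw [Finset.sum_comm]
        simp only [mul_assoc]
      rw [h1]
      obtain ⟨a, ha⟩ := exists_sum_of_forall_eq_zero (l := l)
        (m := fun i' => (if i' = i then 1 else 0) - ∑ s, (b s : ι → ℂ) i * c i' s) (fun z hz => by
          have h3 := hc z ((hV z).2 hz) i
          have h4 := congrArg (eval z) h1
          rw [eval_linForm] at h4
          rw [← h4]
          simp only [map_sub, eval_X, map_sum, map_mul, eval_C, eval_linForm]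
          rw [← h3, sub_self])
      have h5 : linForm (fun i' => (if i' = i then 1 else 0) - ∑ s, (b s : ι → ℂ) i * c i' s) =
          ∑ k, C (a k) * linForm (l k) := by
        refine MvPolynomial.funext fun z => ?_
        simp only [eval_linForm, ha, map_sum, map_mul, eval_C, Finset.mul_sum, Finset.sum_mul]
        rw [Finset.sum_comm]
        simp only [mul_assoc]
      rw [h5]
      exact sum_mem fun k _ => Ideal.mul_mem_left _ _ (Ideal.subset_span ⟨k, rfl⟩)
    have hP : ∀ P : MvPolynomial ι ℂ, P - aeval (fun s => linForm fun i => c i s)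
        (linSubst (fun s => (b s : ι → ℂ)) P) ∈ Ideal.span (Set.range fun k => linForm (l k)) := by
      intro P
      rw [← Ideal.Quotient.eq]
      have : (Ideal.Quotient.mkₐ ℂ (Ideal.span (Set.range fun k => linForm (l k)))) =
        (Ideal.Quotient.mkₐ ℂ (Ideal.span (Set.range fun k => linForm (l k)))).comp
          ((aeval (fun s => linForm fun i => c i s)).comp (linSubst (fun s => (b s : ι → ℂ)))) := by
        refine algHom_ext fun i => ?_
        rw [AlgHom.comp_apply, AlgHom.comp_apply, linSubst_X, linForm, map_sum]
        simp only [map_mul, algHom_C, algebraMap_eq, aeval_X]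
        simpa only [map_sum, map_mul, Ideal.Quotient.mkₐ_eq_mk] using Ideal.Quotient.eq.2 (hX i)
      exact DFunLike.congr_fun this P
    intro P h0
    rw [RingHom.mem_ker] at h0
    simpa [h0] using hP P
  · rw [Ideal.span_le]
    rintro _ ⟨k, rfl⟩
    rw [SetLike.mem_coe, RingHom.mem_ker]
    refine MvPolynomial.funext fun y => ?_
    rw [eval_linSubst, eval_linForm, map_zero]
    have : (fun i => ∑ s, (b s : ι → ℂ) i * y s) = ((∑ s, y s • b s : V) : ι → ℂ) := by
      funext i
      simp [Submodule.coe_sum, mul_comm]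
    have h2 := (hV _).1 (Submodule.coe_mem (∑ s, y s • b s)) k
    rwa [← this] at h2

end SubspaceIdeal

section SplitForm

variable {σ : Type*}

/-- A form of degree `d` is a product of two forms of positive degree. -/
def IsSplitForm {R : Type*} [CommRing R] (d : ℕ) (h : MvPolynomial σ R) : Prop :=
  ∃ (a b : ℕ) (f g : MvPolynomial σ R), 0 < a ∧ 0 < b ∧ a + b = d ∧
    f.IsHomogeneous a ∧ g.IsHomogeneous b ∧ h = f * g

theorem isSplitForm_zero {R : Type*} [CommRing R] {d : ℕ} (hd : 2 ≤ d) :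
    IsSplitForm d (0 : MvPolynomial σ R) :=
  ⟨1, d - 1, 0, 0, one_pos, by omega, by omega, isHomogeneous_zero _ _ _, isHomogeneous_zero _ _ _,
    (mul_zero _).symm⟩

theorem homogeneousComponent_mul_of_totalDegree_le {R : Type*} [CommRing R]
    {f g : MvPolynomial σ R} {a b : ℕ} (hf : f.totalDegree ≤ a) (hg : g.totalDegree ≤ b) :
    homogeneousComponent (a + b) (f * g) = homogeneousComponent a f * homogeneousComponent b g := by
  conv_lhs => rw [← sum_homogeneousComponent f, Finset.sum_mul, map_sum]
  have h : ∀ i ∈ Finset.range (f.totalDegree + 1),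
      homogeneousComponent (a + b) (homogeneousComponent i f * g) =
      if i = a then homogeneousComponent a f * homogeneousComponent b g else 0 := by
    intro i hi
    rw [Finset.mem_range] at hi
    rw [show a + b = i + (a - i + b) by omega,
      homogeneousComponent_mul (homogeneousComponent_isHomogeneous i f)]
    split_ifs with h
    · subst h
      simp
    · rw [homogeneousComponent_eq_zero _ g (by omega), mul_zero]
  rw [Finset.sum_congr rfl h, Finset.sum_ite_eq']
  split_ifs with hb
  · rfl
  · rw [homogeneousComponent_eq_zero _ f (by simpa using hb), zero_mul]

variable {K : Type*} [Field K]

theorem isUnit_of_totalDegree_eq_zero {f : MvPolynomial σ K} (h0 : f ≠ 0) (h : f.totalDegree = 0) :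
    IsUnit f := by
  rw [totalDegree_eq_zero_iff_eq_C] at h
  rw [h]
  refine (IsUnit.mk0 _ fun h1 => h0 ?_).map C
  rw [h, h1, C_0]

theorem isSplitForm_of_eq_mul {d : ℕ} {h f g : MvPolynomial σ K} (hh : h.IsHomogeneous d)
    (h0 : h ≠ 0) (hfg : h = f * g) (hf : ¬ IsUnit f) (hg : ¬ IsUnit g) : IsSplitForm d h := by
  have hf0 : f ≠ 0 := by
    rintro rfl
    exact h0 (by rw [hfg, zero_mul])
  have hg0 : g ≠ 0 := by
    rintro rfl
    exact h0 (by rw [hfg, mul_zero])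
  have hdeg : f.totalDegree + g.totalDegree = d := by
    rw [← totalDegree_mul_of_isDomain hf0 hg0, ← hfg, hh.totalDegree h0]
  refine ⟨f.totalDegree, g.totalDegree, homogeneousComponent f.totalDegree f,
    homogeneousComponent g.totalDegree g, Nat.pos_of_ne_zero fun h =>
      hf (isUnit_of_totalDegree_eq_zero hf0 h), Nat.pos_of_ne_zero fun h =>
      hg (isUnit_of_totalDegree_eq_zero hg0 h), hdeg, homogeneousComponent_isHomogeneous _ _,
    homogeneousComponent_isHomogeneous _ _, ?_⟩
  rw [← homogeneousComponent_mul_of_totalDegree_le le_rfl le_rfl, hdeg, ← hfg,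
    homogeneousComponent_of_mem hh, if_pos rfl]

theorem prime_of_not_isSplitForm [Finite σ] {d : ℕ} (hd : 2 ≤ d) {h : MvPolynomial σ K}
    (hh : h.IsHomogeneous d) (hs : ¬ IsSplitForm d h) : Prime h := by
  have h0 : h ≠ 0 := by
    rintro rfl
    exact hs (isSplitForm_zero hd)
  rw [← irreducible_iff_prime]
  refine ⟨fun hu => ?_, fun f g hfg => ?_⟩
  · rw [MvPolynomial.isUnit_iff_totalDegree_of_isReduced] at hu
    rw [hh.totalDegree h0] at hu
    omega
  · by_contra! hc
    exact hs (isSplitForm_of_eq_mul hh h0 hfg hc.1 hc.2)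

theorem isSplitForm_of_forall_eval_eq_zero [Finite σ] [IsAlgClosed K] {d e : ℕ} (hed : e < d)
    (he : 0 < e) (hd : 2 ≤ d)
    {f q : MvPolynomial σ K} (hf : f.IsHomogeneous d) (hq : q.IsHomogeneous e)
    (h : ∀ z, eval z q = 0 → eval z f = 0) : IsSplitForm d f := by
  by_cases hf0 : f = 0
  · rw [hf0]
    exact isSplitForm_zero hd
  have hq0 : q ≠ 0 := by
    rintro rfl
    have : Infinite K := IsAlgClosed.instInfinite
    exact hf0 (MvPolynomial.funext fun z => by simpa using h z (by simp))
  have hqu : ¬ IsUnit q := fun hu => by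
    rw [MvPolynomial.isUnit_iff_totalDegree_of_isReduced, hq.totalDegree hq0] at hu
    omega
  obtain ⟨p, hp, m, rfl⟩ := WfDvdMonoid.exists_irreducible_factor hqu hq0
  have hpf : p ∣ f := by
    have := (Ideal.span_singleton_prime hp.ne_zero).2 (irreducible_iff_prime.1 hp)
    rw [← Ideal.mem_span_singleton,
      ← IsPrime.vanishingIdeal_zeroLocus (K := K) (Ideal.span {p}), mem_vanishingIdeal_iff]
    intro z hz
    rw [mem_zeroLocus_iff] at hz
    have h1 : eval z p = 0 := by simpa using hz p (Ideal.mem_span_singleton_self p)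
    simpa using h z (by rw [map_mul, h1, zero_mul])
  obtain ⟨g, rfl⟩ := hpf
  refine isSplitForm_of_eq_mul hf hf0 rfl hp.not_isUnit fun hg => ?_
  rw [MvPolynomial.isUnit_iff_totalDegree_of_isReduced] at hg
  have h1 := hf.totalDegree hf0
  have h2 := hq.totalDegree hq0
  rw [totalDegree_mul_of_isDomain (left_ne_zero_of_mul hf0) (right_ne_zero_of_mul hf0)] at h1
  rw [totalDegree_mul_of_isDomain (left_ne_zero_of_mul hq0) (right_ne_zero_of_mul hq0)] at h2
  omega

end SplitForm

section LinearForms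

theorem exists_eq_sum_linForm_mul {ι κ : Type*} [Fintype ι] [Fintype κ] {l : κ → ι → ℂ}
    {f : MvPolynomial ι ℂ} {d : ℕ} (hf : f.IsHomogeneous (d + 1))
    (h : ∀ z : ι → ℂ, (∀ k, ∑ i, l k i * z i = 0) → eval z f = 0) :
    ∃ m : κ → MvPolynomial ι ℂ, (∀ k, (m k).IsHomogeneous d) ∧ f = ∑ k, linForm (l k) * m k := by
  let V : Submodule ℂ (ι → ℂ) := ⨅ k, LinearMap.ker (Fintype.linearCombination ℂ (l k))
  have hV : ∀ z, z ∈ V ↔ ∀ k, ∑ i, l k i * z i = 0 := by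
    intro z
    simp [V, Submodule.mem_iInf, Fintype.linearCombination_apply, mul_comm]
  have hf0 : f ∈ RingHom.ker (linSubst fun s => (Module.finBasis ℂ V s : ι → ℂ)) := by
    rw [RingHom.mem_ker]
    refine MvPolynomial.funext fun y => ?_
    rw [eval_linSubst, map_zero]
    have : (fun i => ∑ s, (Module.finBasis ℂ V s : ι → ℂ) i * y s) =
        ((∑ s, y s • Module.finBasis ℂ V s : V) : ι → ℂ) := by
      funext i
      simp [Submodule.coe_sum, mul_comm]
    rw [this]
    exact h _ ((hV _).1 (Submodule.coe_mem _))
  rw [ker_linSubst _ hV, Ideal.mem_span_range_iff_exists_fun] at hf0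
  obtain ⟨c, hc⟩ := hf0
  refine ⟨fun k => homogeneousComponent d (c k), fun k => homogeneousComponent_isHomogeneous _ _, ?_⟩
  have h1 := congrArg (homogeneousComponent (d + 1)) hc
  rw [homogeneousComponent_of_mem hf, if_pos rfl, map_sum] at h1
  rw [← h1]
  refine Finset.sum_congr rfl fun k _ => ?_
  rw [mul_comm, add_comm, homogeneousComponent_mul (isHomogeneous_linForm _)]

theorem rankOn_le {n r : ℕ} {q : MvPolynomial (Fin n) ℂ} {A : Set (Fin n → ℂ)}
    (l : Fin r → (Fin n → ℂ) →ₗ[ℂ] ℂ) (h : ∀ z ∈ A, eval z q = ∑ i, l i z ^ 2) :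
    rankOn q A ≤ r :=
  Nat.sInf_le ⟨l, h⟩

theorem exists_linearMap_of_isHomogeneous_one {ι : Type*} [Fintype ι] {m : MvPolynomial ι ℂ}
    (hm : m.IsHomogeneous 1) : ∃ L : (ι → ℂ) →ₗ[ℂ] ℂ, ∀ z, eval z m = L z := by
  refine ⟨Fintype.linearCombination ℂ fun i => coeff (Finsupp.single i 1) m, fun z => ?_⟩
  conv_lhs => rw [isHomogeneous_one_eq_sum hm]
  simp [Fintype.linearCombination_apply, mul_comm]

theorem rankOn_le_add_two {n r : ℕ} {κ : Type*} [Fintype κ] {q : MvPolynomial (Fin n) ℂ}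
    (hq : q.IsHomogeneous 2) {A : Set (Fin n → ℂ)} {l : κ → Fin n → ℂ}
    (hA : ∀ z ∈ A, ∀ k, ∑ i, l k i * z i = 0) (p : Fin n → ℂ)
    (L : Fin r → (Fin n → ℂ) →ₗ[ℂ] ℂ)
    (h : ∀ z, (∀ k, ∑ i, l k i * z i = 0) → ∑ i, p i * z i = 0 → eval z q = ∑ a, L a z ^ 2) :
    rankOn q A ≤ r + 2 := by
  classical
  let Lf : Fin r → MvPolynomial (Fin n) ℂ := fun a => linForm fun i => L a (Pi.single i 1)
  have hL : ∀ a z, eval z (Lf a) = L a z := by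
    intro a z
    simp only [Lf, eval_linForm]
    conv_rhs => rw [← Finset.univ_sum_single z]
    rw [map_sum]
    refine Finset.sum_congr rfl fun i _ => ?_
    have : (Pi.single i (z i) : Fin n → ℂ) = z i • Pi.single i 1 := by
      rw [← Pi.single_smul, smul_eq_mul, mul_one]
    rw [this, map_smul, smul_eq_mul, mul_comm]
  obtain ⟨m, hm, hf⟩ := exists_eq_sum_linForm_mul (l := fun k : Option κ => k.elim p l)
    (f := q - ∑ a, Lf a ^ 2) (d := 1)
    (hq.sub (IsHomogeneous.sum _ _ _ fun a _ => (isHomogeneous_linForm _).pow 2)) (fun z hz => by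
      simp only [map_sub, map_sum, map_pow, hL]
      rw [h z (fun k => hz (some k)) (hz none), sub_self])
  obtain ⟨N, hN⟩ := exists_linearMap_of_isHomogeneous_one (hm none)
  let P : (Fin n → ℂ) →ₗ[ℂ] ℂ := Fintype.linearCombination ℂ p
  have hP : ∀ z, P z = ∑ i, p i * z i := fun z => by
    simp [P, Fintype.linearCombination_apply, mul_comm]
  refine rankOn_le (Fin.append L ![(2⁻¹ : ℂ) • (P + N), (2⁻¹ * Complex.I) • (P - N)]) fun z hz => ?_
  rw [Fin.sum_univ_add]
  simp only [Fin.append_left, Fin.append_right, Fin.sum_univ_two, Matrix.cons_val_zero,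
    Matrix.cons_val_one, LinearMap.smul_apply, LinearMap.add_apply, LinearMap.sub_apply,
    smul_eq_mul]
  have h1 := congrArg (eval z) hf
  simp only [map_sub, map_sum, map_add, map_pow, hL, Fintype.sum_option, map_mul, eval_linForm,
    Option.elim_none, Option.elim_some, hA z hz, zero_mul, Finset.sum_const_zero, add_zero, hN]
    at h1
  rw [← hP] at h1
  linear_combination h1 + (4⁻¹ * (P z - N z) ^ 2) * (- Complex.I_sq)

end LinearForms

section Height

theorem eq_of_chain_of_mem_minimalPrimes {R : Type*} [CommRing R] [IsDomain R]
    [IsNoetherianRing R] {f : Fin 4 → R} {P₁ P₂ P₃ P₄ P : Ideal R} [P₁.IsPrime]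
    [P₂.IsPrime] [P₃.IsPrime] [P₄.IsPrime] (hP : P ∈ (Ideal.span (Set.range f)).minimalPrimes) (h₁ : P₁ ≠ ⊥)
    (h₂ : P₁ < P₂) (h₃ : P₂ < P₃) (h₄ : P₃ < P₄) (h : P₄ ≤ P) : P₄ = P := by
  have : P.IsPrime := hP.1.1
  by_contra hne
  have h5 : P₄ < P := lt_of_le_of_ne h hne
  have hle : P.height ≤ 4 := by
    refine (Ideal.height_le_card_of_mem_minimalPrimes_span (Set.finite_range f) hP).trans ?_
    have : (Set.range f).ncard ≤ 4 := by
      rw [← Set.image_univ]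
      exact (Set.ncard_image_le).trans (by simp [Set.ncard_univ])
    exact_mod_cast this
  have a0 := Ideal.height_strict_mono_of_isPrime (bot_lt_iff_ne_bot.2 h₁)
  have a1 := Ideal.height_strict_mono_of_isPrime h₂
  have a2 := Ideal.height_strict_mono_of_isPrime h₃
  have a3 := Ideal.height_strict_mono_of_isPrime h₄
  have a4 := Ideal.height_strict_mono_of_isPrime h5
  have b1 := Order.add_one_le_of_lt a0
  have b2 := Order.add_one_le_of_lt a1
  have b3 := Order.add_one_le_of_lt a2
  have b4 := Order.add_one_le_of_lt a3
  have b5 := Order.add_one_le_of_lt a4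
  have : (5 : ℕ∞) ≤ 4 := by
    calc (5 : ℕ∞) = 0 + 1 + 1 + 1 + 1 + 1 := by norm_num
      _ ≤ (⊥ : Ideal R).height + 1 + 1 + 1 + 1 + 1 := by gcongr; exact zero_le
      _ ≤ P₁.height + 1 + 1 + 1 + 1 := by gcongr
      _ ≤ P₂.height + 1 + 1 + 1 := by gcongr
      _ ≤ P₃.height + 1 + 1 := by gcongr
      _ ≤ P₄.height + 1 := by gcongr
      _ ≤ P.height := b5
      _ ≤ 4 := hle
  exact absurd this (by norm_num)

end Height

section Components

variable {ι : Type*} [Finite ι]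

theorem exists_mem_zeroLocus_of_notMem {Q : Ideal (MvPolynomial ι ℂ)} [hQ : Q.IsPrime]
    {f : MvPolynomial ι ℂ} (hf : f ∉ Q) :
    ∃ z : ι → ℂ, (∀ P ∈ Q, eval z P = 0) ∧ eval z f ≠ 0 := by
  by_contra! h
  apply hf
  rw [← MvPolynomial.IsPrime.vanishingIdeal_zeroLocus (K := ℂ) Q]
  rw [MvPolynomial.mem_vanishingIdeal_iff]
  intro z hz
  rw [MvPolynomial.mem_zeroLocus_iff] at hz
  simpa using h z fun P hP => by simpa using hz P hP

theorem isIrreducible_zeroLocus (Q : Ideal (MvPolynomial ι ℂ)) [hQ : Q.IsPrime] :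
    @IsIrreducible (ι → ℂ) (zariskiTopology _) {z | ∀ P ∈ Q, eval z P = 0} := by
  let : TopologicalSpace (ι → ℂ) := zariskiTopology _
  refine ⟨?_, ?_⟩
  · obtain ⟨z, hz, -⟩ := exists_mem_zeroLocus_of_notMem (Q := Q) (f := 1)
      (fun h => hQ.ne_top ((Ideal.eq_top_iff_one _).2 h))
    exact ⟨z, hz⟩
  · rw [isPreirreducible_iff_isClosed_union_isClosed]
    intro A B hA hB hAB
    by_contra! hcon
    obtain ⟨x, hx, hxA⟩ := Set.not_subset.1 hcon.1
    obtain ⟨y, hy, hyB⟩ := Set.not_subset.1 hcon.2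
    obtain ⟨F, hF, hFx⟩ := exists_poly_separating (φ := LinearMap.id) Function.injective_id hA hxA
    obtain ⟨G, hG, hGy⟩ := exists_poly_separating (φ := LinearMap.id) Function.injective_id hB hyB
    have : F * G ∈ Q := by
      by_contra hFG
      obtain ⟨z, hz, hne⟩ := exists_mem_zeroLocus_of_notMem hFG
      apply hne
      rcases hAB hz with h | h
      · rw [map_mul, show eval z F = 0 from hF z h, zero_mul]
      · rw [map_mul, show eval z G = 0 from hG z h, mul_zero]
    rcases hQ.mem_or_mem this with h | h
    · exact hFx (hx F h)
    · exact hGy (hy G h)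

theorem vanIdeal_mem_minimalPrimes {κ : Type*} {f : κ → MvPolynomial ι ℂ} {C Z : Set (ι → ℂ)}
    (hZ : Z = {z | ∀ k, eval z (f k) = 0}) (hC : IsIrredCompOf C Z) :
    vanIdeal LinearMap.id C ∈ (Ideal.span (Set.range f)).minimalPrimes := by
  obtain ⟨hCZ, hirr, hmax⟩ := hC
  refine ⟨⟨vanIdeal_isPrime _ hirr, ?_⟩, ?_⟩
  · rw [Ideal.span_le]
    rintro _ ⟨k, rfl⟩ z hz
    have := hCZ hz
    rw [hZ] at this
    exact this k
  · rintro Q ⟨hQ, hle⟩ hQC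
    have h1 : {z | ∀ P ∈ Q, eval z P = 0} = C := by
      refine hmax _ (fun z hz P hP => hQC hP z hz) ?_ (isIrreducible_zeroLocus Q)
      intro z hz
      rw [hZ]
      exact fun k => hz _ (hle (Ideal.subset_span ⟨k, rfl⟩))
    intro P hP
    by_contra hPQ
    obtain ⟨z, hz, hne⟩ := exists_mem_zeroLocus_of_notMem hPQ
    exact hne (hP z (h1 ▸ hz))

end Components

section QuadricSection

variable {N : ℕ}

theorem mem_ker_linSubst_iff {ι σ : Type*} [Finite ι] [Fintype σ] {V : Submodule ℂ (ι → ℂ)}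
    (b : Module.Basis σ ℂ V) {P : MvPolynomial ι ℂ} :
    P ∈ RingHom.ker (linSubst fun s => (b s : ι → ℂ)) ↔ ∀ z ∈ V, eval z P = 0 := by
  have key : ∀ y : σ → ℂ, (fun i => ∑ s, (b s : ι → ℂ) i * y s) =
      ((∑ s, y s • b s : V) : ι → ℂ) := by
    intro y
    funext i
    simp [Submodule.coe_sum, mul_comm]
  rw [RingHom.mem_ker]
  constructor
  · intro h z hz
    have h1 := congrArg (eval (b.repr ⟨z, hz⟩)) h
    rw [eval_linSubst, key, b.sum_repr, map_zero] at h1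
    exact h1
  · intro h
    refine MvPolynomial.funext fun y => ?_
    rw [eval_linSubst, key, map_zero]
    exact h _ (Submodule.coe_mem _)

instance isPrime_ker_linSubst {ι σ : Type*} [Fintype σ] (b : σ → ι → ℂ) :
    (RingHom.ker (linSubst b)).IsPrime :=
  RingHom.ker_isPrime (linSubst b)

theorem ker_linSubst_lt {ι σ τ : Type*} [Fintype ι] [Fintype σ] [Fintype τ]
    {V W : Submodule ℂ (ι → ℂ)} (b : Module.Basis σ ℂ V) (c : Module.Basis τ ℂ W) (h : W ≤ V)
    {P : MvPolynomial ι ℂ} (hP : ∀ z ∈ W, eval z P = 0) {z : ι → ℂ} (hz : z ∈ V)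
    (hne : eval z P ≠ 0) :
    RingHom.ker (linSubst fun s => (b s : ι → ℂ)) <
      RingHom.ker (linSubst fun s => (c s : ι → ℂ)) := by
  refine lt_of_le_of_ne (fun Q hQ => ?_) fun heq => ?_
  · rw [mem_ker_linSubst_iff] at hQ ⊢
    exact fun z hz => hQ z (h hz)
  · have : P ∈ RingHom.ker (linSubst fun s => (b s : ι → ℂ)) := by
      rw [heq]
      exact (mem_ker_linSubst_iff c).2 hP
    exact hne ((mem_ker_linSubst_iff b).1 this z hz)

def zeroSpace {ι κ : Type*} [Fintype ι] (l : κ → ι → ℂ) : Submodule ℂ (ι → ℂ) :=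
  ⨅ k, LinearMap.ker (Fintype.linearCombination ℂ (l k))

theorem mem_zeroSpace {ι κ : Type*} [Fintype ι] {l : κ → ι → ℂ} {z : ι → ℂ} :
    z ∈ zeroSpace l ↔ ∀ k, ∑ i, l k i * z i = 0 := by
  simp [zeroSpace, Submodule.mem_iInf, Fintype.linearCombination_apply, mul_comm]

theorem not_isSplitForm_linSubst {n : ℕ} {κ σ : Type*} [Fintype κ] [Fintype σ]
    {q : MvPolynomial (Fin n) ℂ} (hq : q.IsHomogeneous 2) {A : Set (Fin n → ℂ)}
    {l : κ → Fin n → ℂ} (hA : ∀ z ∈ A, ∀ k, ∑ i, l k i * z i = 0) (hr : 5 ≤ rankOn q A)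
    {V : Submodule ℂ (Fin n → ℂ)} (b : Module.Basis σ ℂ V) {p : Fin n → ℂ}
    (hV : ∀ z, (∀ k, ∑ i, l k i * z i = 0) → ∑ i, p i * z i = 0 → z ∈ V) :
    ¬ IsSplitForm 2 (linSubst (fun s => (b s : Fin n → ℂ)) q) := by
  rintro ⟨a, a', f, g, ha, ha', haa, hf, hg, hfg⟩
  obtain rfl : a = 1 := by omega
  obtain rfl : a' = 1 := by omega
  obtain ⟨F', hF'⟩ := linSubst_surjective b f
  obtain ⟨G', hG'⟩ := linSubst_surjective b g
  have hF : linSubst (fun s => (b s : Fin n → ℂ)) (homogeneousComponent 1 F') = f := by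
    rw [linSubst_homogeneousComponent, hF', homogeneousComponent_of_mem hf, if_pos rfl]
  have hG : linSubst (fun s => (b s : Fin n → ℂ)) (homogeneousComponent 1 G') = g := by
    rw [linSubst_homogeneousComponent, hG', homogeneousComponent_of_mem hg, if_pos rfl]
  obtain ⟨L, hL⟩ := exists_linearMap_of_isHomogeneous_one
    (homogeneousComponent_isHomogeneous 1 F')
  obtain ⟨L', hL'⟩ := exists_linearMap_of_isHomogeneous_one
    (homogeneousComponent_isHomogeneous 1 G')
  have hker : q - homogeneousComponent 1 F' * homogeneousComponent 1 G' ∈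
      RingHom.ker (linSubst fun s => (b s : Fin n → ℂ)) := by
    rw [RingHom.mem_ker, map_sub, map_mul, hF, hG, hfg, sub_self]
  rw [mem_ker_linSubst_iff] at hker
  have := rankOn_le_add_two hq hA p ![(2⁻¹ : ℂ) • (L + L'), (2⁻¹ * Complex.I) • (L - L')]
    fun z h1 h2 => by
      have := hker z (hV z h1 h2)
      rw [map_sub, map_mul, hL, hL', sub_eq_zero] at this
      simp only [Fin.sum_univ_two, Matrix.cons_val_zero,
        Matrix.cons_val_one, LinearMap.smul_apply, LinearMap.add_apply, LinearMap.sub_apply,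
        smul_eq_mul]
      linear_combination this + (4⁻¹ * (L z - L' z) ^ 2) * (- Complex.I_sq)
  omega

theorem exists_eq_of_span_ne {j : Fin N} {q₁ q₂ q₃ : MvPolynomial (Fin N) ℂ}
    (h1 : q₁.IsHomogeneous 1) (h2 : q₂.IsHomogeneous 2) (h3 : q₃.IsHomogeneous 3)
    (hq₁ : ∃ z : Fin N → ℂ, z j = 0 ∧ eval z q₁ ≠ 0)
    (hr : 5 ≤ rankOn q₂ {z | z j = 0 ∧ eval z q₁ = 0}) {C : Set (Fin N → ℂ)}
    (hC : IsIrredCompOf C {z | z j = 0 ∧ eval z q₁ = 0 ∧ eval z q₂ = 0 ∧ eval z q₃ = 0})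
    (hspan : (Submodule.span ℂ C : Set (Fin N → ℂ)) ≠ {z | z j = 0 ∧ eval z q₁ = 0}) :
    ∃ (h : Fin N → ℂ) (w a b c : MvPolynomial (Fin N) ℂ), w.IsHomogeneous 1 ∧
      a.IsHomogeneous 2 ∧ b.IsHomogeneous 2 ∧
      q₃ = q₂ * w + q₁ * a + linForm h * b + X j * c := by
  classical
  let l₁ : Fin N → ℂ := fun i => coeff (Finsupp.single i 1) q₁
  have hl₁ : ∀ z, eval z q₁ = ∑ i, l₁ i * z i := fun z => by
    conv_lhs => rw [isHomogeneous_one_eq_sum h1]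
    simp [l₁]
  have hl₀ : ∀ z : Fin N → ℂ, ∑ i, (Pi.single j 1 : Fin N → ℂ) i * z i = z j := fun z => by
    simp [Pi.single_apply]
  let W : Submodule ℂ (Fin N → ℂ) := zeroSpace ![Pi.single j 1, l₁]
  have hW : ∀ z, z ∈ W ↔ z j = 0 ∧ eval z q₁ = 0 := fun z => by
    simp [W, mem_zeroSpace, Fin.forall_fin_two, hl₀, hl₁, -Pi.single_apply]
  have hCW : Submodule.span ℂ C ≤ W := Submodule.span_le.2 fun z hz =>
    (hW z).2 ⟨(hC.1 hz).1, (hC.1 hz).2.1⟩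
  obtain ⟨t, htW, htC⟩ : ∃ t ∈ W, t ∉ Submodule.span ℂ C := by
    by_contra! hcon
    apply hspan
    ext z
    exact ⟨fun hz => (hW z).1 (hCW hz), fun hz => hcon z ((hW z).2 hz)⟩
  obtain ⟨f, hft, hfC⟩ := Submodule.exists_le_ker_of_notMem htC
  let h : Fin N → ℂ := fun i => f (Pi.single i 1)
  have hh : ∀ z, ∑ i, h i * z i = f z := fun z => by
    conv_rhs => rw [← Finset.univ_sum_single z]
    rw [map_sum]
    refine Finset.sum_congr rfl fun i _ => ?_
    rw [show (Pi.single i (z i) : Fin N → ℂ) = z i • Pi.single i 1 by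
      rw [← Pi.single_smul, smul_eq_mul, mul_one], map_smul, smul_eq_mul, mul_comm]
  let V₁ : Submodule ℂ (Fin N → ℂ) := zeroSpace fun _ : Unit => Pi.single j 1
  let V₃ : Submodule ℂ (Fin N → ℂ) := zeroSpace ![Pi.single j 1, l₁, h]
  have hV₁ : ∀ z, z ∈ V₁ ↔ z j = 0 := fun z => by
    simp only [V₁, mem_zeroSpace, hl₀, forall_const]
  have hV₃ : ∀ z, z ∈ V₃ ↔ z j = 0 ∧ eval z q₁ = 0 ∧ f z = 0 := fun z => by
    simp only [V₃, mem_zeroSpace, Fin.forall_fin_succ, Matrix.cons_val_zero, Matrix.cons_val_succ,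
      hl₀, ← hl₁, hh, IsEmpty.forall_iff, and_true]
  let b₁ := Module.finBasis ℂ V₁
  let b₂ := Module.finBasis ℂ W
  let b₃ := Module.finBasis ℂ V₃
  let ψ := linSubst fun s => (b₃ s : Fin N → ℂ)
  have hker : RingHom.ker ψ = Ideal.span (Set.range fun k =>
      linForm ((![Pi.single j 1, l₁, h] : Fin 3 → Fin N → ℂ) k)) :=
    ker_linSubst b₃ fun z => mem_zeroSpace
  have hns : ¬ IsSplitForm 2 (ψ q₂) :=
    not_isSplitForm_linSubst h2 (l := ![Pi.single j 1, l₁]) (p := h)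
      (fun z hz => mem_zeroSpace.1 ((hW z).2 hz)) hr b₃ fun z hz hz' =>
        (hV₃ z).2 ⟨((hW z).1 (mem_zeroSpace.2 hz)).1, ((hW z).1 (mem_zeroSpace.2 hz)).2,
          (hh z) ▸ hz'⟩
  have hψh : (ψ q₂).IsHomogeneous 2 := isHomogeneous_linSubst _ h2
  have hprime : Prime (ψ q₂) := prime_of_not_isSplitForm le_rfl hψh hns
  have : (Ideal.span {ψ q₂}).IsPrime := (Ideal.span_singleton_prime hprime.ne_zero).2 hprime
  let P₄ : Ideal (MvPolynomial (Fin N) ℂ) := (Ideal.span {ψ q₂}).comap ψ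
  let P := vanIdeal LinearMap.id C
  have hPmin : P ∈ (Ideal.span (Set.range ![X j, q₁, q₂, q₃])).minimalPrimes :=
    vanIdeal_mem_minimalPrimes (by
      ext z
      simp [Fin.forall_fin_succ]) hC
  have hq₂P : q₂ ∈ P := fun z hz => (hC.1 hz).2.2.1
  have hq₃P : q₃ ∈ P := fun z hz => (hC.1 hz).2.2.2
  have hkerP : RingHom.ker ψ ≤ P := by
    intro F hF z hz
    refine (mem_ker_linSubst_iff b₃).1 hF z ((hV₃ z).2 ⟨(hC.1 hz).1, (hC.1 hz).2.1, ?_⟩)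
    exact hfC (Submodule.subset_span hz)
  obtain ⟨z₁, hz₁, hz₁'⟩ := hq₁
  have hmem : ∀ F, F ∈ P₄ → ∃ w, F - q₂ * w ∈ RingHom.ker ψ := by
    intro F hF
    obtain ⟨u, hu⟩ := Ideal.mem_span_singleton.1 (Ideal.mem_comap.1 hF)
    obtain ⟨w, rfl⟩ := linSubst_surjective b₃ u
    refine ⟨w, ?_⟩
    rw [RingHom.mem_ker, map_sub, map_mul]
    exact sub_eq_zero.2 hu
  have heq : P₄ = P := by
    refine eq_of_chain_of_mem_minimalPrimes
      (P₁ := RingHom.ker (linSubst fun s => (b₁ s : Fin N → ℂ)))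
      (P₂ := RingHom.ker (linSubst fun s => (b₂ s : Fin N → ℂ)))
      (P₃ := RingHom.ker ψ) hPmin ?_ ?_ ?_ ?_ ?_
    · intro hbot
      have : (X j : MvPolynomial (Fin N) ℂ) ∈
          RingHom.ker (linSubst fun s => (b₁ s : Fin N → ℂ)) :=
        (mem_ker_linSubst_iff b₁).2 fun z hz => by simpa using (hV₁ z).1 hz
      rw [hbot, Ideal.mem_bot] at this
      exact X_ne_zero j this
    · exact ker_linSubst_lt b₁ b₂ (fun z hz => (hV₁ z).2 ((hW z).1 hz).1)
        (fun z hz => ((hW z).1 hz).2) ((hV₁ z₁).2 hz₁) hz₁'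
    · refine ker_linSubst_lt b₂ b₃ (P := linForm h)
        (fun z hz => (hW z).2 ⟨((hV₃ z).1 hz).1, ((hV₃ z).1 hz).2.1⟩) (fun z hz => ?_) htW ?_
      · rw [eval_linForm, hh]
        exact ((hV₃ z).1 hz).2.2
      · rw [eval_linForm, hh]
        exact hft
    · refine lt_of_le_of_ne (fun F hF => ?_) fun heq => ?_
      · rw [Ideal.mem_comap, (RingHom.mem_ker).1 hF]
        exact Ideal.zero_mem _
      · have : q₂ ∈ RingHom.ker ψ := by
          rw [heq]
          exact Ideal.mem_comap.2 (Ideal.mem_span_singleton_self _)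
        exact hprime.ne_zero this
    · intro F hF
      obtain ⟨w, hw⟩ := hmem F hF
      have := P.add_mem (hkerP hw) (P.mul_mem_right w hq₂P)
      simpa using this
  obtain ⟨w, hw⟩ := hmem q₃ (heq ▸ hq₃P)
  rw [hker, Ideal.mem_span_range_iff_exists_fun] at hw
  obtain ⟨c, hc⟩ := hw
  refine ⟨h, homogeneousComponent 1 w, homogeneousComponent 2 (c 1), homogeneousComponent 2 (c 2),
    homogeneousComponent 2 (c 0), homogeneousComponent_isHomogeneous _ _,
    homogeneousComponent_isHomogeneous _ _, homogeneousComponent_isHomogeneous _ _, ?_⟩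
  have hX : linForm (Pi.single j 1) = (X j : MvPolynomial (Fin N) ℂ) :=
    MvPolynomial.funext fun z => by rw [eval_linForm, hl₀, eval_X]
  have hq : linForm l₁ = q₁ := MvPolynomial.funext fun z => by rw [eval_linForm, hl₁]
  have h4 : q₃ = q₂ * w + (q₁ * c 1 + (linForm h * c 2 + X j * c 0)) := by
    rw [Fin.sum_univ_three] at hc
    simp only [Matrix.cons_val_zero, Matrix.cons_val_one, Matrix.cons_val_two, Matrix.head_cons,
      Matrix.tail_cons, hX, hq, Matrix.cons_val] at hc
    linear_combination -hc
  have h5 := congrArg (homogeneousComponent 3) h4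
  rw [homogeneousComponent_of_mem h3, if_pos rfl, map_add, map_add, map_add,
    show 3 = 2 + 1 from rfl, homogeneousComponent_mul h2, show 2 + 1 = 1 + 2 from rfl,
    homogeneousComponent_mul h1, homogeneousComponent_mul (isHomogeneous_linForm h),
    homogeneousComponent_mul (isHomogeneous_X _ j)] at h5
  rw [h5]
  ring

end QuadricSection

section TangentQuadric

theorem two_mul_choose_add_le_choose_three {M D : ℕ} (hM : 10 ≤ M)
    (hD : 2 * D ≤ (M - 6) * (M - 5)) :
    (M + 1).choose 2 + ((M + 1).choose 2 + 2 * M) + D ≤ (M + 2).choose 3 := by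
  obtain ⟨n, rfl⟩ : ∃ n, M = n + 10 := ⟨M - 10, by omega⟩
  have h3 : 6 * (n + 10 + 2).choose 3 = (n + 12) * (n + 11) * (n + 10) := by
    have := Nat.descFactorial_eq_factorial_mul_choose (n + 12) 3
    simp [Nat.descFactorial, Nat.factorial] at this
    rw [show n + 10 + 2 = n + 12 from rfl, ← this]
    ring
  have h2 : 2 * (n + 10 + 1).choose 2 = (n + 11) * (n + 10) := by
    have := Nat.descFactorial_eq_factorial_mul_choose (n + 11) 2
    simp [Nat.descFactorial, Nat.factorial] at this
    rw [show n + 10 + 1 = n + 11 from rfl, ← this]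
    ring
  rw [show n + 10 - 6 = n + 4 by omega, show n + 10 - 5 = n + 5 by omega] at hD
  nlinarith

theorem exists_linForm_eq {σ : Type*} [Fintype σ] {L : MvPolynomial σ ℂ} (hL : L.IsHomogeneous 1) :
    ∃ l, L = linForm l := ⟨_, isHomogeneous_one_eq_sum hL⟩

/-- Restriction of a polynomial to the coordinate hyperplane `z_j = 0`. -/
def restrictZero {N : ℕ} (j : Fin N) : MvPolynomial (Fin N) ℂ →ₐ[ℂ] MvPolynomial {i // i ≠ j} ℂ :=
  linSubst fun s i => if i = s then 1 else 0

theorem eval_restrictZero {N : ℕ} (j : Fin N) (w : {i // i ≠ j} → ℂ) (P : MvPolynomial (Fin N) ℂ) :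
    eval w (restrictZero j P) = eval (extZero j w) P := by
  rw [restrictZero, eval_linSubst]
  congr 2
  funext i
  by_cases h : i = j
  · subst h
    rw [extZero_self]
    refine Finset.sum_eq_zero fun s _ => ?_
    rw [if_neg (Ne.symm s.2), zero_mul]
  · rw [Finset.sum_eq_single ⟨i, h⟩]
    · simp [extZero, h]
    · intro s _ hs
      rw [if_neg, zero_mul]
      rintro rfl
      exact hs rfl
    · simp

theorem restrictZero_chartComp {N : ℕ} (k : ℕ) (G : MvPolynomial (Fin N) ℂ) (v : Fin N → ℂ)
    (j : Fin N) : restrictZero j (chartComp k G v j) = locComp k G v j :=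
  MvPolynomial.funext fun w => by rw [eval_restrictZero, eval_extZero_chartComp]

theorem exists_chartComp_one_ne_zero {N : ℕ} {G : MvPolynomial (Fin N) ℂ} {v : Fin N → ℂ}
    {j : Fin N} (h : chartComp 1 G v j ≠ 0) :
    ∃ z : Fin N → ℂ, z j = 0 ∧ eval z (chartComp 1 G v j) ≠ 0 := by
  by_contra! hcon
  apply h
  rw [← rename_locComp]
  have : locComp 1 G v j = 0 := MvPolynomial.funext fun w => by
    rw [map_zero, ← eval_extZero_chartComp]
    exact hcon _ (extZero_self j w)
  rw [this, map_zero]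

variable {M : ℕ} {j : Fin (M + 1)}

theorem exists_locComp_three_eq {G : MvPolynomial (Fin (M + 1)) ℂ} {v : Fin (M + 1) → ℂ}
    (h1 : chartComp 1 G v j ≠ 0) (hr : 6 ≤ rankOn (chartComp 2 G v j)
        {z : Fin (M + 1) → ℂ | z j = 0 ∧ MvPolynomial.eval z (chartComp 1 G v j) = 0})
    (h : ¬ ChartR12 G v j) : ∃ (l : Fin 2 → {i // i ≠ j} → ℂ) (m : Fin 2 → MvPolynomial _ ℂ),
      (∀ i, (m i).IsHomogeneous 2) ∧ locComp 3 G v j = locComp 2 G v j * linForm (l 0) +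
        locComp 1 G v j * m 0 + linForm (l 1) * m 1 := by
  rw [ChartR12, not_and] at h
  have h2 := h hr
  push Not at h2
  obtain ⟨C, hC, hspan⟩ := h2
  obtain ⟨p, w, a, b, c, hw, ha, hb, heq⟩ := exists_eq_of_span_ne (isHomogeneous_chartComp 1 G v j)
    (isHomogeneous_chartComp 2 G v j) (isHomogeneous_chartComp 3 G v j)
    (exists_chartComp_one_ne_zero h1) (by omega) hC hspan
  obtain ⟨l₀, hl₀⟩ := exists_linForm_eq (L := restrictZero j w) (isHomogeneous_linSubst _ hw)
  obtain ⟨l₁, hl₁⟩ := exists_linForm_eq (L := restrictZero j (linForm p))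
    (isHomogeneous_linSubst _ (isHomogeneous_linForm p))
  refine ⟨![l₀, l₁], ![restrictZero j a, restrictZero j b], ?_, ?_⟩
  · rw [Fin.forall_fin_two]
    exact ⟨isHomogeneous_linSubst _ ha, isHomogeneous_linSubst _ hb⟩
  · have := congrArg (restrictZero j) heq
    simp only [map_add, map_mul, restrictZero_chartComp, hl₀, hl₁] at this
    have hX : restrictZero j (X j) = 0 := MvPolynomial.funext fun w => by
      rw [eval_restrictZero, eval_X, extZero_self, map_zero]
    rw [hX, zero_mul, add_zero] at this
    simpa using this

variable {I : Type} (U : Ultrafilter I)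
  {G : I → MvPolynomial (Fin (M + 1)) ℂ} {v : I → Fin (M + 1) → ℂ} (S : Set (UPow U))

theorem dle_ultraComp_three_of_not_R12
    (hS : coeffSet (ultraComp U j G v 1) ⊆ S) (hS2 : coeffSet (ultraComp U j G v 2) ⊆ S)
    (h1 : ∀ᶠ a in (U : Filter I), chartComp 1 (G a) (v a) j ≠ 0)
    (hr : ∀ᶠ a in (U : Filter I), 6 ≤ rankOn (chartComp 2 (G a) (v a) j)
        {z | z j = 0 ∧ eval z (chartComp 1 (G a) (v a) j) = 0})
    (h : ∀ᶠ a in (U : Filter I), ¬ ChartR12 (G a) (v a) j) :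
    Dle ℂ S (coeffSet (ultraComp U j G v 3))
      ((M + 1).choose 2 + ((M + 1).choose 2 + 2 * M)) := by
  have hcard : Fintype.card {i // i ≠ j} = M := by simp [Fintype.card_subtype_compl]
  obtain ⟨l, hl⟩ := ((h1.and (hr.and h)).mono fun a ha =>
    exists_locComp_three_eq ha.1 ha.2.1 ha.2.2).choice
  obtain ⟨m, hlm⟩ := hl.choice
  let A : Fin 2 → MvPolynomial {i // i ≠ j} (UPow U) := fun i => ultraPoly U 2 fun a => m a i
  have hA : ∀ i, (A i).IsHomogeneous 2 := fun i => isHomogeneous_ultraPoly _ _ _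
  have h1 : ultraComp U j G v 3 = ultraComp U j G v 2 * linForm (fun i => toUPow U fun a => l a 0 i)
      + ultraComp U j G v 1 * A 0 + linForm (fun i => toUPow U fun a => l a 1 i) * A 1 := by
    rw [ultraComp_eq_map U (P := liftPoly 2 (fun a => locComp 2 (G a) (v a) j) *
      linForm (fun i a => l a 0 i) + liftPoly 1 (fun a => locComp 1 (G a) (v a) j) *
      liftPoly 2 (fun a => m a 0) + linForm (fun i a => l a 1 i) * liftPoly 2 fun a => m a 1)]
    · simp [map_linForm, ultraComp, ultraPoly, A]
    · refine hlm.mono fun a ha => ?_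
      rw [ha.2]
      simp only [map_add, map_mul, map_linForm]
      rw [map_liftPoly_locComp, map_liftPoly_locComp, map_liftPoly (p := fun a => m a 0) (ha.1 0),
        map_liftPoly (p := fun a => m a 1) (ha.1 1)]
      rfl
  have h2 := dle_coeffSet_of_mem_polyOver (k := ℂ) (S := S ∪ coeffSet (A 0) ∪ coeffSet (A 1))
    (P := ultraComp U j G v 3)
    (fun x : Fin 2 × {i // i ≠ j} => toUPow U fun a => l a x.1 x.2) (by
      have h3 : ∀ b i, (toUPow U fun a => l a b i) ∈ acl ℂ
          (S ∪ coeffSet (A 0) ∪ coeffSet (A 1) ∪ Set.range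
          (fun x : Fin 2 × {i // i ≠ j} => toUPow U fun a => l a x.1 x.2)) := fun b i =>
        subset_acl _ (Or.inr ⟨(b, i), rfl⟩)
      have hm : ∀ {P : MvPolynomial {i // i ≠ j} (UPow U)},
          coeffSet P ⊆ S ∪ coeffSet (A 0) ∪ coeffSet (A 1) → P ∈ polyOver _ (acl ℂ
          (S ∪ coeffSet (A 0) ∪ coeffSet (A 1) ∪ Set.range
          (fun x : Fin 2 × {i // i ≠ j} => toUPow U fun a => l a x.1 x.2))) := fun hP =>
        mem_polyOver_acl_of_coeffSet_subset (hP.trans Set.subset_union_left)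
      rw [h1]
      refine add_mem (add_mem (mul_mem (hm ?_) (linForm_mem_polyOver (h3 _)))
        (mul_mem (hm ?_) (hm ?_))) (mul_mem (linForm_mem_polyOver (h3 _)) (hm ?_))
      · exact fun x hx => Or.inl (Or.inl (hS2 hx))
      · exact fun x hx => Or.inl (Or.inl (hS hx))
      · exact fun x hx => Or.inl (Or.inr hx)
      · exact fun x hx => Or.inr hx)
  have h3 := (dle_coeffSet (k := ℂ) (S := S) (hA 0)).trans
    ((dle_coeffSet (k := ℂ) (S := S ∪ coeffSet (A 0)) (hA 1)).trans h2)
  refine h3.mono (k := ℂ) (subset_acl _) (fun x hx => subset_acl _ (Or.inr (Or.inr (Or.inr hx)))) ?_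
  simp [hcard, Fintype.card_subtype_compl]

theorem exists_dle_of_not_R12 (hM : 10 ≤ M) {D : ℕ} (hD : 2 * D ≤ (M - 6) * (M - 5))
    (h1 : ∀ᶠ a in (U : Filter I), chartComp 1 (G a) (v a) j ≠ 0)
    (hS : coeffSet (ultraComp U j G v 1) ⊆ S)
    (h : ∀ᶠ a in (U : Filter I), ¬ ChartR12 (G a) (v a) j) :
    ∃ e, Dle ℂ S (⋃ i < M - 1, coeffSet (ultraComp U j G v (i + 2))) e ∧ e + D ≤
      ∑ i ∈ Finset.range (M - 1), (M + (i + 2) - 1).choose (i + 2) := by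
  have hcard : Fintype.card {i // i ≠ j} = M := by simp [Fintype.card_subtype_compl]
  have h' : ∀ᶠ a in (U : Filter I), rankOn (chartComp 2 (G a) (v a) j)
      {z | z j = 0 ∧ eval z (chartComp 1 (G a) (v a) j) = 0} ≤ 5 ∨
      6 ≤ rankOn (chartComp 2 (G a) (v a) j)
        {z | z j = 0 ∧ eval z (chartComp 1 (G a) (v a) j) = 0} :=
    Filter.Eventually.of_forall fun a => by omega
  rw [Ultrafilter.eventually_or] at h'
  rcases h' with hr | hr
  · obtain ⟨e, he, hes⟩ := dle_ultraComp_two_of_rank_hyperplane (G := G) (v := v) (j := j) U S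
      (r := 5) (by omega) h1 hS hr
    have h2 : (M - 5).choose 2 = (M - 6) * (M - 5) / 2 := by
      rw [Nat.choose_two_right, mul_comm]
      congr 2
    have := exists_dle_iUnion_of_single (k := ℂ) (S := S) (m := M - 1)
      (Q := fun i => ultraComp U j G v (i + 2)) (fun i _ => isHomogeneous_ultraComp U _)
      (i₀ := 0) (by omega) (c := D) he (by
        rw [hcard]
        simp only [zero_add, Nat.add_succ_sub_one]
        omega)
    simpa only [hcard] using this
  · have h3 := dle_ultraComp_three_of_not_R12 U (S ∪ coeffSet (ultraComp U j G v 2))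
      (hS.trans Set.subset_union_left) Set.subset_union_right h1 hr h
    have := exists_dle_iUnion_of_single_of_lt (k := ℂ) (S := S) (m := M - 1)
      (Q := fun i => ultraComp U j G v (i + 2)) (fun i _ => isHomogeneous_ultraComp U _)
      (i₀ := 1) (by omega) (c := D) (by simpa using h3) (by
        rw [hcard]
        exact two_mul_choose_add_le_choose_three hM hD)
    simpa only [hcard] using this

end TangentQuadric

section Filtration

open Polynomial in
theorem coeff_mul_eq_top {R : Type*} [CommRing R] {p q : R[X]} {D α : ℕ}
    (hp : ∀ n, D < n + α → p.coeff n = 0) (hq : q.natDegree ≤ α) :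
    (p * q).coeff D = (if α ≤ D then p.coeff (D - α) else 0) * q.coeff α := by
  split_ifs with h
  · have hpd : p.natDegree ≤ D - α :=
      natDegree_le_iff_coeff_eq_zero.2 fun n hn => hp n (by omega)
    have := coeff_mul_add_eq_of_natDegree_le hpd hq
    rwa [Nat.sub_add_cancel h] at this
  · have : p = 0 := Polynomial.ext fun n => by rw [hp n (by omega), Polynomial.coeff_zero]
    rw [this, zero_mul, zero_mul, Polynomial.coeff_zero]

variable {A : Type*} [CommRing A] [IsDomain A] (φ : A →+* Polynomial A)

theorem map_eq_monomial_coeff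
    (hφ : ∀ f d, φ ((φ f).coeff d) = Polynomial.monomial d ((φ f).coeff d))
    {f : A} {d : ℕ} (h : φ f = Polynomial.monomial d f) (c : A) {D : ℕ} :
    (φ (c * f)).coeff D = (if d ≤ D then (φ c).coeff (D - d) else 0) * f := by
  rw [map_mul, h, ← Polynomial.C_mul_X_pow_eq_monomial, ← mul_assoc, Polynomial.coeff_mul_X_pow',
    Polynomial.coeff_mul_C]
  split_ifs <;> simp

theorem coeff_mem_of_mem_span_pair_aux
    (hφ : ∀ f d, φ ((φ f).coeff d) = Polynomial.monomial d ((φ f).coeff d))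
    {a b : A} {α β : ℕ} (ha : (φ a).natDegree ≤ α)
    (hb : (φ b).natDegree ≤ β) (hprime : Prime ((φ b).coeff β))
    (hndvd : ¬ (φ b).coeff β ∣ (φ a).coeff α) (d k : ℕ) :
    ∀ u v : A, (∀ n, d + k < n + α → (φ u).coeff n = 0) →
      (∀ n, d + k < n + β → (φ v).coeff n = 0) → (φ (u * a + v * b)).natDegree ≤ d →
      (φ (u * a + v * b)).coeff d ∈ Ideal.span {(φ a).coeff α, (φ b).coeff β} := by
  induction k with
  | zero =>
    intro u v hu hv _
    rw [add_zero] at hu hv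
    rw [map_add, map_mul, map_mul, Polynomial.coeff_add, coeff_mul_eq_top hu ha,
      coeff_mul_eq_top hv hb]
    exact Ideal.mem_span_pair.2 ⟨_, _, rfl⟩
  | succ k ih =>
    intro u v hu hv hd
    set a₀ := (φ a).coeff α with ha₀
    set b₀ := (φ b).coeff β with hb₀
    have hb₀' : φ b₀ = Polynomial.monomial β b₀ := hφ b β
    have htop : (φ (u * a + v * b)).coeff (d + (k + 1)) = 0 :=
      Polynomial.coeff_eq_zero_of_natDegree_lt (by omega)
    rw [map_add, map_mul, map_mul, Polynomial.coeff_add, coeff_mul_eq_top hu ha,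
      coeff_mul_eq_top hv hb, ← ha₀, ← hb₀] at htop
    set D := d + (k + 1) with hD
    set ut := if α ≤ D then (φ u).coeff (D - α) else 0 with hut
    set vt := if β ≤ D then (φ v).coeff (D - β) else 0 with hvt
    have hdvd : b₀ ∣ ut := by
      have h1 : b₀ ∣ ut * a₀ := ⟨-vt, by linear_combination htop⟩
      exact (hprime.dvd_or_dvd h1).resolve_right hndvd
    obtain ⟨c, hc⟩ := hdvd
    obtain ⟨c', hc', hc''⟩ : ∃ c', ut = c' * b₀ ∧ ((α + β ≤ D ∧
        φ c' = Polynomial.monomial (D - α - β) c') ∨ c' = 0) := by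
      by_cases hα : α ≤ D
      · rw [if_pos hα] at hut
        have h1 : (φ (c * b₀)).coeff (D - α) = ut := by
          have := hφ u (D - α)
          rw [mul_comm, ← hc, hut, this, Polynomial.coeff_monomial, if_pos rfl]
        rw [map_eq_monomial_coeff φ hφ hb₀' c] at h1
        split_ifs at h1 with hβ
        · exact ⟨_, h1.symm, Or.inl ⟨by omega, hφ _ _⟩⟩
        · exact ⟨0, h1.symm, Or.inr rfl⟩
      · rw [if_neg hα] at hut
        exact ⟨0, by rw [hut, zero_mul], Or.inr rfl⟩
    have hvt' : vt = - (c' * a₀) := by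
      refine mul_right_cancel₀ hprime.ne_zero ?_
      rw [hc'] at htop
      linear_combination htop
    have hlt : ∀ {s : A} {γ δ : ℕ}, (φ s).natDegree ≤ γ → γ + δ = α + β → ∀ n, D < n + δ →
        (φ (c' * s)).coeff n = 0 := by
      intro s γ δ hs hγ n hn
      rcases hc'' with ⟨h1, h2⟩ | h2
      · rw [map_mul, h2]
        refine Polynomial.coeff_eq_zero_of_natDegree_lt
          ((Polynomial.natDegree_mul_le_of_le (Polynomial.natDegree_monomial_le _) hs).trans_lt ?_)
        omega
      · rw [h2, zero_mul, map_zero, Polynomial.coeff_zero]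
    have heq : ∀ {s : A} {γ δ : ℕ}, (φ s).natDegree ≤ γ → γ + δ = α + β → ∀ n, D = n + δ →
        (φ (c' * s)).coeff n = c' * (φ s).coeff γ := by
      intro s γ δ hs hγ n hn
      rcases hc'' with ⟨h1, h2⟩ | h2
      · rw [map_mul, h2, show n = γ + (D - α - β) by omega, Polynomial.coeff_monomial_mul]
      · rw [h2, zero_mul, map_zero, Polynomial.coeff_zero, zero_mul]
    have h3 : u * a + v * b = (u - c' * b) * a + (v + c' * a) * b := by ring
    rw [h3] at hd ⊢
    refine ih _ _ (fun n hn => ?_) (fun n hn => ?_) hd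
    · rw [map_sub, Polynomial.coeff_sub]
      rcases lt_or_eq_of_le (show D ≤ n + α by omega) with h | h
      · rw [hu n h, hlt hb (add_comm _ _) n h, sub_zero]
      · rw [heq hb (add_comm _ _) n h, ← hb₀, ← hc', hut, if_pos (by omega), h,
          Nat.add_sub_cancel, sub_self]
    · rw [map_add, Polynomial.coeff_add]
      rcases lt_or_eq_of_le (show D ≤ n + β by omega) with h | h
      · rw [hv n h, hlt ha rfl n h, zero_add]
      · have : (φ v).coeff n = vt := by rw [hvt, if_pos (by omega), h, Nat.add_sub_cancel]
        rw [heq ha rfl n h, ← ha₀, this, hvt', neg_add_cancel]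

theorem coeff_mem_of_mem_span_pair
    (hφ : ∀ f d, φ ((φ f).coeff d) = Polynomial.monomial d ((φ f).coeff d))
    {a b : A} {α β : ℕ} (ha : (φ a).natDegree ≤ α)
    (hb : (φ b).natDegree ≤ β) (hprime : Prime ((φ b).coeff β))
    (hndvd : ¬ (φ b).coeff β ∣ (φ a).coeff α) {f : A} (hf : f ∈ Ideal.span {a, b}) {d : ℕ}
    (hd : (φ f).natDegree ≤ d) :
    (φ f).coeff d ∈ Ideal.span {(φ a).coeff α, (φ b).coeff β} := by
  obtain ⟨u, v, rfl⟩ := Ideal.mem_span_pair.1 hf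
  refine coeff_mem_of_mem_span_pair_aux φ hφ ha hb hprime hndvd d
    ((φ u).natDegree + (φ v).natDegree + α + β) u v (fun n hn => ?_) (fun n hn => ?_) hd
  · exact Polynomial.coeff_eq_zero_of_natDegree_lt (by omega)
  · exact Polynomial.coeff_eq_zero_of_natDegree_lt (by omega)

theorem exists_sub_mem_coeff_notMem
    (hφ : ∀ f d, φ ((φ f).coeff d) = Polynomial.monomial d ((φ f).coeff d))
    (hinj : Function.Injective φ)
    {a b : A} {α β : ℕ} (ha : (φ a).natDegree ≤ α)
    (hb : (φ b).natDegree ≤ β) (n : ℕ) : ∀ f, f ∉ Ideal.span {a, b} →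
      (∀ m, n ≤ m → (φ f).coeff m = 0) → ∃ f' d, f - f' ∈ Ideal.span {a, b} ∧
        (φ f').natDegree ≤ d ∧
        (φ f').coeff d ∉ Ideal.span {(φ a).coeff α, (φ b).coeff β} := by
  induction n with
  | zero =>
    intro f hf h
    have : f = 0 := hinj (by
      rw [map_zero]
      exact Polynomial.ext fun n => by rw [h n (Nat.zero_le _), Polynomial.coeff_zero])
    exact absurd (this ▸ Ideal.zero_mem _) hf
  | succ n ih =>
    intro f hf h
    by_cases hJ : (φ f).coeff n ∈ Ideal.span {(φ a).coeff α, (φ b).coeff β}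
    · have hcomp : ∀ {s : A} {γ : ℕ}, (φ s).natDegree ≤ γ → ∀ x : A, ∃ x' : A,
          (φ (x * (φ s).coeff γ)).coeff n = x' * (φ s).coeff γ ∧
          (φ (x' * s)).coeff n = x' * (φ s).coeff γ ∧
          ∀ m, n < m → (φ (x' * s)).coeff m = 0 := by
        intro s γ hs x
        refine ⟨if γ ≤ n then (φ x).coeff (n - γ) else 0,
          map_eq_monomial_coeff φ hφ (hφ s γ) x, ?_⟩
        split_ifs with hγ
        · have h1 := hφ x (n - γ)
          have h2 := Polynomial.natDegree_monomial_le (m := n - γ) ((φ x).coeff (n - γ))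
          rw [map_mul, h1]
          refine ⟨?_, fun m hm => Polynomial.coeff_eq_zero_of_natDegree_lt
            ((Polynomial.natDegree_mul_le_of_le h2 hs).trans_lt (by omega))⟩
          have := Polynomial.coeff_mul_add_eq_of_natDegree_le h2 hs
          rwa [Nat.sub_add_cancel hγ, Polynomial.coeff_monomial, if_pos rfl] at this
        · simp
      obtain ⟨x, y, hxy⟩ := Ideal.mem_span_pair.1 hJ
      obtain ⟨x', hx1, hx2, hx3⟩ := hcomp ha x
      obtain ⟨y', hy1, hy2, hy3⟩ := hcomp hb y
      have hmem : x' * a + y' * b ∈ Ideal.span {a, b} := Ideal.mem_span_pair.2 ⟨_, _, rfl⟩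
      obtain ⟨f', d, h1, h2⟩ := ih (f - (x' * a + y' * b))
        (fun hcon => hf (by simpa using add_mem hcon hmem)) (fun m hm => by
          rw [map_sub, map_add, Polynomial.coeff_sub, Polynomial.coeff_add]
          rcases lt_or_eq_of_le hm with hm | rfl
          · rw [h m hm, hx3 m hm, hy3 m hm, add_zero, sub_zero]
          · have h5 := congrArg (fun z => (φ z).coeff n) hxy
            simp only [map_add, Polynomial.coeff_add, hx1, hy1, hφ f n,
              Polynomial.coeff_monomial, if_true] at h5
            rw [hx2, hy2, h5, sub_self])
      refine ⟨f', d, ?_, h2⟩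
      have := add_mem h1 hmem
      rwa [show f - (x' * a + y' * b) - f' + (x' * a + y' * b) = f - f' by ring] at this
    · exact ⟨f, n, by simp, Polynomial.natDegree_le_iff_coeff_eq_zero.2 fun m hm => h m hm, hJ⟩

/-- An ideal generated by two elements is prime as soon as the ideal generated by their leading
forms is prime and the leading forms are a regular sequence. -/
theorem isPrime_span_pair_of_coeff
    (hφ : ∀ f d, φ ((φ f).coeff d) = Polynomial.monomial d ((φ f).coeff d))
    (hinj : Function.Injective φ)
    {a b : A} {α β : ℕ} (ha : (φ a).natDegree ≤ α)
    (hb : (φ b).natDegree ≤ β) (hprime : Prime ((φ b).coeff β))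
    (hndvd : ¬ (φ b).coeff β ∣ (φ a).coeff α)
    (hJ : (Ideal.span {(φ a).coeff α, (φ b).coeff β}).IsPrime) : (Ideal.span {a, b}).IsPrime := by
  refine ⟨fun htop => ?_, fun {f g} hfg => ?_⟩
  · have := coeff_mem_of_mem_span_pair φ hφ ha hb hprime hndvd
      ((Ideal.eq_top_iff_one _).1 htop) (d := 0) (by simp)
    rw [map_one, Polynomial.coeff_one_zero] at this
    exact hJ.ne_top ((Ideal.eq_top_iff_one _).2 this)
  · by_contra! hcon
    obtain ⟨f', d, hf, hd, hfd⟩ := exists_sub_mem_coeff_notMem φ hφ hinj ha hb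
      ((φ f).natDegree + 1) f hcon.1 fun m hm => Polynomial.coeff_eq_zero_of_natDegree_lt hm
    obtain ⟨g', e, hg, he, hge⟩ := exists_sub_mem_coeff_notMem φ hφ hinj ha hb
      ((φ g).natDegree + 1) g hcon.2 fun m hm => Polynomial.coeff_eq_zero_of_natDegree_lt hm
    have h1 : f' * g' ∈ Ideal.span {a, b} := by
      have h2 := sub_mem (sub_mem hfg (Ideal.mul_mem_left _ f' hg)) (Ideal.mul_mem_right g _ hf)
      rwa [show f * g - f' * (g - g') - (f - f') * g = f' * g' by ring] at h2
    have h2 := coeff_mem_of_mem_span_pair φ hφ ha hb hprime hndvd h1 (d := d + e) (by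
      rw [map_mul]
      exact Polynomial.natDegree_mul_le_of_le hd he)
    rw [map_mul, Polynomial.coeff_mul_add_eq_of_natDegree_le hd he] at h2
    exact (hJ.mem_or_mem h2).elim hfd hge

/-- The grading of a polynomial ring with weights `w`, encoded as a substitution
`X i ↦ T ^ w i * X i`. -/
def weightHom {σ K : Type*} [CommRing K] (w : σ → ℕ) :
    MvPolynomial σ K →ₐ[K] Polynomial (MvPolynomial σ K) :=
  aeval fun i => Polynomial.monomial (w i) (X i)

variable {σ K : Type*} [CommRing K] (w : σ → ℕ)

theorem weightHom_X (i : σ) :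
    weightHom w (X i : MvPolynomial σ K) = Polynomial.monomial (w i) (X i) := aeval_X _ _

theorem weightHom_coeff (f : MvPolynomial σ K) : ∀ d,
    weightHom w ((weightHom w f).coeff d) = Polynomial.monomial d ((weightHom w f).coeff d) := by
  induction f using MvPolynomial.induction_on with
  | C a =>
    intro d
    have h : weightHom w (C a : MvPolynomial σ K) = Polynomial.C (C a) := by
      rw [← algebraMap_eq, AlgHom.commutes]
      rfl
    rw [h, Polynomial.coeff_C]
    split_ifs with hd
    · rw [h, hd, Polynomial.monomial_zero_left]
    · simp
  | add p q hp hq =>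
    intro d
    rw [map_add, Polynomial.coeff_add, map_add, hp d, hq d, map_add]
  | mul_X p i hp =>
    intro d
    rw [map_mul, weightHom_X, ← Polynomial.C_mul_X_pow_eq_monomial, ← mul_assoc,
      Polynomial.coeff_mul_X_pow', Polynomial.coeff_mul_C]
    split_ifs with h
    · rw [map_mul, hp, weightHom_X, Polynomial.monomial_mul_monomial, Nat.sub_add_cancel h]
    · simp

theorem weightHom_injective : Function.Injective (weightHom w : MvPolynomial σ K → _) := by
  have : ∀ f : MvPolynomial σ K, Polynomial.eval 1 (weightHom w f) = f := by
    intro f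
    induction f using MvPolynomial.induction_on with
    | C a =>
      rw [← algebraMap_eq, AlgHom.commutes]
      simp [Polynomial.algebraMap_apply]
    | add p q hp hq => rw [map_add, Polynomial.eval_add, hp, hq]
    | mul_X p i hp => rw [map_mul, Polynomial.eval_mul, hp, weightHom_X, Polynomial.eval_monomial,
        one_pow, mul_one]
  exact Function.LeftInverse.injective this

end Filtration

section LinearPrime

open Polynomial in
theorem linear_dvd_of_aeval_eq_zero {B : Type*} [CommRing B] [IsDomain B] {α β : B} (hα : α ≠ 0)
    (h : ∀ c, α ∣ c * β → α ∣ c) (n : ℕ) : ∀ f : B[X], f.natDegree ≤ n →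
      aeval (- algebraMap B (FractionRing B) β / algebraMap B (FractionRing B) α) f = 0 →
      (Polynomial.C α * Polynomial.X + Polynomial.C β) ∣ f := by
  set x := - algebraMap B (FractionRing B) β / algebraMap B (FractionRing B) α with hx
  have hα' : algebraMap B (FractionRing B) α ≠ 0 :=
    (map_ne_zero_iff _ (IsFractionRing.injective B (FractionRing B))).2 hα
  have hL : aeval x (Polynomial.C α * Polynomial.X + Polynomial.C β) = 0 := by
    simp only [map_add, map_mul, Polynomial.aeval_C, Polynomial.aeval_X, hx]
    field_simp
    ring
  have hpow : ∀ m c, α ∣ c * β ^ m → α ∣ c := by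
    intro m
    induction m with
    | zero => intro c hc; simpa using hc
    | succ m ih =>
      intro c hc
      refine ih c (h _ ?_)
      rwa [mul_assoc, ← pow_succ]
  induction n with
  | zero =>
    intro f hf h0
    rw [Polynomial.eq_C_of_natDegree_le_zero hf, Polynomial.aeval_C] at h0
    have := (map_eq_zero_iff _ (IsFractionRing.injective B (FractionRing B))).1 h0
    rw [Polynomial.eq_C_of_natDegree_le_zero hf, this, map_zero]
    exact dvd_zero _
  | succ n ih =>
    intro f hf h0
    have hdvd : α ∣ f.coeff (n + 1) := by
      refine hpow (n + 1) _ ?_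
      have h1 : ∑ i ∈ Finset.range (n + 2), f.coeff i * (-β) ^ i * α ^ (n + 1 - i) = 0 := by
        apply IsFractionRing.injective B (FractionRing B)
        rw [map_zero, map_sum]
        rw [Polynomial.aeval_eq_sum_range' (show f.natDegree < n + 2 by omega)] at h0
        have h2 := congrArg (fun z => z * algebraMap B (FractionRing B) α ^ (n + 1)) h0
        simp only [zero_mul, Finset.sum_mul] at h2
        rw [← h2]
        refine Finset.sum_congr rfl fun i hi => ?_
        have hi' : i ≤ n + 1 := by
          have := Finset.mem_range.1 hi
          omega
        rw [Algebra.smul_def, hx, div_pow]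
        simp only [map_mul, map_pow, map_neg]
        rw [← Nat.sub_add_cancel hi', pow_add _ _ i, Nat.sub_add_cancel hi']
        field_simp
      rw [Finset.sum_range_succ, Nat.sub_self, pow_zero, mul_one] at h1
      have h3 : α ∣ ∑ i ∈ Finset.range (n + 1), f.coeff i * (-β) ^ i * α ^ (n + 1 - i) :=
        Finset.dvd_sum fun i hi => Dvd.dvd.mul_left (dvd_pow_self _ (by
          have := Finset.mem_range.1 hi
          omega)) _
      have h4 : α ∣ f.coeff (n + 1) * (-β) ^ (n + 1) := by
        rw [eq_neg_of_add_eq_zero_right h1]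
        exact (dvd_neg).2 h3
      rw [neg_pow, ← mul_assoc, mul_comm (f.coeff (n + 1)), mul_assoc] at h4
      rcases neg_one_pow_eq_or B (n + 1) with h5 | h5 <;> rw [h5] at h4
      · simpa using h4
      · simpa using h4
    obtain ⟨c, hc⟩ := hdvd
    have h5 := ih (f - Polynomial.monomial n c * (Polynomial.C α * Polynomial.X + Polynomial.C β))
      (by
        refine Polynomial.natDegree_le_iff_coeff_eq_zero.2 fun m hm => ?_
        obtain ⟨m, rfl⟩ : ∃ k, m = k + 1 := ⟨m - 1, by omega⟩
        rw [Polynomial.coeff_sub, mul_add, Polynomial.coeff_add, Polynomial.coeff_mul_C, ← mul_assoc, Polynomial.coeff_mul_X, Polynomial.coeff_mul_C,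
          Polynomial.coeff_monomial, Polynomial.coeff_monomial, if_neg (show n ≠ m + 1 by omega)]
        rcases eq_or_ne n m with rfl | hne
        · rw [if_pos rfl, hc]
          ring
        · rw [if_neg hne, Polynomial.coeff_eq_zero_of_natDegree_lt (by omega)]
          ring) (by rw [map_sub, map_mul, hL, h0, mul_zero, sub_zero])
    have h6 := dvd_add h5 (dvd_mul_left (Polynomial.C α * Polynomial.X + Polynomial.C β)
      (Polynomial.monomial n c))
    rwa [sub_add_cancel] at h6

theorem prime_linear {B : Type*} [CommRing B] [IsDomain B] {α β : B} (hα : α ≠ 0)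
    (h : ∀ c, α ∣ c * β → α ∣ c) : Prime (Polynomial.C α * Polynomial.X + Polynomial.C β) := by
  have hdeg : (Polynomial.C α * Polynomial.X + Polynomial.C β).natDegree = 1 :=
    Polynomial.natDegree_linear hα
  refine ⟨fun h0 => ?_, fun hu => ?_, fun f g hfg => ?_⟩
  · rw [h0, Polynomial.natDegree_zero] at hdeg
    exact absurd hdeg (by norm_num)
  · rw [Polynomial.natDegree_eq_zero_of_isUnit hu] at hdeg
    exact absurd hdeg (by norm_num)
  · have hα' : algebraMap B (FractionRing B) α ≠ 0 :=
      (map_ne_zero_iff _ (IsFractionRing.injective B (FractionRing B))).2 hα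
    have h0 : Polynomial.aeval (- algebraMap B (FractionRing B) β /
        algebraMap B (FractionRing B) α) (f * g) = 0 := by
      obtain ⟨q, hq⟩ := hfg
      rw [hq, map_mul]
      have : Polynomial.aeval (- algebraMap B (FractionRing B) β /
        algebraMap B (FractionRing B) α) (Polynomial.C α * Polynomial.X + Polynomial.C β) = 0 := by
        simp only [map_add, map_mul, Polynomial.aeval_C, Polynomial.aeval_X]
        field_simp
        ring
      rw [this, zero_mul]
    rw [map_mul, mul_eq_zero] at h0
    exact h0.imp (linear_dvd_of_aeval_eq_zero hα h _ f le_rfl)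
      (linear_dvd_of_aeval_eq_zero hα h _ g le_rfl)

/-- `(h, α X + β)` is prime in `A[X]` if `h` is prime and `α, β` is a regular sequence modulo `h`. -/
theorem isPrime_span_C_linear {A : Type*} [CommRing A] {h α β : A}
    (hh : Prime h) (hα : ¬ h ∣ α)
    (hreg : ∀ c, c * β ∈ Ideal.span {α, h} → c ∈ Ideal.span {α, h}) :
    (Ideal.span {Polynomial.C h, Polynomial.C α * Polynomial.X + Polynomial.C β}).IsPrime := by
  let I : Ideal A := Ideal.span {h}
  have : I.IsPrime := (Ideal.span_singleton_prime hh.ne_zero).2 hh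
  have hdvd : ∀ c : A, Ideal.Quotient.mk I α ∣ Ideal.Quotient.mk I c ↔ c ∈ Ideal.span {α, h} := by
    intro c
    rw [Ideal.mem_span_pair]
    constructor
    · rintro ⟨d, hd⟩
      obtain ⟨d, rfl⟩ := Ideal.Quotient.mk_surjective d
      rw [← map_mul, Ideal.Quotient.mk_eq_mk_iff_sub_mem, Ideal.mem_span_singleton] at hd
      obtain ⟨e, he⟩ := hd
      exact ⟨d, e, by linear_combination -he⟩
    · rintro ⟨d, e, rfl⟩
      refine ⟨Ideal.Quotient.mk I d, ?_⟩
      have : Ideal.Quotient.mk I h = 0 :=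
        Ideal.Quotient.eq_zero_iff_mem.2 (Ideal.mem_span_singleton_self h)
      rw [map_add, map_mul, map_mul, this, mul_zero, add_zero, mul_comm]
  have hL : Prime (Polynomial.C (Ideal.Quotient.mk I α) * Polynomial.X +
      Polynomial.C (Ideal.Quotient.mk I β)) := by
    refine prime_linear (fun h0 => hα ?_) fun c hc => ?_
    · exact Ideal.mem_span_singleton.1 (Ideal.Quotient.eq_zero_iff_mem.1 h0)
    · obtain ⟨c, rfl⟩ := Ideal.Quotient.mk_surjective c
      rw [← map_mul, hdvd] at hc
      exact (hdvd c).2 (hreg c hc)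
  have hcomap : Ideal.span {Polynomial.C h, Polynomial.C α * Polynomial.X + Polynomial.C β} =
      (Ideal.span {Polynomial.C (Ideal.Quotient.mk I α) * Polynomial.X +
        Polynomial.C (Ideal.Quotient.mk I β)}).comap
          (Polynomial.mapRingHom (Ideal.Quotient.mk I)) := by
    have h1 : Polynomial.C (Ideal.Quotient.mk I α) * Polynomial.X +
        Polynomial.C (Ideal.Quotient.mk I β) = Polynomial.mapRingHom (Ideal.Quotient.mk I)
          (Polynomial.C α * Polynomial.X + Polynomial.C β) := by simp
    have h2 : Ideal.span {Polynomial.mapRingHom (Ideal.Quotient.mk I)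
        (Polynomial.C α * Polynomial.X + Polynomial.C β)} = (Ideal.span
          {Polynomial.C α * Polynomial.X + Polynomial.C β}).map
            (Polynomial.mapRingHom (Ideal.Quotient.mk I)) := by
      rw [Ideal.map_span, Set.image_singleton]
    rw [h1, h2, Ideal.comap_map_of_surjective' _
      (Polynomial.map_surjective _ Ideal.Quotient.mk_surjective), Polynomial.ker_mapRingHom,
      Ideal.mk_ker, Ideal.map_span, Set.image_singleton, Ideal.span_insert, sup_comm]
  rw [hcomap]
  have := (Ideal.span_singleton_prime hL.ne_zero).2 hL
  infer_instance

end LinearPrime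

section LeadingForms

variable {τ : Type*}

theorem not_X_dvd {σ : Type*} {h : MvPolynomial σ ℂ} {z : σ → ℂ} {i : σ} (hz : z i = 0)
    (hh : eval z h ≠ 0) : ¬ X i ∣ h := by
  rintro ⟨g, rfl⟩
  rw [map_mul, eval_X, hz, zero_mul] at hh
  exact hh rfl

theorem prime_X_mul_add {σ : Type*} {i j k : σ} (hij : i ≠ j) (hik : i ≠ k) :
    Prime (X none * X (some i) + X (some j) * X (some k) : MvPolynomial (Option σ) ℂ) := by
  rw [← MulEquiv.prime_iff (optionEquivLeft ℂ σ)]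
  have : optionEquivLeft ℂ σ (X none * X (some i) + X (some j) * X (some k)) =
      Polynomial.C (X i) * Polynomial.X + Polynomial.C (X j * X k) := by
    rw [map_add, map_mul, map_mul, optionEquivLeft_X_none, optionEquivLeft_X_some,
      optionEquivLeft_X_some, optionEquivLeft_X_some, mul_comm, map_mul]
  rw [this]
  refine prime_linear (X_ne_zero i) fun c hc => ?_
  have hX : ∀ {l}, i ≠ l → ¬ (X i : MvPolynomial σ ℂ) ∣ X l := fun {l} hl => by
    classical
    refine not_X_dvd (z := Pi.single l 1) (by simp [hl]) (by simp)
  have hp : Prime (X i : MvPolynomial σ ℂ) := X_prime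
  rcases hp.dvd_or_dvd hc with h | h
  · exact h
  · rcases hp.dvd_or_dvd h with h | h
    · exact absurd h (hX hij)
    · exact absurd h (hX hik)

/-- Primality of `(h, y₁ x_i + x_j x_k)` for a prime form `h` not involving `y₁` and
not vanishing at some point with `x_i = x_j = x_k = 0`. -/
theorem isPrime_span_rename {σ : Type*} {i j k : σ} {h : MvPolynomial σ ℂ} (hh : Prime h)
    {z : σ → ℂ} (hi : z i = 0) (hj : z j = 0) (hk : z k = 0) (hz : eval z h ≠ 0)
    (hij : i ≠ j) (hik : i ≠ k) :
    (Ideal.span {rename some h,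
      (X none * X (some i) + X (some j) * X (some k) : MvPolynomial (Option σ) ℂ)}).IsPrime := by
  classical
  let e := optionEquivLeft ℂ σ
  have h1 : (Ideal.span {Polynomial.C h,
      Polynomial.C (X i) * Polynomial.X + Polynomial.C (X j * X k)}).IsPrime := by
    have hp : ∀ l, Prime (X l : MvPolynomial σ ℂ) := fun l => X_prime
    refine isPrime_span_C_linear hh (fun hdvd => ?_) fun c hc => ?_
    · have h2 := ((hh.dvd_prime_iff_associated (hp i)).1 hdvd).symm.dvd
      exact not_X_dvd hi hz h2
    · let π : MvPolynomial σ ℂ →ₐ[ℂ] MvPolynomial σ ℂ := aeval fun l => if l = i then 0 else X l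
      have hπX : ∀ l, l ≠ i → π (X l) = X l := fun l hl => by simp [π, hl]
      have hπi : π (X i) = 0 := by simp [π]
      have hπ : ∀ f, ∃ g, π f = f + g * X i := by
        intro f
        induction f using MvPolynomial.induction_on with
        | C a => exact ⟨0, by simp [π]⟩
        | add p q hp hq =>
          obtain ⟨g, hg⟩ := hp
          obtain ⟨g', hg'⟩ := hq
          exact ⟨g + g', by rw [map_add, hg, hg']; ring⟩
        | mul_X p l hp =>
          obtain ⟨g, hg⟩ := hp
          by_cases hl : l = i
          · exact ⟨-p, by rw [map_mul, hl, hπi]; ring⟩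
          · exact ⟨g * X l, by rw [map_mul, hπX l hl, hg]; ring⟩
      have hπz : ∀ f, eval z (π f) = eval z f := by
        intro f
        obtain ⟨g, hg⟩ := hπ f
        rw [hg, map_add, map_mul, eval_X, hi, mul_zero, add_zero]
      obtain ⟨s, t, hst⟩ := Ideal.mem_span_pair.1 hc
      have h2 : π c * (X j * X k) = π t * π h := by
        have := congrArg π hst
        rw [map_add, map_mul, map_mul, map_mul, map_mul, hπi, hπX j hij.symm, hπX k hik.symm] at this
        linear_combination -this
      have hdvd : ∀ {l}, z l = 0 → ∀ {f g : MvPolynomial σ ℂ}, X l * f = g * π h → X l ∣ g := by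
        intro l hl f g hfg
        refine ((hp l).dvd_or_dvd ⟨f, hfg.symm⟩).resolve_right (not_X_dvd hl ?_)
        rwa [hπz]
      obtain ⟨t₁, ht₁⟩ := hdvd hj (f := π c * X k) (g := π t) (by linear_combination h2)
      have h3 : X k * π c = t₁ * π h := by
        refine mul_left_cancel₀ (X_ne_zero j) ?_
        rw [ht₁] at h2
        linear_combination h2
      obtain ⟨t₂, ht₂⟩ := hdvd hk h3
      have h4 : π c = t₂ * π h := by
        refine mul_left_cancel₀ (X_ne_zero k) ?_
        rw [ht₂] at h3
        linear_combination h3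
      obtain ⟨g, hg⟩ := hπ c
      obtain ⟨g', hg'⟩ := hπ h
      exact Ideal.mem_span_pair.2 ⟨t₂ * g' - g, t₂, by
        rw [hg, hg'] at h4
        linear_combination -h4⟩
  have hrename : e (rename some h) = Polynomial.C h := by
    have : (e : MvPolynomial (Option σ) ℂ →ₐ[ℂ] _).comp (rename some) =
        (Polynomial.CAlgHom : MvPolynomial σ ℂ →ₐ[MvPolynomial σ ℂ] _).restrictScalars ℂ :=
      algHom_ext fun l => by simp [e, optionEquivLeft_X_some]
    exact DFunLike.congr_fun this h
  have h2 : Ideal.span {rename some h,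
      (X none * X (some i) + X (some j) * X (some k) : MvPolynomial (Option σ) ℂ)} =
      (Ideal.span {Polynomial.C h, Polynomial.C (X i) * Polynomial.X +
        Polynomial.C (X j * X k)}).comap (e : MvPolynomial (Option σ) ℂ ≃+* _) := by
    rw [← Ideal.map_symm, Ideal.map_span, Set.image_pair]
    congr 2
    · refine (RingEquiv.symm_apply_eq _).2 ?_ |>.symm
      exact hrename.symm
    · congr 1
      refine (RingEquiv.symm_apply_eq _).2 ?_ |>.symm
      change _ = e _
      rw [map_add, map_mul e, map_mul e, optionEquivLeft_X_none, optionEquivLeft_X_some,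
        optionEquivLeft_X_some, optionEquivLeft_X_some, mul_comm, map_mul]
  rw [h2]
  exact Ideal.comap_isPrime _ _

end LeadingForms

section HyperbolicPairs

open Module

variable {E : Type*} [AddCommGroup E] [Module ℂ E] [FiniteDimensional ℂ E]
  {B : E →ₗ[ℂ] E →ₗ[ℂ] ℂ}

theorem exists_hyperbolic_pair (hB : ∀ x y, B x y = B y x) (W : Submodule ℂ E)
    (h : ¬ ∃ L : E →ₗ[ℂ] ℂ, ∀ z ∈ W, B z z = L z ^ 2) :
    ∃ u ∈ W, ∃ v ∈ W, B u u = 0 ∧ B v v = 0 ∧ B u v = 1 / 2 := by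
  have hnorm : ∀ w : E, B w w ≠ 0 → ∃ c : ℂ, B (c • w) (c • w) = 1 := by
    intro w hw
    obtain ⟨c, hc⟩ := IsAlgClosed.exists_pow_nat_eq (B w w)⁻¹ (n := 2) two_pos
    refine ⟨c, ?_⟩
    simp only [map_smul, LinearMap.smul_apply, smul_eq_mul]
    rw [← mul_assoc, ← sq, hc, inv_mul_cancel₀ hw]
  obtain ⟨w, hwW, hw⟩ : ∃ w ∈ W, B w w = 1 := by
    by_contra! hne
    refine h ⟨0, fun z hz => ?_⟩
    by_contra h0
    obtain ⟨c, hc⟩ := hnorm z (by simpa using h0)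
    exact hne _ (W.smul_mem c hz) hc
  obtain ⟨w', hw'W, hww', hw'⟩ : ∃ w' ∈ W, B w w' = 0 ∧ B w' w' = 1 := by
    by_contra! hne
    refine h ⟨B w, fun z hz => ?_⟩
    have h1 : B w (z - B w z • w) = 0 := by
      simp only [map_sub, map_smul, smul_eq_mul, hw]
      ring
    have h2 : B (z - B w z • w) (z - B w z • w) = 0 := by
      by_contra h0
      obtain ⟨c, hc⟩ := hnorm _ h0
      exact hne _ (W.smul_mem c (W.sub_mem hz (W.smul_mem _ hwW)))
        (by rw [map_smul, h1, smul_zero]) hc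
    simp only [map_sub, map_smul, smul_eq_mul, LinearMap.sub_apply, LinearMap.smul_apply, hw,
      hB z w] at h2
    linear_combination h2
  have hI : Complex.I * Complex.I = -1 := Complex.I_mul_I
  refine ⟨(1 / 2 : ℂ) • (w + Complex.I • w'), W.smul_mem _ (W.add_mem hwW (W.smul_mem _ hw'W)),
    (1 / 2 : ℂ) • (w - Complex.I • w'), W.smul_mem _ (W.sub_mem hwW (W.smul_mem _ hw'W)), ?_, ?_, ?_⟩
  all_goals simp only [map_add, map_sub, map_smul, smul_eq_mul, LinearMap.sub_apply,
      LinearMap.add_apply, LinearMap.smul_apply, hw, hw', hww', hB w' w]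
  · linear_combination (1 / 4) * hI
  · linear_combination (1 / 4) * hI
  · linear_combination (-1 / 4) * hI

/-- A quadratic form that is not a sum of three squares contains two orthogonal hyperbolic planes. -/
theorem exists_two_hyperbolic_pairs (hB : ∀ x y, B x y = B y x)
    (h : ¬ ∃ L : Fin 3 → E →ₗ[ℂ] ℂ, ∀ z, B z z = ∑ a, L a z ^ 2) :
    ∃ u₁ v₁ u₂ v₂ : E, B u₁ u₁ = 0 ∧ B v₁ v₁ = 0 ∧ B u₁ v₁ = 1 / 2 ∧
      B u₂ u₂ = 0 ∧ B v₂ v₂ = 0 ∧ B u₂ v₂ = 1 / 2 ∧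
      B u₁ u₂ = 0 ∧ B u₁ v₂ = 0 ∧ B v₁ u₂ = 0 ∧ B v₁ v₂ = 0 := by
  obtain ⟨u₁, -, v₁, -, hu, hv, huv⟩ := exists_hyperbolic_pair hB ⊤ (by
    rintro ⟨L, hL⟩
    exact h ⟨![L, 0, 0], fun z => by rw [hL z trivial]; simp [Fin.sum_univ_three]⟩)
  obtain ⟨u₂, hu₂W, v₂, hv₂W, hu₂, hv₂, huv₂⟩ := exists_hyperbolic_pair hB
    (LinearMap.ker (B u₁) ⊓ LinearMap.ker (B v₁)) (by
    rintro ⟨L, hL⟩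
    have hI : Complex.I ^ 2 = -1 := Complex.I_sq
    refine h ⟨![L - (2 * L u₁) • B v₁ - (2 * L v₁) • B u₁, B u₁ + B v₁,
      Complex.I • (B u₁ - B v₁)], fun z => ?_⟩
    have h1 := hL (z - (2 * B v₁ z) • u₁ - (2 * B u₁ z) • v₁) (by
      simp only [Submodule.mem_inf, LinearMap.mem_ker, map_sub, map_smul, smul_eq_mul, hu, hv, huv,
        hB v₁ u₁]
      constructor <;> ring)
    simp only [map_sub, map_smul, smul_eq_mul, LinearMap.sub_apply, LinearMap.smul_apply, hu, hv,
      huv, hB v₁ u₁, hB z u₁, hB z v₁] at h1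
    simp only [Fin.sum_univ_three, Matrix.cons_val_zero, Matrix.cons_val_one, Matrix.cons_val,
      LinearMap.sub_apply, LinearMap.add_apply, LinearMap.smul_apply, smul_eq_mul]
    linear_combination h1 - (B u₁ z - B v₁ z) ^ 2 * hI)
  simp only [Submodule.mem_inf, LinearMap.mem_ker] at hu₂W hv₂W
  exact ⟨u₁, v₁, u₂, v₂, hu, hv, huv, hu₂, hv₂, huv₂, hu₂W.1, hv₂W.1, hu₂W.2, hv₂W.2⟩

theorem exists_isotropic_pair (hB : ∀ x y, B x y = B y x) (W : Submodule ℂ E)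
    (hW : 4 ≤ finrank ℂ W) {w : E} (hwW : w ∈ W) (hw0 : w ≠ 0) (hw : B w w = 0) :
    ∃ w' ∈ W, B w' w' = 0 ∧ B w w' = 0 ∧ LinearIndependent ℂ ![w, w'] := by
  have hker : 3 ≤ finrank ℂ (LinearMap.ker ((B w).comp W.subtype)) := by
    have h1 := LinearMap.finrank_range_add_finrank_ker ((B w).comp W.subtype)
    have h2 : finrank ℂ (LinearMap.range ((B w).comp W.subtype)) ≤ 1 :=
      (Submodule.finrank_le _).trans (finrank_self ℂ).le
    omega
  let K := LinearMap.ker ((B w).comp W.subtype)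
  have hwK : (⟨w, hwW⟩ : W) ∈ K := by
    simpa [K] using hw
  let w₀ : K := ⟨⟨w, hwW⟩, hwK⟩
  have hw₀ : w₀ ≠ 0 := fun h0 => hw0 (congrArg (fun z : K => ((z : W) : E)) h0)
  obtain ⟨a, ha⟩ := exists_linearIndependent_pair_of_one_lt_finrank (show 1 < finrank ℂ K by
    change 3 ≤ finrank ℂ K at hker
    omega) hw₀
  obtain ⟨b, hb⟩ := exists_linearIndependent_cons_of_lt_finrank ha (show 2 < finrank ℂ K from hker)
  have hli : ∀ r s t : ℂ, r • (b : E) + s • w + t • (a : E) = 0 → r = 0 ∧ s = 0 ∧ t = 0 := by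
    intro r s t h
    have := Fintype.linearIndependent_iff.1 hb ![r, s, t] (by
      apply Subtype.ext
      apply Subtype.ext
      simpa [Fin.sum_univ_three, w₀, add_assoc] using h)
    exact ⟨this 0, this 1, this 2⟩
  have hperp : ∀ z : K, B w z = 0 := fun z => LinearMap.mem_ker.1 z.2
  obtain ⟨s, t, hst, hQ⟩ : ∃ s t : ℂ, (s ≠ 0 ∨ t ≠ 0) ∧
      B (s • (b : E) + t • (a : E)) (s • (b : E) + t • (a : E)) = 0 := by
    by_cases ha0 : B (a : E) a = 0
    · exact ⟨0, 1, Or.inr one_ne_zero, by simpa using ha0⟩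
    · obtain ⟨t, ht⟩ := exists_quadratic_eq_zero (b := 2 * B (a : E) b) (c := B (b : E) b) ha0
        (IsAlgClosed.exists_eq_mul_self _)
      refine ⟨1, t, Or.inl one_ne_zero, ?_⟩
      simp only [map_add, map_smul, smul_eq_mul, LinearMap.add_apply, LinearMap.smul_apply,
        hB (b : E) a]
      linear_combination ht
  refine ⟨s • (b : E) + t • (a : E), W.add_mem (W.smul_mem _ (b : W).2) (W.smul_mem _ (a : W).2), hQ,
    by rw [map_add, map_smul, map_smul, hperp, hperp, smul_zero, smul_zero, add_zero], ?_⟩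
  rw [LinearIndependent.pair_iff]
  intro r c hrc
  obtain ⟨h1, h2, h3⟩ := hli (c * s) r (c * t) (by
    rw [← hrc]
    module)
  refine ⟨h2, ?_⟩
  rcases hst with h | h
  · exact (mul_eq_zero.1 h1).resolve_right h
  · exact (mul_eq_zero.1 h3).resolve_right h

theorem exists_basis_of_linearIndependent {f : Fin 4 → E} {y₁ y₂ : E}
    (h : LinearIndependent ℂ (Sum.elim f ![y₁, y₂])) :
    ∃ (k : ℕ) (b : Basis (Option (Fin 4 ⊕ Option (Fin k))) ℂ E),
      (∀ i, b (some (Sum.inl i)) = f i) ∧ b none = y₁ ∧ b (some (Sum.inr none)) = y₂ := by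
  classical
  obtain ⟨k, b, hb⟩ : ∃ (k : ℕ) (b : Basis ((Fin 4 ⊕ Fin 2) ⊕ Fin k) ℂ E),
      ∀ i, b (Sum.inl i) = Sum.elim f ![y₁, y₂] i := by
    have : Finite ((Fin 4 ⊕ Fin 2) ⊕ Basis.sumExtendIndex h) :=
      Module.Finite.finite_basis (Basis.sumExtend h)
    have : Finite (Basis.sumExtendIndex h) :=
      Finite.of_injective _ (Sum.inr_injective (α := Fin 4 ⊕ Fin 2))
    obtain ⟨k, ⟨e⟩⟩ := Finite.exists_equiv_fin (Basis.sumExtendIndex h)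
    refine ⟨k, (Basis.sumExtend h).reindex (Equiv.sumCongr (Equiv.refl _) e), fun i => ?_⟩
    rw [Basis.reindex_apply, Equiv.sumCongr_symm, Equiv.sumCongr_apply, Sum.map_inl]
    change Basis.sumExtend h (Sum.inl i) = _
    simp only [Basis.sumExtend, Basis.reindex_apply, Equiv.symm_symm, Basis.extend_apply_self]
    have := Classical.decPred (· ∈ Set.range (Sum.elim f ![y₁, y₂]))
    exact congrArg Subtype.val (Equiv.Set.sumDiffSubset_apply_inl
      (h.linearIndepOn_id.subset_extend (Set.subset_univ _)) (Equiv.ofInjective _ h.injective i))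
  let e : (Fin 4 ⊕ Fin 2) ⊕ Fin k ≃ Option (Fin 4 ⊕ Option (Fin k)) :=
    { toFun := Sum.elim (Sum.elim (fun i => some (Sum.inl i)) ![none, some (Sum.inr none)])
        fun t => some (Sum.inr (some t))
      invFun := fun o => o.elim (Sum.inl (Sum.inr 0)) (Sum.elim (fun i => Sum.inl (Sum.inl i))
        fun o => o.elim (Sum.inl (Sum.inr 1)) Sum.inr)
      left_inv := by
        rintro ((i | i) | t)
        · rfl
        · fin_cases i <;> rfl
        · rfl
      right_inv := by
        rintro (_ | (i | (_ | t))) <;> rfl }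
  refine ⟨k, b.reindex e, fun i => ?_, ?_, ?_⟩
  · rw [Basis.reindex_apply]
    exact hb (Sum.inl i)
  · rw [Basis.reindex_apply]
    exact hb (Sum.inr 0)
  · rw [Basis.reindex_apply]
    exact hb (Sum.inr 1)

end HyperbolicPairs

theorem prime_rename {σ τ R : Type*} [CommRing R] {g : σ → τ} (hg : Function.Injective g)
    {h : MvPolynomial σ R} (hh : Prime h) : Prime (rename g h) := by
  have h1 : rename g h = rename ((↑) : Set.range g → τ) (renameEquiv R (Equiv.ofInjective g hg) h) := by
    rw [renameEquiv_apply, rename_rename]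
    rfl
  rw [h1, prime_rename_iff, MulEquiv.prime_iff]
  exact hh

section TopWeight

variable {σ K : Type*} [CommRing K]

/-- The part of highest possible weight of a form. -/
def topWeightHom (w : σ → ℕ) (m : ℕ) : MvPolynomial σ K →ₐ[K] MvPolynomial σ K :=
  aeval fun i => if w i = m then X i else 0

theorem weightHom_of_isHomogeneous {w : σ → ℕ} {m : ℕ} (hw : ∀ i, w i ≤ m) {f : MvPolynomial σ K}
    {d : ℕ} (hf : f.IsHomogeneous d) : (weightHom w f).natDegree ≤ d * m ∧
      (weightHom w f).coeff (d * m) = topWeightHom w m f := by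
  classical
  have hX : ∀ i, (weightHom w (X i : MvPolynomial σ K)).natDegree ≤ m ∧
      (weightHom w (X i : MvPolynomial σ K)).coeff m = topWeightHom w m (X i) := by
    intro i
    rw [weightHom_X, topWeightHom, aeval_X, Polynomial.coeff_monomial]
    exact ⟨(Polynomial.natDegree_monomial_le _).trans (hw i), rfl⟩
  have hpow : ∀ i n, (weightHom w (X i ^ n : MvPolynomial σ K)).natDegree ≤ n * m ∧
      (weightHom w (X i ^ n : MvPolynomial σ K)).coeff (n * m) = topWeightHom w m (X i ^ n) := by
    intro i n
    rw [map_pow, map_pow]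
    exact ⟨Polynomial.natDegree_pow_le_of_le n (hX i).1, by
      rw [Polynomial.coeff_pow_of_natDegree_le (hX i).1, (hX i).2]⟩
  have hprod : ∀ (s : σ →₀ ℕ) (S : Finset σ),
      (weightHom w (∏ i ∈ S, X i ^ s i : MvPolynomial σ K)).natDegree ≤ (∑ i ∈ S, s i) * m ∧
      (weightHom w (∏ i ∈ S, X i ^ s i : MvPolynomial σ K)).coeff ((∑ i ∈ S, s i) * m) =
        topWeightHom w m (∏ i ∈ S, X i ^ s i) := by
    intro s S
    induction S using Finset.induction with
    | empty => simp
    | insert a S ha ih =>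
      rw [Finset.prod_insert ha, Finset.sum_insert ha, add_mul, map_mul, map_mul]
      exact ⟨Polynomial.natDegree_mul_le_of_le (hpow a _).1 ih.1, by
        rw [Polynomial.coeff_mul_add_eq_of_natDegree_le (hpow a _).1 ih.1, (hpow a _).2, ih.2]⟩
  have hmon : ∀ s ∈ f.support, (weightHom w (monomial s (coeff s f))).natDegree ≤ d * m ∧
      (weightHom w (monomial s (coeff s f))).coeff (d * m) =
        topWeightHom w m (monomial s (coeff s f)) := by
    intro s hs
    have hd : ∑ i ∈ s.support, s i = d := by
      have := hf (mem_support_iff.1 hs)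
      rw [Finsupp.weight_apply, Finsupp.sum] at this
      simpa using this
    rw [monomial_eq, Finsupp.prod, ← smul_eq_C_mul, map_smul, map_smul]
    obtain ⟨h1, h2⟩ := hprod s s.support
    rw [hd] at h1 h2
    exact ⟨(Polynomial.natDegree_smul_le _ _).trans h1, by rw [Polynomial.coeff_smul, h2]⟩
  constructor
  · rw [f.as_sum, map_sum]
    exact Polynomial.natDegree_sum_le_of_forall_le _ _ fun s hs => (hmon s hs).1
  · conv_lhs => rw [f.as_sum]
    conv_rhs => rw [f.as_sum]
    rw [map_sum, map_sum, Polynomial.finsetSum_coeff]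
    exact Finset.sum_congr rfl fun s hs => (hmon s hs).2

theorem weightHom_of_totalDegree_le {w : σ → ℕ} {m : ℕ} (hm : 0 < m) (hw : ∀ i, w i ≤ m)
    {f : MvPolynomial σ K} {d : ℕ} (hf : f.totalDegree ≤ d) : (weightHom w f).natDegree ≤ d * m ∧
      (weightHom w f).coeff (d * m) = topWeightHom w m (homogeneousComponent d f) := by
  have h1 : ∀ i, i ≤ d → (weightHom w (homogeneousComponent i f)).natDegree ≤ d * m ∧
      (i ≠ d → (weightHom w (homogeneousComponent i f)).coeff (d * m) = 0) := by
    intro i hi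
    have h2 := (weightHom_of_isHomogeneous hw (homogeneousComponent_isHomogeneous i f)).1
    refine ⟨h2.trans (Nat.mul_le_mul_right m hi), fun hne =>
      Polynomial.coeff_eq_zero_of_natDegree_lt (h2.trans_lt ?_)⟩
    exact Nat.mul_lt_mul_of_pos_right (lt_of_le_of_ne hi hne) hm
  have h3 : f = ∑ i ∈ Finset.range (d + 1), homogeneousComponent i f := by
    conv_lhs => rw [← sum_homogeneousComponent f]
    refine Finset.sum_subset (Finset.range_mono (by omega)) fun i _ hi => ?_
    exact homogeneousComponent_eq_zero _ _ (by simpa using hi)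
  constructor
  · rw [h3, map_sum]
    exact Polynomial.natDegree_sum_le_of_forall_le _ _ fun i hi =>
      (h1 i (by simpa [Nat.lt_succ_iff] using hi)).1
  · conv_lhs => rw [h3, map_sum, Polynomial.finsetSum_coeff, Finset.sum_range_succ,
      Finset.sum_eq_zero fun i hi => (h1 i (Finset.mem_range.1 hi).le).2 (Finset.mem_range.1 hi).ne,
      zero_add, (weightHom_of_isHomogeneous hw (homogeneousComponent_isHomogeneous d f)).2]

end TopWeight

section Degeneration

variable {k : ℕ}

/-- The weights of the coordinates for the degeneration of `q₂ + ⋯ + q_M` on `{q₂ = 0}`. -/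
def degWeight : Option (Fin 4 ⊕ Option (Fin k)) → ℕ
  | none => 1
  | some (Sum.inl _) => 2
  | some (Sum.inr none) => 1
  | some (Sum.inr (some _)) => 0

theorem degWeight_le : ∀ s : Option (Fin 4 ⊕ Option (Fin k)), degWeight s ≤ 2
  | none => by simp [degWeight]
  | some (Sum.inl _) => le_rfl
  | some (Sum.inr none) => by simp [degWeight]
  | some (Sum.inr (some _)) => by simp [degWeight]

theorem topWeightHom_linSubst {N : ℕ} (b : Option (Fin 4 ⊕ Option (Fin k)) → Fin N → ℂ)
    (P : MvPolynomial (Fin N) ℂ) : topWeightHom degWeight 2 (linSubst b P) =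
      rename some (rename Sum.inl (linSubst (fun i => b (some (Sum.inl i))) P)) := by
  have h : (topWeightHom degWeight 2).comp (linSubst b) = ((rename some).comp (rename Sum.inl)).comp
      (linSubst (fun i => b (some (Sum.inl i)))) := by
    refine algHom_ext fun i => ?_
    simp only [AlgHom.comp_apply, linSubst_X, linForm, map_sum, map_mul, topWeightHom, aeval_X,
      rename_X, rename_C, algHom_C, algebraMap_eq]
    simp [Fintype.sum_option, Fintype.sum_sum_type, degWeight]
  exact DFunLike.congr_fun h P

theorem isPrime_span_of_hyperbolic_pairs {N M : ℕ} (hM : 2 ≤ M)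
    (b : Option (Fin 4 ⊕ Option (Fin k)) → Fin N → ℂ)
    {q f : MvPolynomial (Fin N) ℂ} {β : Option (Fin 4 ⊕ Option (Fin k)) →
      Option (Fin 4 ⊕ Option (Fin k)) → ℂ}
    (hq : linSubst b q = ∑ s, ∑ t, C (β s t) * X s * X t) (hβ : ∀ s t, β s t = β t s)
    (h0 : ∀ i j, β (some (Sum.inl i)) (some (Sum.inl j)) = 0)
    (h1 : ∀ i, β none (some (Sum.inl i)) = if i = 0 then 1 / 2 else 0)
    (h2 : ∀ i, β (some (Sum.inr none)) (some (Sum.inl i)) = if i = 1 then 1 / 2 else 0)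
    (hf : f.totalDegree ≤ M)
    (hs : ¬ IsSplitForm M (linSubst (fun i => b (some (Sum.inl i))) (homogeneousComponent M f)))
    (hne : eval (b (some (Sum.inl 2))) (homogeneousComponent M f) ≠ 0) :
    (Ideal.span {linSubst b f, linSubst b q}).IsPrime := by
  classical
  set e : Fin 4 → Fin N → ℂ := fun i => b (some (Sum.inl i)) with he
  set h := linSubst e (homogeneousComponent M f) with hh
  have hprime : Prime h := prime_of_not_isSplitForm hM
    (isHomogeneous_linSubst _ (homogeneousComponent_isHomogeneous _ _)) hs
  have hz : eval (Pi.single 2 1) h ≠ 0 := by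
    rw [hh, eval_linSubst]
    simpa [Pi.single_apply, he] using hne
  have hdeg : (linSubst b f).totalDegree ≤ M := by
    rw [← sum_homogeneousComponent f, map_sum]
    refine totalDegree_finsetSum_le fun i hi => ?_
    refine (isHomogeneous_linSubst b (homogeneousComponent_isHomogeneous i f)).totalDegree_le.trans ?_
    have := Finset.mem_range.1 hi
    omega
  obtain ⟨ha, ha'⟩ := weightHom_of_totalDegree_le two_pos degWeight_le hdeg
  rw [← linSubst_homogeneousComponent, topWeightHom_linSubst, ← he, ← hh] at ha'
  have hterm : ∀ s t : Option (Fin 4 ⊕ Option (Fin k)),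
      weightHom degWeight (C (β s t) * X s * X t) =
        Polynomial.monomial (degWeight s + degWeight t) (C (β s t) * X s * X t) := by
    intro s t
    rw [mul_assoc, ← smul_eq_C_mul, map_smul, map_mul, weightHom_X, weightHom_X,
      Polynomial.monomial_mul_monomial, Polynomial.smul_monomial]
  have hb : (weightHom degWeight (linSubst b q)).natDegree ≤ 3 := by
    rw [hq, map_sum]
    refine Polynomial.natDegree_sum_le_of_forall_le _ _ fun s _ => ?_
    rw [map_sum]
    refine Polynomial.natDegree_sum_le_of_forall_le _ _ fun t _ => ?_
    rw [hterm]
    rcases s with _ | (i | (_ | s)) <;> rcases t with _ | (j | (_ | t))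
    all_goals first
      | refine (Polynomial.natDegree_monomial_le _).trans ?_
        simp [degWeight]
        done
      | simp [h0]
  have hb' : (weightHom degWeight (linSubst b q)).coeff 3 =
      X none * X (some (Sum.inl 0)) + X (some (Sum.inl 1)) * X (some (Sum.inr none)) := by
    have h1' : ∀ i, β (some (Sum.inl i)) none = if i = 0 then 1 / 2 else 0 := fun i => by
      rw [hβ, h1]
    have h2' : ∀ i, β (some (Sum.inl i)) (some (Sum.inr none)) = if i = 1 then 1 / 2 else 0 :=
      fun i => by rw [hβ, h2]
    have hhalf : (C 2⁻¹ + C 2⁻¹ : MvPolynomial (Option (Fin 4 ⊕ Option (Fin k))) ℂ) = 1 := by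
      rw [← C_add]
      norm_num
    rw [hq]
    simp only [map_sum, hterm, Polynomial.finsetSum_coeff, Polynomial.coeff_monomial]
    simp only [Fintype.sum_option, Fintype.sum_sum_type, degWeight, h1, h2, h1', h2', Fin.sum_univ_four]
    simp
    linear_combination (X none * X (some (Sum.inl 0)) +
      X (some (Sum.inl 1)) * X (some (Sum.inr none))) * hhalf
  have hcoe : ∀ P : MvPolynomial (Option (Fin 4 ⊕ Option (Fin k))) ℂ,
      (weightHom degWeight).toRingHom P = weightHom degWeight P := fun _ => rfl
  refine isPrime_span_pair_of_coeff _ (weightHom_coeff _) (weightHom_injective _) ha hb ?_ ?_ ?_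
  · rw [hcoe, hb']
    exact prime_X_mul_add (by simp) (by simp)
  · rw [hcoe, hcoe, hb', ha']
    rintro ⟨g, hg⟩
    have h3 := congrArg (eval fun s => s.elim 0 (Sum.elim (Pi.single (2 : Fin 4) (1 : ℂ)) 0)) hg
    rw [eval_rename, eval_rename] at h3
    refine hz (Eq.trans (congrArg (fun p => eval p h) (funext fun i => rfl)) (h3.trans ?_))
    simp
  · rw [hcoe, hcoe, ha', hb']
    refine isPrime_span_rename (z := Sum.elim (Pi.single 2 1) 0) (prime_rename Sum.inl_injective hprime)
      (by simp) (by simp) (by simp) ?_ (by simp) (by simp)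
    rwa [eval_rename, Sum.elim_comp_inl]

end Degeneration

section HyperbolicPairs

theorem eval_linSubst_coe {ι σ : Type*} [Fintype σ] {V : Submodule ℂ (ι → ℂ)} (b : σ → V)
    (y : σ → ℂ) (P : MvPolynomial ι ℂ) :
    eval y (linSubst (fun s => (b s : ι → ℂ)) P) = eval ((∑ s, y s • b s : V) : ι → ℂ) P := by
  rw [eval_linSubst]
  congr 2
  funext i
  simp [Submodule.coe_sum, mul_comm]

theorem linSubst_eq_sum {ι σ : Type*} [Fintype σ] {V : Submodule ℂ (ι → ℂ)} (b : σ → V)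
    {B : V →ₗ[ℂ] V →ₗ[ℂ] ℂ} {q : MvPolynomial ι ℂ} (hq : ∀ z : V, eval (z : ι → ℂ) q = B z z) :
    linSubst (fun s => (b s : ι → ℂ)) q = ∑ s, ∑ t, C (B (b s) (b t)) * X s * X t := by
  refine MvPolynomial.funext fun y => ?_
  rw [eval_linSubst_coe, hq]
  simp only [map_sum, map_smul, LinearMap.sum_apply, LinearMap.smul_apply, smul_eq_mul, map_mul,
    eval_C, eval_X, Finset.mul_sum]
  rw [Finset.sum_comm]
  refine Finset.sum_congr rfl fun s _ => Finset.sum_congr rfl fun t _ => by ring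

theorem linearIndependent_of_hyperbolic_pairs {E : Type*} [AddCommGroup E] [Module ℂ E]
    {B : E →ₗ[ℂ] E →ₗ[ℂ] ℂ} (hB : ∀ x y, B x y = B y x) {u₁ v₁ u₂ v₂ w w' : E}
    (hu₁ : B u₁ u₁ = 0) (hv₁ : B v₁ v₁ = 0) (huv₁ : B u₁ v₁ = 1 / 2) (hu₂ : B u₂ u₂ = 0)
    (hv₂ : B v₂ v₂ = 0) (huv₂ : B u₂ v₂ = 1 / 2) (h₁ : B u₁ u₂ = 0) (h₂ : B u₁ v₂ = 0)
    (h₃ : B v₁ u₂ = 0) (h₄ : B v₁ v₂ = 0)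
    (a₁ : B u₁ w = 0) (a₂ : B v₁ w = 0) (a₃ : B u₂ w = 0) (a₄ : B v₂ w = 0)
    (b₁ : B u₁ w' = 0) (b₂ : B v₁ w' = 0) (b₃ : B u₂ w' = 0) (b₄ : B v₂ w' = 0)
    (hli : LinearIndependent ℂ ![w, w']) :
    LinearIndependent ℂ (Sum.elim ![u₁, u₂, w, w'] ![v₁, v₂]) := by
  rw [Fintype.linearIndependent_iff]
  intro g hg
  rw [Fintype.sum_sum_type] at hg
  simp only [Sum.elim_inl, Sum.elim_inr, Fin.sum_univ_four, Fin.sum_univ_two] at hg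
  simp only [Matrix.cons_val] at hg
  have k1 := congrArg (B v₁) hg
  have k2 := congrArg (B v₂) hg
  have k3 := congrArg (B u₁) hg
  have k4 := congrArg (B u₂) hg
  simp only [map_add, map_smul, smul_eq_mul, map_zero, hB v₁ u₁, hB v₂ u₁, hB v₂ u₂, hB v₂ v₁,
    hB u₂ u₁, hB u₂ v₁, hu₁, hv₁, huv₁, hu₂, hv₂, huv₂, h₁, h₂, h₃, h₄, a₁, a₂, a₃, a₄, b₁, b₂, b₃,
    b₄, mul_zero, add_zero, zero_add] at k1 k2 k3 k4
  have g0 : g (Sum.inl 0) = 0 := by simpa using k1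
  have g1 : g (Sum.inl 1) = 0 := by simpa using k2
  have g2 : g (Sum.inr 0) = 0 := by simpa using k3
  have g3 : g (Sum.inr 1) = 0 := by simpa using k4
  rw [g0, g1, g2, g3] at hg
  have := Fintype.linearIndependent_iff.1 hli ![g (Sum.inl 2), g (Sum.inl 3)]
    (by simpa using hg)
  have g4 := this 0
  have g5 := this 1
  simp only [Matrix.cons_val] at g4 g5
  rintro (i | i) <;> fin_cases i <;> assumption

theorem exists_linearIndependent_mem {E : Type*} [AddCommGroup E] [Module ℂ E]
    [FiniteDimensional ℂ E] {W : Submodule ℂ E} {n : ℕ} (h : n ≤ Module.finrank ℂ W) :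
    ∃ y : Fin n → E, LinearIndependent ℂ y ∧ ∀ i, y i ∈ W := by
  obtain ⟨y, hy⟩ := exists_linearIndependent_of_le_finrank h
  exact ⟨fun i => y i, hy.map' W.subtype (Submodule.ker_subtype W), fun i => (y i).2⟩

theorem exists_isSplitForm_or_isPrime {N M : ℕ} (hM : 3 ≤ M) {V : Submodule ℂ (Fin N → ℂ)}
    (hV : 8 ≤ Module.finrank ℂ V) {B : V →ₗ[ℂ] V →ₗ[ℂ] ℂ} (hB : ∀ x y, B x y = B y x)
    (h3 : ¬ ∃ L : Fin 3 → V →ₗ[ℂ] ℂ, ∀ z, B z z = ∑ a, L a z ^ 2)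
    {q f : MvPolynomial (Fin N) ℂ} (hqh : q.IsHomogeneous 2)
    (hq : ∀ z : V, eval (z : Fin N → ℂ) q = B z z) (hf : f.totalDegree ≤ M) :
    (∃ e : Fin 4 → V, LinearIndependent ℂ e ∧
      IsSplitForm M (linSubst (fun i => (e i : Fin N → ℂ)) (homogeneousComponent M f))) ∨
    ∃ (σ : Type) (_ : Fintype σ) (b : Module.Basis σ ℂ V),
      (Ideal.span {linSubst (fun i => (b i : Fin N → ℂ)) f,
        linSubst (fun i => (b i : Fin N → ℂ)) q}).IsPrime := by
  by_contra! hcon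
  obtain ⟨hns, hnp⟩ := hcon
  obtain ⟨u₁, v₁, u₂, v₂, hu₁, hv₁, huv₁, hu₂, hv₂, huv₂, h₁, h₂, h₃, h₄⟩ :=
    exists_two_hyperbolic_pairs hB h3
  let Φ : V →ₗ[ℂ] Fin 4 → ℂ := LinearMap.pi ![B u₁, B v₁, B u₂, B v₂]
  have hΦ : ∀ z, z ∈ LinearMap.ker Φ ↔ B u₁ z = 0 ∧ B v₁ z = 0 ∧ B u₂ z = 0 ∧ B v₂ z = 0 := by
    intro z
    rw [LinearMap.mem_ker, funext_iff]
    simp [Φ, Fin.forall_fin_succ]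
  have hdim : 4 ≤ Module.finrank ℂ (LinearMap.ker Φ) := by
    have := LinearMap.finrank_range_add_finrank_ker Φ
    have h' := Submodule.finrank_le (LinearMap.range Φ)
    rw [Module.finrank_fin_fun] at h'
    omega
  obtain ⟨y, hy, hyΦ⟩ := exists_linearIndependent_mem hdim
  obtain ⟨c, hc, hcne⟩ : ∃ c, eval c (linSubst (fun i => (y i : Fin N → ℂ)) q) = 0 ∧
      eval c (linSubst (fun i => (y i : Fin N → ℂ)) (homogeneousComponent M f)) ≠ 0 := by
    by_contra! h
    exact hns _ hy (isSplitForm_of_forall_eval_eq_zero (e := 2) (by omega) two_pos (by omega)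
      (isHomogeneous_linSubst _ (homogeneousComponent_isHomogeneous _ _))
      (isHomogeneous_linSubst _ hqh) h)
  rw [eval_linSubst_coe, hq] at hc
  rw [eval_linSubst_coe] at hcne
  set w : V := ∑ s, c s • y s with hw_def
  have hwW : w ∈ LinearMap.ker Φ :=
    Submodule.sum_mem _ fun s _ => Submodule.smul_mem _ _ (hyΦ s)
  have hw0 : w ≠ 0 := by
    intro h
    apply hcne
    rw [h, Submodule.coe_zero]
    rw [MvPolynomial.eval_zero, constantCoeff_eq, coeff_homogeneousComponent, if_neg]
    rw [map_zero]
    omega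
  obtain ⟨w', hw', hw₁, hww', hli⟩ := exists_isotropic_pair hB _ hdim hwW hw0 hc
  obtain ⟨a1, a2, a3, a4⟩ := (hΦ w).1 hwW
  obtain ⟨b1, b2, b3, b4⟩ := (hΦ w').1 hw'
  have hLI := linearIndependent_of_hyperbolic_pairs hB hu₁ hv₁ huv₁ hu₂ hv₂ huv₂ h₁ h₂ h₃ h₄
    a1 a2 a3 a4 b1 b2 b3 b4 hli
  obtain ⟨k, b, hb, hb1, hb2⟩ := exists_basis_of_linearIndependent hLI
  refine hnp _ inferInstance b ?_
  have hbe : ∀ i, b (some (Sum.inl i)) = (![u₁, u₂, w, w'] : Fin 4 → V) i := hb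
  refine isPrime_span_of_hyperbolic_pairs (β := fun s t => B (b s) (b t)) (by omega)
    (fun s => (b s : Fin N → ℂ)) (linSubst_eq_sum b hq) (fun s t => hB _ _) ?_ ?_ ?_ hf ?_ ?_
  · intro i j
    simp only [hbe]
    have h0 : ∀ i, B ((![u₁, u₂, w, w'] : Fin 4 → V) i) w = 0 ∧
        B ((![u₁, u₂, w, w'] : Fin 4 → V) i) w' = 0 ∧
        B ((![u₁, u₂, w, w'] : Fin 4 → V) i) u₁ = 0 ∧
        B ((![u₁, u₂, w, w'] : Fin 4 → V) i) u₂ = 0 := by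
      rw [Fin.forall_fin_succ, Fin.forall_fin_succ, Fin.forall_fin_succ, Fin.forall_fin_succ]
      simp only [Matrix.cons_val]
      exact ⟨⟨a1, b1, hu₁, h₁⟩, ⟨a3, b3, hB u₁ u₂ ▸ h₁, hu₂⟩, ⟨hc, hww', hB u₁ w ▸ a1,
        hB u₂ w ▸ a3⟩, ⟨hB w w' ▸ hww', hw₁, hB u₁ w' ▸ b1, hB u₂ w' ▸ b3⟩, fun i => i.elim0⟩
    obtain ⟨c1, c2, c3, c4⟩ := h0 i
    fin_cases j
    exacts [c3, c4, c1, c2]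
  · intro i
    simp only [hbe, hb1]
    fin_cases i
    exacts [hB u₁ v₁ ▸ huv₁, h₃, a2, b2]
  · intro i
    simp only [hbe, hb2]
    fin_cases i
    exacts [hB u₁ v₂ ▸ h₂, hB u₂ v₂ ▸ huv₂, a4, b4]
  · exact hns _ (b.linearIndependent.comp _ ((Option.some_injective _).comp Sum.inl_injective))
  · rw [hbe]
    exact hcne

end HyperbolicPairs

section HyperplaneSections

theorem isPrime_span_insert_of_linSubst {N : ℕ} {σ : Type*} [Fintype σ] {p r : Fin N → ℂ}
    {j : Fin N} (b : Module.Basis σ ℂ (zeroSpace ![Pi.single j 1, p, r]))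
    {f q : MvPolynomial (Fin N) ℂ}
    (h : (Ideal.span {linSubst (fun i => (b i : Fin N → ℂ)) f,
        linSubst (fun i => (b i : Fin N → ℂ)) q}).IsPrime) :
    (Ideal.span {X j, linForm p, linForm r, q, f}).IsPrime := by
  set ψ := linSubst (fun i => (b i : Fin N → ℂ)) with hψ
  have hker : RingHom.ker ψ = Ideal.span (Set.range fun k =>
      linForm ((![Pi.single j 1, p, r] : Fin 3 → Fin N → ℂ) k)) :=
    ker_linSubst b fun z => mem_zeroSpace
  have hX : linForm (Pi.single j 1 : Fin N → ℂ) = X j := by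
    classical
    simp [linForm, Pi.single_apply, ite_mul, apply_ite C]
  have hrange : (Set.range fun k =>
      linForm ((![Pi.single j 1, p, r] : Fin 3 → Fin N → ℂ) k)) =
        {X j, linForm p, linForm r} := by
    ext P
    simp [Fin.exists_fin_succ, hX, eq_comm]
  have hcomap : Ideal.comap ψ (Ideal.map ψ (Ideal.span {f, q})) =
      Ideal.span {X j, linForm p, linForm r, q, f} := by
    rw [Ideal.comap_map_of_surjective' ψ (linSubst_surjective b), hker, hrange, ← Ideal.span_union]
    congr 1
    ext P
    simp only [Set.mem_union, Set.mem_insert_iff, Set.mem_singleton_iff]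
    tauto
  rw [← hcomap, Ideal.map_span, Set.image_pair]
  exact Ideal.comap_isPrime ψ _

theorem finrank_zeroSpace_three {n : ℕ} (l : Fin 3 → Fin n → ℂ) :
    n ≤ Module.finrank ℂ (zeroSpace l) + 3 := by
  let Φ : (Fin n → ℂ) →ₗ[ℂ] Fin 3 → ℂ :=
    LinearMap.pi fun k => Fintype.linearCombination ℂ (l k)
  have hΦ : LinearMap.ker Φ = zeroSpace l := by
    ext z
    rw [zeroSpace, LinearMap.ker_pi]
  have := LinearMap.finrank_range_add_finrank_ker Φ
  have h' := Submodule.finrank_le (LinearMap.range Φ)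
  rw [Module.finrank_fin_fun] at h' this
  rw [hΦ] at this
  omega

theorem exists_isSplitForm_of_not_R13 {M : ℕ} (hM : 10 ≤ M)
    {G : MvPolynomial (Fin (M + 1)) ℂ} (hG : G.IsHomogeneous M) {v : Fin (M + 1) → ℂ}
    {j : Fin (M + 1)}
    (hr : 6 ≤ rankOn (chartComp 2 G v j)
      {z : Fin (M + 1) → ℂ | z j = 0 ∧ eval z (chartComp 1 G v j) = 0})
    (h : ¬ ChartR13 G v j) :
    ∃ e : Fin 4 → {i // i ≠ j} → ℂ, LinearIndependent ℂ e ∧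
      IsSplitForm M (linSubst e (locComp M G v j)) := by
  unfold ChartR13 at h
  push Not at h
  obtain ⟨p', hp', -, hnp⟩ := h
  obtain ⟨p, rfl⟩ := exists_linForm_eq hp'
  obtain ⟨r, hr1⟩ := exists_linForm_eq (isHomogeneous_chartComp 1 G v j)
  rw [hr1] at hr hnp
  set V := zeroSpace ![Pi.single j 1, p, r] with hV_def
  have hV : ∀ z, z ∈ V ↔ z j = 0 ∧ ∑ i, p i * z i = 0 ∧ ∑ i, r i * z i = 0 := fun z => by
    simp [V, mem_zeroSpace, Fin.forall_fin_succ, Pi.single_apply]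
  have hdim : 8 ≤ Module.finrank ℂ V := by
    have : M + 1 ≤ Module.finrank ℂ V + 3 := finrank_zeroSpace_three ![Pi.single j 1, p, r]
    omega
  have hq2 := isHomogeneous_chartComp 2 G v j
  obtain ⟨t, l, hl⟩ := exists_sum_sq (chartComp 2 G v j) hq2
  let L : Fin t → V →ₗ[ℂ] ℂ := fun a => (Fintype.linearCombination ℂ (l a)).comp V.subtype
  let B : V →ₗ[ℂ] V →ₗ[ℂ] ℂ := ∑ a, (L a).smulRight (L a)
  have hBapp : ∀ x y, B x y = ∑ a, L a x * L a y := fun x y => by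
    simp [B, LinearMap.sum_apply]
  have hB : ∀ x y, B x y = B y x := fun x y => by
    simp only [hBapp, mul_comm]
  have hq : ∀ z : V, eval (z : Fin (M + 1) → ℂ) (chartComp 2 G v j) = B z z := fun z => by
    rw [hBapp, hl, map_sum]
    refine Finset.sum_congr rfl fun a _ => ?_
    rw [map_pow, eval_linForm, sq]
    simp [L, Fintype.linearCombination_apply, mul_comm]
  have h3 : ¬ ∃ L : Fin 3 → V →ₗ[ℂ] ℂ, ∀ z, B z z = ∑ a, L a z ^ 2 := by
    rintro ⟨L', hL'⟩
    choose L'' hL'' using fun a => LinearMap.exists_extend (L' a)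
    have := rankOn_le_add_two hq2 (A := {z | z j = 0 ∧ eval z (linForm r) = 0})
      (l := ![Pi.single j 1, r]) (fun z hz => by
        simpa [Fin.forall_fin_two, Pi.single_apply, eval_linForm] using hz) p L''
      fun z h1 h2 => by
        have hz : z ∈ V := by
          rw [hV]
          simp [Fin.forall_fin_two, Pi.single_apply] at h1
          exact ⟨h1.1, h2, h1.2⟩
        rw [hq ⟨z, hz⟩, hL']
        refine Finset.sum_congr rfl fun a _ => ?_
        rw [← hL'' a]
        rfl
    omega
  have hdeg : (chartShift G v j).totalDegree ≤ M := by
    rw [← rename_locShift]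
    exact (totalDegree_rename_le _ _).trans ((totalDegree_locShift_le G v j).trans
      hG.totalDegree_le)
  rcases exists_isSplitForm_or_isPrime (by omega) hdim hB h3 hq2 hq hdeg with
    ⟨e, he, hs⟩ | ⟨σ, _, b, hb⟩
  · refine ⟨fun s i => (e s : Fin (M + 1) → ℂ) i, ?_, ?_⟩
    · rw [Fintype.linearIndependent_iff] at he ⊢
      intro g hg
      refine he g ?_
      apply Subtype.ext
      funext i
      by_cases hi : i = j
      · subst hi
        exact ((hV _).1 (Submodule.coe_mem _)).1
      · have := congrFun hg ⟨i, hi⟩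
        simpa [Submodule.coe_sum] using this
    · change IsSplitForm M (linSubst _ (chartComp M G v j)) at hs
      rw [← rename_locComp] at hs
      convert hs using 1
      refine MvPolynomial.funext fun y => ?_
      rw [eval_linSubst, eval_linSubst, eval_rename]
      rfl
  · exact absurd (isPrime_span_insert_of_linSubst b hb) hnp

end HyperplaneSections

section SplitCount

variable {k F σ : Type*} [Field k] [Field F] [Algebra k F] [Fintype σ] [DecidableEq σ]

theorem rename_linSubst_of_eq_ite {R : Type*} [CommRing R] {B : Finset σ} {a : B → σ → R}
    (ha : ∀ b b' : B, a b b' = if b' = b then 1 else 0) {P : MvPolynomial σ R}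
    (hP : P.vars ⊆ B) : rename Subtype.val (linSubst a P) = P := by
  refine hom_congr_vars (f₁ := ((rename Subtype.val : MvPolynomial B R →ₐ[R] _).comp
    (linSubst a)).toRingHom) (f₂ := RingHom.id _) (p₂ := P) ?_ ?_ rfl
  · ext1 r
    simp [← algebraMap_eq]
  · intro i hi _
    have := hP hi
    simp [linSubst_X, linForm, ha _ ⟨i, this⟩]

theorem vars_sum_monomial_subset {R : Type*} [CommRing R] {B : Finset σ} {d : ℕ}
    (c : (σ →₀ ℕ) → R) : (∑ α ∈ B.finsuppAntidiag d, monomial α (c α)).vars ⊆ B := by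
  refine (vars_sum_subset _ _).trans (Finset.biUnion_subset.2 fun α hα => ?_)
  by_cases h : c α = 0
  · simp [h]
  · rw [vars_monomial h]
    exact (Finset.mem_finsuppAntidiag.1 hα).2

theorem dle_coeffSet_of_isSplit {S : Set F} {M d d' : ℕ} {Q : MvPolynomial σ F}
    (hQ : Q.IsHomogeneous M) {B : Finset σ} {a : B → σ → F}
    (ha : ∀ b b' : B, a b b' = if b' = b then 1 else 0) {f g : MvPolynomial B F}
    (hf : f.IsHomogeneous d) (hg : g.IsHomogeneous d') (h : linSubst a Q = f * g) :
    Dle k S (coeffSet Q) (B.card * Fintype.card σ + (B.card + d - 1).choose d +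
      (B.card + d' - 1).choose d' +
        ((Fintype.card σ + M - 1).choose M - (B.card + M - 1).choose M)) := by
  let T := (Finset.univ : Finset σ).finsuppAntidiag M \ B.finsuppAntidiag M
  have hBU : B.finsuppAntidiag M ⊆ (Finset.univ : Finset σ).finsuppAntidiag M :=
    Finset.finsuppAntidiag_mono (Finset.subset_univ B) M
  have hT : T.card = (Fintype.card σ + M - 1).choose M - (B.card + M - 1).choose M := by
    rw [Finset.card_sdiff_of_subset hBU, Finset.card_finsuppAntidiag_nat_eq_choose,
      Finset.card_finsuppAntidiag_nat_eq_choose, Finset.card_univ]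
  have h1 : Dle k S (Set.range fun x : B × σ => a x.1 x.2) (B.card * Fintype.card σ) := by
    have := Dle.range (k := k) (S := S) fun x : B × σ => a x.1 x.2
    rwa [Fintype.card_prod, Fintype.card_coe] at this
  have h2 := dle_coeffSet (k := k) (S := S ∪ Set.range fun x : B × σ => a x.1 x.2) hf
  have h3 := dle_coeffSet (k := k) (S := S ∪ ((Set.range fun x : B × σ => a x.1 x.2) ∪
    coeffSet f)) hg
  have h4 : Dle k (S ∪ ((Set.range fun x : B × σ => a x.1 x.2) ∪ coeffSet f ∪ coeffSet g))
      (Set.range fun α : T => coeff (α : σ →₀ ℕ) Q) _ := Dle.range _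
  rw [Fintype.card_coe, hT] at h4
  rw [Fintype.card_coe] at h2 h3
  have h5 := ((h1.trans h2).trans h3).trans h4
  refine h5.mono (subset_acl _) (coeffSet_subset_acl (σ := σ) ?_) le_rfl
  set E := acl k (S ∪ (Set.range (fun x : B × σ => a x.1 x.2) ∪ coeffSet f ∪ coeffSet g ∪
    Set.range fun α : T => coeff (α : σ →₀ ℕ) Q)) with hE
  have hfE : f ∈ polyOver B E := mem_polyOver_acl_of_coeffSet_subset fun x hx =>
    Or.inr (Or.inl (Or.inl (Or.inr hx)))
  have hgE : g ∈ polyOver B E := mem_polyOver_acl_of_coeffSet_subset fun x hx =>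
    Or.inr (Or.inl (Or.inr hx))
  have haE : ∀ b i, a b i ∈ E := fun b i =>
    subset_acl _ (Or.inr (Or.inl (Or.inl (Or.inl ⟨(b, i), rfl⟩))))
  let Q' := ∑ α ∈ T, monomial α (coeff α Q)
  let QB := ∑ α ∈ B.finsuppAntidiag M, monomial α (coeff α Q)
  have hQ' : Q' ∈ polyOver σ E := sum_mem fun α hα => by
    have : coeff α Q ∈ E := subset_acl _ (Or.inr (Or.inr ⟨⟨α, hα⟩, rfl⟩))
    exact ⟨monomial α ⟨_, this⟩, by rw [map_monomial]; rfl⟩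
  have hsum : Q' + QB = Q := by
    rw [Finset.sum_sdiff hBU]
    conv_rhs => rw [Q.as_sum]
    refine (Finset.sum_subset (fun α hα => ?_) fun α _ hα => ?_).symm
    · rw [Finset.mem_finsuppAntidiag]
      refine ⟨?_, Finset.subset_univ _⟩
      have : ¬ α.degree ≠ M := fun h => mem_support_iff.1 hα (hQ.coeff_eq_zero h)
      rw [← not_not.1 this, Finsupp.degree_eq_sum]
    · rw [notMem_support_iff.1 hα, map_zero]
  have hQB : QB = rename Subtype.val (f * g - linSubst a Q') := by
    rw [← h, ← map_sub, ← hsum, add_sub_cancel_left,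
      rename_linSubst_of_eq_ite ha (vars_sum_monomial_subset _)]
  rw [← hsum, hQB]
  have hsub : linSubst a Q' ∈ polyOver B E :=
    aeval_mem_polyOver (fun i => linForm_mem_polyOver fun b => haE b i) hQ'
  refine add_mem hQ' ?_
  rw [rename_eq_aeval]
  exact aeval_mem_polyOver (fun i => X_mem_polyOver _) (sub_mem (mul_mem hfE hgE) hsub)

theorem choose_three_add_choose_three_le {d d' : ℕ} (hd : 0 < d) (hd' : 0 < d') :
    (d + 3).choose 3 + (d' + 3).choose 3 ≤ 4 + (d + d' + 2).choose 3 := by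
  induction d', hd' using Nat.le_induction with
  | base => rw [add_comm]; rfl
  | succ n hn ih =>
    have h1 : (n + 1 + 3).choose 3 = (n + 3).choose 2 + (n + 3).choose 3 := Nat.choose_succ_succ _ _
    have h2 : (d + (n + 1) + 2).choose 3 = (d + n + 2).choose 2 + (d + n + 2).choose 3 :=
      Nat.choose_succ_succ _ _
    have h3 : (n + 3).choose 2 ≤ (d + n + 2).choose 2 := Nat.choose_le_choose 2 (by omega)
    omega

theorem isSplit_count_le {M D d d' : ℕ} (hM : 10 ≤ M) (hD : 2 * D ≤ (M - 6) * (M - 5))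
    (hd : 0 < d) (hd' : 0 < d') (hdd : d + d' = M) :
    4 * M + (4 + d - 1).choose d + (4 + d' - 1).choose d' +
      ((M + M - 1).choose M - (4 + M - 1).choose M) + D ≤ (M + M - 1).choose M := by
  have h4 : ∀ n, (4 + n - 1).choose n = (n + 3).choose 3 := fun n => by
    rw [show 4 + n - 1 = n + 3 by omega, Nat.choose_symm_add]
  rw [h4, h4, h4]
  have h1 := choose_three_add_choose_three_le hd hd'
  rw [hdd] at h1
  have h2 : (M + 3).choose 3 = (M + 2).choose 2 + (M + 2).choose 3 := Nat.choose_succ_succ _ _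
  have h3 : (M + 3).choose 3 ≤ (M + M - 1).choose M := by
    rw [← Nat.choose_symm_add]
    exact Nat.choose_le_choose M (by omega)
  have h5 : 4 * M + 4 + D ≤ (M + 2).choose 2 := by
    rw [Nat.choose_two_right, Nat.le_div_iff_mul_le two_pos]
    obtain ⟨m, rfl⟩ := Nat.exists_eq_add_of_le hM
    simp only [show 10 + m - 6 = m + 4 by omega, show 10 + m - 5 = m + 5 by omega] at hD
    rw [show 10 + m + 2 - 1 = m + 11 by omega]
    nlinarith
  omega

end SplitCount

theorem exists_isSplitForm_normalized {σ : Type*} [Fintype σ] [DecidableEq σ] {M : ℕ}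
    (hσ : 4 ≤ Fintype.card σ) {e : Fin 4 → σ → ℂ} (he : LinearIndependent ℂ e)
    {Q : MvPolynomial σ ℂ} (hs : IsSplitForm M (linSubst e Q)) :
    ∃ (B : Finset σ) (a : B → σ → ℂ), B.card = 4 ∧
      (∀ b b' : B, a b b' = if b' = b then 1 else 0) ∧ IsSplitForm M (linSubst a Q) := by
  obtain ⟨B, c, hB, hc⟩ := exists_finset_coordinates
    (fun i : σ => Fintype.linearCombination ℂ fun s => e s i) (by simpa using hσ)
  rw [Module.finrank_fin_fun] at hB
  let Φ : (Fin 4 → ℂ) →ₗ[ℂ] B → ℂ :=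
    LinearMap.pi fun b => Fintype.linearCombination ℂ fun s => e s b
  have hΦ : ∀ y b, Φ y b = ∑ s, y s * e s b := fun y b => by
    simp [Φ, Fintype.linearCombination_apply]
  have hc' : ∀ y i, ∑ s, y s * e s i = ∑ b, c i b * Φ y b := fun y i => by
    have := LinearMap.congr_fun (hc i) y
    simpa [Fintype.linearCombination_apply, LinearMap.sum_apply, hΦ] using this
  have hinj : Function.Injective Φ := by
    rw [← LinearMap.ker_eq_bot, LinearMap.ker_eq_bot']
    intro y hy
    have := Fintype.linearIndependent_iff.1 he y (by
      funext i
      simpa [hy] using hc' y i)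
    exact funext this
  have hsurj : Function.Surjective Φ :=
    (LinearMap.injective_iff_surjective_of_finrank_eq_finrank (by simp [hB])).1 hinj
  choose y hy using fun b : B => hsurj (Pi.single b 1)
  refine ⟨B, fun b i => ∑ s, y b s * e s i, hB, fun b b' => ?_, ?_⟩
  · change ∑ s, y b s * e s b' = _
    rw [← hΦ, hy, Pi.single_apply]
  · obtain ⟨d, d', f, g, hd, hd', hdd, hf, hg, hfg⟩ := hs
    refine ⟨d, d', linSubst y f, linSubst y g, hd, hd', hdd, isHomogeneous_linSubst _ hf,
      isHomogeneous_linSubst _ hg, ?_⟩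
    rw [← map_mul, ← hfg]
    refine MvPolynomial.funext fun x => ?_
    rw [eval_linSubst, eval_linSubst, eval_linSubst]
    congr 2
    funext i
    simp only [Finset.sum_mul, Finset.mul_sum]
    rw [Finset.sum_comm]
    refine Finset.sum_congr rfl fun s _ => Finset.sum_congr rfl fun b _ => by ring

section IrreducibleSections

theorem exists_normalized_of_not_R13 {M : ℕ} (hM : 10 ≤ M)
    {G : MvPolynomial (Fin (M + 1)) ℂ} (hG : G.IsHomogeneous M) {v : Fin (M + 1) → ℂ}
    {j : Fin (M + 1)}
    (hr : 6 ≤ rankOn (chartComp 2 G v j)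
      {z : Fin (M + 1) → ℂ | z j = 0 ∧ eval z (chartComp 1 G v j) = 0})
    (h : ¬ ChartR13 G v j) :
    ∃ (x : Finset {i // i ≠ j} × Fin (M + 1)) (a : x.1 → {i // i ≠ j} → ℂ)
      (fg : Fin 2 → MvPolynomial x.1 ℂ), x.1.card = 4 ∧ 0 < (x.2 : ℕ) ∧ 0 < M - x.2 ∧
        (∀ b b' : x.1, a b b' = if b' = b then 1 else 0) ∧ (fg 0).IsHomogeneous x.2 ∧
        (fg 1).IsHomogeneous (M - x.2) ∧ linSubst a (locComp M G v j) = fg 0 * fg 1 := by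
  have hcard : Fintype.card {i // i ≠ j} = M := by simp [Fintype.card_subtype_compl]
  obtain ⟨e, he, hs⟩ := exists_isSplitForm_of_not_R13 hM hG hr h
  obtain ⟨B, a, hB, ha, d, d', f, g, hd, hd', hdd, hf, hg, hfg⟩ :=
    exists_isSplitForm_normalized (by omega) he hs
  have hdM : d < M + 1 := by omega
  obtain rfl : d' = M - d := by omega
  exact ⟨(B, ⟨d, hdM⟩), a, ![f, g], hB, hd, hd', ha, hf, hg, hfg⟩

variable {M : ℕ} {j : Fin (M + 1)} {I : Type} (U : Ultrafilter I)
  {G : I → MvPolynomial (Fin (M + 1)) ℂ} {v : I → Fin (M + 1) → ℂ} (S : Set (UPow U))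

theorem exists_dle_of_not_R13 (hM : 10 ≤ M) {D : ℕ} (hD : 2 * D ≤ (M - 6) * (M - 5))
    (hG : ∀ a, (G a).IsHomogeneous M)
    (hr : ∀ᶠ a in (U : Filter I), ChartR12 (G a) (v a) j)
    (h : ∀ᶠ a in (U : Filter I), ¬ ChartR13 (G a) (v a) j) :
    ∃ e, Dle ℂ S (⋃ i < M - 1, coeffSet (ultraComp U j G v (i + 2))) e ∧ e + D ≤
      ∑ i ∈ Finset.range (M - 1), (M + (i + 2) - 1).choose (i + 2) := by
  have hcard : Fintype.card {i // i ≠ j} = M := by simp [Fintype.card_subtype_compl]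
  obtain ⟨⟨B, d⟩, hT⟩ := Ultrafilter.eventually_exists_iff.1 ((hr.and h).mono fun i hi =>
    exists_normalized_of_not_R13 hM (hG i) hi.1.1 hi.2)
  obtain ⟨a, hT⟩ := hT.choice
  obtain ⟨fg, hT⟩ := hT.choice
  obtain ⟨hB, hd, hd', -⟩ := hT.exists.choose_spec
  simp only at hB hd hd'
  have ha : ∀ b b' : B, (toUPow U fun i => a i b b') = if b' = b then 1 else 0 := by
    intro b b'
    have : (toUPow U fun i => a i b b') = toUPow U (if b' = b then 1 else 0) := by
      rw [toUPow_eq_iff]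
      refine hT.mono fun i hi => ?_
      rw [hi.2.2.2.1 b b']
      split_ifs <;> rfl
    rw [this]
    split_ifs <;> simp
  have hsplit : linSubst (fun b s => toUPow U fun i => a i b s) (ultraComp U j G v M) =
      ultraPoly U d (fun i => fg i 0) * ultraPoly U (M - d) fun i => fg i 1 := by
    have := map_toUPow_congr U
      (P := linSubst (fun b s i => a i b s) (liftPoly M fun i => locComp M (G i) (v i) j))
      (Q := liftPoly d (fun i => fg i 0) * liftPoly (M - d) fun i => fg i 1)
      (hT.mono fun i hi => by
        rw [map_linSubst, map_liftPoly_locComp, map_mul,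
          map_liftPoly (p := fun i => fg i 0) hi.2.2.2.2.1,
          map_liftPoly (p := fun i => fg i 1) hi.2.2.2.2.2.1]
        exact hi.2.2.2.2.2.2)
    rw [map_linSubst, map_mul] at this
    exact this
  have hdle := dle_coeffSet_of_isSplit (k := ℂ) (S := S) (isHomogeneous_ultraComp U M) ha
    (isHomogeneous_ultraPoly U _ _) (isHomogeneous_ultraPoly U _ _) hsplit
  have hM2 : M - 2 + 2 = M := by omega
  have := exists_dle_iUnion_of_single (k := ℂ) (S := S) (m := M - 1)
    (Q := fun i => ultraComp U j G v (i + 2)) (fun i _ => isHomogeneous_ultraComp U _)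
    (i₀ := M - 2) (by omega) (c := D) (by simpa only [hM2] using hdle) (by
      rw [hcard, hB, hM2]
      exact isSplit_count_le hM hD hd hd' (by omega))
  simpa only [hcard] using this

theorem exists_dle_of_nonsingular (hM : 10 ≤ M) {D : ℕ} (hD : 2 * D ≤ (M - 6) * (M - 5))
    (hG : ∀ a, (G a).IsHomogeneous M)
    (h1 : ∀ᶠ a in (U : Filter I), chartComp 1 (G a) (v a) j ≠ 0)
    (hS : coeffSet (ultraComp U j G v 1) ⊆ S)
    (h : ∀ᶠ a in (U : Filter I), ¬ (ChartR11 (G a) (v a) j ∧ ChartR12 (G a) (v a) j ∧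
      ChartR13 (G a) (v a) j)) :
    ∃ e, Dle ℂ S (⋃ i < M - 1, coeffSet (ultraComp U j G v (i + 2))) e ∧ e + D ≤
      ∑ i ∈ Finset.range (M - 1), (M + (i + 2) - 1).choose (i + 2) := by
  have h' : ∀ᶠ a in (U : Filter I), ¬ ChartR11 (G a) (v a) j ∨ ¬ ChartR12 (G a) (v a) j ∨
      (ChartR12 (G a) (v a) j ∧ ¬ ChartR13 (G a) (v a) j) := h.mono fun a ha => by tauto
  rw [Ultrafilter.eventually_or, Ultrafilter.eventually_or, Filter.eventually_and] at h'
  rcases h' with h | h | ⟨hr, h⟩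
  · exact exists_dle_of_not_R11 U S hM hD h1 hS h
  · exact exists_dle_of_not_R12 U S hM hD h1 hS h
  · exact exists_dle_of_not_R13 U S hM hD hG hr h

end IrreducibleSections

section Counting

theorem sum_range_add_choose_self (m n : ℕ) :
    ∑ d ∈ Finset.range (n + 1), (m + d).choose d = (m + n + 1).choose n := by
  induction n with
  | zero => simp
  | succ n ih =>
    rw [Finset.sum_range_succ, ih]
    exact (Nat.choose_succ_succ (m + n + 1) n).symm

theorem sum_range_choose_add {M : ℕ} (hM : 10 ≤ M) :
    ∑ i ∈ Finset.range (M - 1), (M + (i + 2) - 1).choose (i + 2) + (M + 1) =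
      (M + 1 + M - 1).choose M := by
  have h := sum_range_add_choose_self (M - 1) M
  rw [show M + 1 = (M - 1) + 1 + 1 by omega, Finset.sum_range_succ', Finset.sum_range_succ',
    show M - 1 + M + 1 = M + 1 + M - 1 by omega] at h
  rw [← h, add_assoc]
  congr 1
  · refine Finset.sum_congr rfl fun i _ => ?_
    rw [show M + (i + 2) - 1 = M - 1 + (i + 1 + 1) by omega]
  · simp only [zero_add, Nat.choose_one_right, Nat.choose_zero_right]
    omega

variable {M : ℕ} {j : Fin (M + 1)} {I : Type} (U : Ultrafilter I)
  {G : I → MvPolynomial (Fin (M + 1)) ℂ} {v : I → Fin (M + 1) → ℂ}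

theorem dle_coeffSet_ultraPoly (hG : ∀ i, (G i).IsHomogeneous M)
    (hv : ∀ᶠ i in (U : Filter I), v i j = 1 ∧ eval (v i) (G i) = 0) {S : Set (UPow U)}
    (hSv : Set.range (fun s : {s // s ≠ j} => toUPow U fun i => v i s) ⊆ S)
    (hS : coeffSet (ultraComp U j G v 1) ⊆ S) {w e : ℕ} (hw : Dle ℂ ∅ S w)
    (he : Dle ℂ S (⋃ i < M - 1, coeffSet (ultraComp U j G v (i + 2))) e) :
    Dle ℂ ∅ (coeffSet (ultraPoly U M G)) (w + e) := by
  have h := hw.trans (e := e) (by simpa using he)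
  refine h.mono (subset_acl _) ((coeffSet_ultraPoly_subset U j G hG v hv).trans
    (acl_mono ?_)) le_rfl
  rw [Set.empty_union]
  refine Set.union_subset (hSv.trans Set.subset_union_left) (Set.iUnion₂_subset fun d hd => ?_)
  rcases d with _ | d
  · exact hS.trans Set.subset_union_left
  · refine Set.Subset.trans ?_ Set.subset_union_right
    refine Set.subset_iUnion₂_of_subset d ?_ subset_rfl
    have := Finset.mem_range.1 hd
    omega

theorem exists_dle_coeffSet_ultraPoly (hM : 10 ≤ M) (hG : ∀ i, (G i).IsHomogeneous M)
    (hv : ∀ᶠ i in (U : Filter I), v i j = 1 ∧ eval (v i) (G i) = 0)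
    (h : ∀ᶠ a in (U : Filter I),
      ¬ ((chartComp 1 (G a) (v a) j ≠ 0 →
          ChartR11 (G a) (v a) j ∧ ChartR12 (G a) (v a) j ∧ ChartR13 (G a) (v a) j) ∧
        (chartComp 1 (G a) (v a) j = 0 →
          ChartR21 (G a) (v a) j ∧ ChartR22 (G a) (v a) j ∧ ChartR23 (G a) (v a) j))) :
    Dle ℂ ∅ (coeffSet (ultraPoly U M G))
      ((M + 1 + M - 1).choose M - ((M - 7) * (M - 6) / 2 - 5)) := by
  have hcard : Fintype.card {i // i ≠ j} = M := by simp [Fintype.card_subtype_compl]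
  have hN := sum_range_choose_add hM
  have h1 : Dle ℂ (∅ : Set (UPow U))
      (Set.range (fun s : {s // s ≠ j} => toUPow U fun i => v i s)) M := by
    simpa only [hcard] using Dle.range (k := ℂ) (S := (∅ : Set (UPow U)))
      (fun s : {s // s ≠ j} => toUPow U fun i => v i s)
  have h2 : Dle ℂ (∅ ∪ Set.range (fun s : {s // s ≠ j} => toUPow U fun i => v i s))
      (coeffSet (ultraComp U j G v 1)) M := by
    simpa only [hcard, Nat.add_sub_cancel, Nat.choose_one_right] using
      dle_coeffSet (k := ℂ) (S := ∅ ∪ Set.range (fun s : {s // s ≠ j} => toUPow U fun i => v i s))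
        (isHomogeneous_ultraComp U (j := j) (G := G) (v := v) 1)
  have h' := h.mono fun a ha => not_and_or.1 ha
  have hx : 12 ≤ (M - 7) * (M - 6) := by
    obtain ⟨m, rfl⟩ := Nat.exists_eq_add_of_le hM
    simp only [show 10 + m - 7 = m + 3 by omega, show 10 + m - 6 = m + 4 by omega]
    nlinarith
  have hx' : (M - 6) * (M - 5) + 12 = (M - 7) * (M - 6) + 2 * M := by
    obtain ⟨m, rfl⟩ := Nat.exists_eq_add_of_le hM
    simp only [show 10 + m - 7 = m + 3 by omega, show 10 + m - 6 = m + 4 by omega,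
      show 10 + m - 5 = m + 5 by omega]
    ring
  rw [Ultrafilter.eventually_or] at h'
  rcases h' with h | h
  · have hne := h.mono fun a ha => (Classical.not_imp.1 ha).1
    have hbad := h.mono fun a ha => (Classical.not_imp.1 ha).2
    obtain ⟨e, he, hes⟩ := exists_dle_of_nonsingular U (Set.range
      (fun s : {s // s ≠ j} => toUPow U fun i => v i s) ∪ coeffSet (ultraComp U j G v 1))
      (D := (M - 7) * (M - 6) / 2 - 5 + (M - 1)) hM (by omega) hG hne Set.subset_union_right hbad
    refine (dle_coeffSet_ultraPoly U hG hv Set.subset_union_left Set.subset_union_right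
      (h1.trans h2) he).mono (subset_acl _) (Set.subset_union_right.trans (subset_acl _)) ?_
    omega
  · have hne := h.mono fun a ha => (Classical.not_imp.1 ha).1
    have hbad := h.mono fun a ha => (Classical.not_imp.1 ha).2
    have hzero : ultraComp U j G v 1 = 0 := by
      rw [ultraComp_eq_map U (P := 0), map_zero]
      refine hne.mono fun a ha => ?_
      rw [map_zero]
      refine rename_injective _ Subtype.val_injective ?_
      rw [rename_locComp, ha, map_zero]
    have hcoeff : coeffSet (ultraComp U j G v 1) ⊆ {0} := by
      rw [hzero]
      rintro _ ⟨α, rfl⟩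
      simp
    obtain ⟨e, he, hes⟩ := exists_dle_of_singular U (Set.range
      (fun s : {s // s ≠ j} => toUPow U fun i => v i s) ∪ coeffSet (ultraComp U j G v 1))
      (D := (M - 7) * (M - 6) / 2 - 5 - 1) hM (by omega) hbad
    refine (dle_coeffSet_ultraPoly U hG hv Set.subset_union_left Set.subset_union_right
      (h1.trans (Dle.of_subset_acl ?_ 0)) he).mono (subset_acl _)
        (Set.subset_union_right.trans (subset_acl _)) ?_
    · refine hcoeff.trans (Set.singleton_subset_iff.2 (zero_mem _))
    · omega

/-- The coefficients of a form of degree `M`. -/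
def formCoeffs (M : ℕ) : FSpace M →ₗ[ℂ]
    ((Finset.univ : Finset (Fin (M + 1))).finsuppAntidiag M → ℂ) :=
  LinearMap.pi fun α => (lcoeff ℂ (α : Fin (M + 1) →₀ ℕ)).comp (Submodule.subtype _)

theorem formCoeffs_apply (F : FSpace M) (α : (Finset.univ : Finset (Fin (M + 1))).finsuppAntidiag M) :
    formCoeffs M F α = coeff (α : Fin (M + 1) →₀ ℕ) (F : MvPolynomial (Fin (M + 1)) ℂ) := rfl

theorem formCoeffs_bijective : Function.Bijective (formCoeffs M) := by
  classical
  have hmem : ∀ α : Fin (M + 1) →₀ ℕ,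
      α ∈ (Finset.univ : Finset (Fin (M + 1))).finsuppAntidiag M ↔ α.degree = M := fun α => by
    rw [Finset.mem_finsuppAntidiag, Finsupp.degree_eq_sum]
    simp
  constructor
  · intro F F' h
    refine Subtype.ext (MvPolynomial.ext _ _ fun α => ?_)
    by_cases hα : α.degree = M
    · exact congrFun h ⟨α, (hmem α).2 hα⟩
    · rw [((mem_homogeneousSubmodule _ _).1 F.2).coeff_eq_zero hα,
        ((mem_homogeneousSubmodule _ _).1 F'.2).coeff_eq_zero hα]
  · intro c
    refine ⟨⟨∑ α : (Finset.univ : Finset (Fin (M + 1))).finsuppAntidiag M,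
      monomial (α : Fin (M + 1) →₀ ℕ) (c α), (mem_homogeneousSubmodule _ _).2
      (IsHomogeneous.sum _ _ _ fun α _ => isHomogeneous_monomial _ ((hmem α).1 α.2))⟩, ?_⟩
    funext α
    rw [formCoeffs_apply]
    simp [coeff_sum, coeff_monomial]

theorem finrank_FSpace : Module.finrank ℂ (FSpace M) = (M + 1 + M - 1).choose M := by
  rw [(LinearEquiv.ofBijective (formCoeffs M) formCoeffs_bijective).finrank_eq,
    Module.finrank_fintype_fun_eq_card, Fintype.card_coe,
    Finset.card_finsuppAntidiag_nat_eq_choose, Finset.card_univ, Fintype.card_fin]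

theorem dle_formCoeffs_of_not_FRegular (hM : 10 ≤ M)
    (U : Ultrafilter {F : FSpace M | ¬ FRegular (F : MvPolynomial (Fin (M + 1)) ℂ)}) :
    Dle ℂ ∅ (Set.range fun α => toUPow U (fun F => formCoeffs M (F : FSpace M) α))
      ((M + 1 + M - 1).choose M - ((M - 7) * (M - 6) / 2 - 5)) := by
  have hbad : ∀ F : {F : FSpace M | ¬ FRegular (F : MvPolynomial (Fin (M + 1)) ℂ)},
      ∃ (j : Fin (M + 1)) (v : Fin (M + 1) → ℂ), (v j = 1 ∧ eval v F.1.1 = 0) ∧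
        ¬ ((chartComp 1 F.1.1 v j ≠ 0 →
          ChartR11 F.1.1 v j ∧ ChartR12 F.1.1 v j ∧ ChartR13 F.1.1 v j) ∧
        (chartComp 1 F.1.1 v j = 0 →
          ChartR21 F.1.1 v j ∧ ChartR22 F.1.1 v j ∧ ChartR23 F.1.1 v j)) := by
    intro F
    by_contra! h
    exact F.2 fun v j hv hF => h j v ⟨hv, hF⟩
  obtain ⟨j, hj⟩ := Ultrafilter.eventually_exists_iff.1 (Filter.Eventually.of_forall
    (f := (U : Filter _)) hbad)
  obtain ⟨v, hv⟩ := hj.choice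
  have hG : ∀ F : {F : FSpace M | ¬ FRegular (F : MvPolynomial (Fin (M + 1)) ℂ)},
      (F.1.1).IsHomogeneous M := fun F => (mem_homogeneousSubmodule _ _).1 F.1.2
  refine (exists_dle_coeffSet_ultraPoly U hM hG (hv.mono fun F h => h.1)
    (hv.mono fun F h => h.2)).mono (subset_acl _) ?_ le_rfl
  refine Set.Subset.trans ?_ (Set.subset_union_right.trans (subset_acl _))
  rintro _ ⟨α, rfl⟩
  refine ⟨α, coeff_ultraPoly U M _ ?_⟩
  have := (Finset.mem_finsuppAntidiag.1 α.2).1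
  rw [Finsupp.degree_eq_sum]
  exact this

end Counting

/-- Proposition 2.6: for `M ≥ 10`, the complement of the regular
locus `ℱ_reg` in the space `ℱ` of hypersurfaces of degree `M` in `ℙ^M` has
codimension at least `(M−7)(M−6)/2 − 5`. -/
theorem codim_Freg (M : ℕ) (hM : 10 ≤ M) :
    zdim {F : FSpace M | ¬ FRegular (F : MvPolynomial (Fin (M + 1)) ℂ)}
        + (((M - 7) * (M - 6) / 2 - 5 : ℕ) : ℕ∞)
      ≤ ((Module.finrank ℂ (FSpace M) : ℕ∞) : WithBot ℕ∞) := by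
  have h := zdim_le_of_forall_ultrafilter formCoeffs_bijective.injective
    (dle_formCoeffs_of_not_FRegular hM)
  have hle : (M - 7) * (M - 6) / 2 - 5 ≤ (M + 1 + M - 1).choose M := by
    refine le_trans ?_ (choose_two_le_choose (by omega) (by omega))
    rw [Nat.choose_two_right]
    refine (Nat.sub_le _ _).trans (Nat.div_le_div_right (Nat.mul_le_mul ?_ ?_)) <;> omega
  rw [finrank_FSpace]
  refine (add_le_add_left h _).trans (le_of_eq ?_)
  have key (a b : ℕ) : ((a : ℕ) : WithBot ℕ∞) + ((b : ℕ∞) : WithBot ℕ∞)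
      = (((a + b : ℕ) : ℕ∞) : WithBot ℕ∞) := by
    rw [Nat.cast_add]
    rfl
  rw [key, Nat.sub_add_cancel hle]
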